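/- Let n ≥ 2 and let f : B → ℝⁿ \ {0} be a K-quasiregular mapping in the Miniowitz class (Min) with constants C₀, α, satisfying the multiplicity condition (M) with exponent 0 ≤ a < n−1 and constant C₁. Fix κ > 0. Then for every p > 0 the following are equivalent: (1) f ∈ H^p; (2) the non-tangential limit f̃(ω) exists for σ-a.e. ω ∈ S^{n−1} and f̃ ∈ L^p(S^{n−1}, σ); (3) f* ∈ L^p(S^{n−1}, σ). Moreover there is a constant c ≥ 1 depending only on n, p, a, K, α, κ, C₀, C₁ such that c⁻¹‖f‖_{H^p} ≤ ‖f*‖_{L^p(σ)} ≤ c‖f‖_{H^p} and c⁻¹‖f‖_{H^p} ≤ ‖f̃‖_{L^p(σ)} ≤ c‖f‖_{H^p}. -/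

import Mathlib

open MeasureTheory Metric Set Filter
open scoped ENNReal NNReal Topology Classical

noncomputable section

abbrev Vec (n : ℕ) := EuclideanSpace ℝ (Fin n)

/-- The open unit ball in `ℝⁿ`. -/
def unitBall (n : ℕ) : Set (Vec n) := Metric.ball 0 1

/-- The unit sphere `S^{n-1}` in `ℝⁿ`. -/
def unitSphere (n : ℕ) : Set (Vec n) := Metric.sphere 0 1

/-- Surface measure on the unit sphere, modelled by `(n-1)`-dimensional
Hausdorff measure restricted to the sphere. -/
def sphMeasure (n : ℕ) : Measure (Vec n) := (μH[(n : ℝ) - 1]).restrict (unitSphere n)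

/-- `f` is `K`-quasiregular on the unit ball. -/
def IsQR (n : ℕ) (K : ℝ) (f : Vec n → Vec n) : Prop :=
  ContinuousOn f (unitBall n) ∧
  (∀ x ∈ unitBall n, DifferentiableAt ℝ f x) ∧
  (∀ᵐ x ∂(volume.restrict (unitBall n)),
    ‖fderiv ℝ f x‖ ^ n ≤ K * (fderiv ℝ f x).det)

/-- The conformal automorphism `T_x` of the unit ball (with `T_0 = id`). -/
def mobiusT (n : ℕ) (x : Vec n) (y : Vec n) : Vec n :=
  if x = 0 then y
  else (‖x‖ ^ 2 * ‖y - (‖x‖ ^ 2)⁻¹ • x‖ ^ 2)⁻¹ •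
    ((1 - ‖x‖ ^ 2) • (y - x) - ‖y - x‖ ^ 2 • x)

/-- The Miniowitz class (Min) with constants `C₀, α`. -/
def InMiniowitz (n : ℕ) (C₀ α : ℝ) (f : Vec n → Vec n) : Prop :=
  ∀ x ∈ unitBall n, ∀ y ∈ unitBall n,
    C₀⁻¹ * ((1 - ‖y‖) / (1 + ‖y‖)) ^ α ≤ ‖f (mobiusT n (-x) y)‖ / ‖f (mobiusT n (-x) 0)‖ ∧
    ‖f (mobiusT n (-x) y)‖ / ‖f (mobiusT n (-x) 0)‖ ≤ C₀ * ((1 + ‖y‖) / (1 - ‖y‖)) ^ α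

/-- The multiplicity condition (M) with exponent `a` and constant `C₁`. -/
def MultCond (n : ℕ) (a C₁ : ℝ) (f : Vec n → Vec n) : Prop :=
  ∀ x ∈ unitBall n, ∀ r : ℝ, 0 < r → r < 1 → ∀ y : Vec n,
    (({z ∈ Metric.ball (0 : Vec n) r | f (mobiusT n (-x) z) = y}).encard : ℝ≥0∞) ≤
      ENNReal.ofReal (C₁ / (1 - r) ^ a)

/-- The non-tangential region `Γ(ω)` with aperture parameter `κ`. -/
def ntRegion (n : ℕ) (κ : ℝ) (ω : Vec n) : Set (Vec n) :=
  {x ∈ unitBall n | ‖x - ω‖ < (1 + κ) * (1 - ‖x‖)}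

/-- The non-tangential maximal function `f*`. -/
def ntMax (n : ℕ) (κ : ℝ) (f : Vec n → Vec n) (ω : Vec n) : ℝ≥0∞ :=
  ⨆ x ∈ ntRegion n κ ω, ENNReal.ofReal ‖f x‖

/-- `f` has the non-tangential limit `L` at `ω`. -/
def HasNTLimit (n : ℕ) (κ : ℝ) (f : Vec n → Vec n) (ω L : Vec n) : Prop :=
  Filter.Tendsto f (𝓝[ntRegion n κ ω] ω) (𝓝 L)

/-- The `p`-th mean of `f` on the sphere of radius `r`. -/
def hardyMean (n : ℕ) (p : ℝ) (f : Vec n → Vec n) (r : ℝ) : ℝ≥0∞ :=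
  (sphMeasure n (unitSphere n))⁻¹ *
    ∫⁻ ω, ENNReal.ofReal (‖f (r • ω)‖ ^ p) ∂(sphMeasure n)

/-- The Hardy `H^p` norm of `f` on the unit ball. -/
def hardyNorm (n : ℕ) (p : ℝ) (f : Vec n → Vec n) : ℝ≥0∞ :=
  (⨆ r ∈ Set.Ioo (0 : ℝ) 1, hardyMean n p f r) ^ (1 / p)

/-- `f` belongs to the Hardy space `H^p`. -/
def MemHp (n : ℕ) (p : ℝ) (f : Vec n → Vec n) : Prop := hardyNorm n p f < ⊤

/-- The `L^p(σ)` norm of a boundary function on the unit sphere. -/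
def lpSphere (n : ℕ) (p : ℝ) (g : Vec n → Vec n) : ℝ≥0∞ :=
  (∫⁻ ω, ENNReal.ofReal (‖g ω‖ ^ p) ∂(sphMeasure n)) ^ (1 / p)

/-- The `L^p(σ)` norm of the non-tangential maximal function `f*`. -/
def ntMaxLp (n : ℕ) (κ p : ℝ) (f : Vec n → Vec n) : ℝ≥0∞ :=
  (∫⁻ ω, (ntMax n κ f ω) ^ p ∂(sphMeasure n)) ^ (1 / p)

/-- `μ` is a Carleson measure on the unit ball with constant `c`. -/
def IsCarleson (n : ℕ) (c : ℝ) (μ : Measure (Vec n)) : Prop :=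
  ∀ ω ∈ unitSphere n, ∀ r : ℝ, 0 < r →
    μ (unitBall n ∩ Metric.ball ω r) ≤ ENNReal.ofReal c * ENNReal.ofReal r ^ ((n : ℝ) - 1)

/-- `μ` is an `α`-Carleson measure on the unit ball with constant `γ`. -/
def IsAlphaCarleson (n : ℕ) (α γ : ℝ) (μ : Measure (Vec n)) : Prop :=
  ∀ ω ∈ unitSphere n, ∀ r : ℝ, 0 < r →
    μ (unitBall n ∩ Metric.ball ω r) ≤
      ENNReal.ofReal γ * ENNReal.ofReal r ^ (α * ((n : ℝ) - 1))

theorem abs_det_le_norm_pow {n : ℕ} (A : Vec n →L[ℝ] Vec n) : |A.det| ≤ ‖A‖ ^ n := by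
  have h1 : volume (A '' closedBall 0 1) = ENNReal.ofReal |A.det| * volume (closedBall (0 : Vec n) 1) :=
    Measure.addHaar_image_continuousLinearMap volume A _
  have h2 : A '' closedBall 0 1 ⊆ closedBall (0 : Vec n) ‖A‖ := by
    rintro _ ⟨x, hx, rfl⟩
    rw [mem_closedBall_zero_iff] at *
    simpa using A.le_of_opNorm_le_of_le le_rfl hx
  have h3 := measure_mono (μ := volume) h2
  rw [h1, Measure.addHaar_closedBall volume _ (norm_nonneg _),
    Measure.addHaar_closedBall volume _ zero_le_one] at h3
  simp only [one_pow, ENNReal.ofReal_one, one_mul, finrank_euclideanSpace, Fintype.card_fin] at h3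
  have h4 : volume (ball (0 : Vec n) 1) ≠ 0 := (measure_ball_pos _ _ one_pos).ne'
  have h5 : volume (ball (0 : Vec n) 1) ≠ ⊤ := measure_ball_lt_top.ne
  rw [ENNReal.mul_le_mul_iff_left h4 h5] at h3
  exact (ENNReal.ofReal_le_ofReal_iff (by positivity)).1 h3

theorem continuous_clm_det {n : ℕ} : Continuous fun A : Vec n →L[ℝ] Vec n => A.det :=
  ContinuousLinearMap.continuous_det

/-- `det (s + A)` is a polynomial of degree at most `n` in `s`. -/
theorem exists_polynomial_det_smul_id_add {n : ℕ} (A : Vec n →L[ℝ] Vec n) :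
    ∃ q : Polynomial ℝ, q.degree < ((n + 1 : ℕ) : WithBot ℕ) ∧ ∀ s : ℝ,
      (s • ContinuousLinearMap.id ℝ (Vec n) + A).det = q.eval s := by
  let b := (EuclideanSpace.basisFun (Fin n) ℝ).toBasis
  let M := LinearMap.toMatrix b b (A : Vec n →ₗ[ℝ] Vec n)
  refine ⟨(-M).charpoly, ?_, fun s => ?_⟩
  · rw [Matrix.charpoly_degree_eq_dim]
    simp only [Fintype.card_fin]
    exact_mod_cast Nat.lt_succ_self n
  · rw [Matrix.eval_charpoly, ContinuousLinearMap.det, ← LinearMap.det_toMatrix b]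
    congr 1
    have : ((s • ContinuousLinearMap.id ℝ (Vec n) + A : Vec n →L[ℝ] Vec n) : Vec n →ₗ[ℝ] Vec n)
      = s • LinearMap.id + (A : Vec n →ₗ[ℝ] Vec n) := rfl
    rw [this, map_add, map_smul, LinearMap.toMatrix_id, sub_neg_eq_add, Matrix.scalar_apply,
      Matrix.smul_one_eq_diagonal]

theorem det_id_add_pos {n : ℕ} {A : Vec n →L[ℝ] Vec n} (hA : ‖A‖ < 1) :
    0 < (ContinuousLinearMap.id ℝ (Vec n) + A).det := by
  let F : ℝ → ℝ := fun t => (ContinuousLinearMap.id ℝ (Vec n) + t • A).det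
  have hF : Continuous F := continuous_clm_det.comp (by fun_prop)
  have h0 : ∀ t ∈ Icc (0 : ℝ) 1, F t ≠ 0 := by
    intro t ht h
    have hk := LinearMap.bot_lt_ker_of_det_eq_zero
      (f := ((ContinuousLinearMap.id ℝ (Vec n) + t • A : Vec n →L[ℝ] Vec n) : Vec n →ₗ[ℝ] Vec n)) h
    obtain ⟨x, hx, hx0⟩ := (Submodule.ne_bot_iff _).1 hk.ne'
    have hx1 : x + t • A x = 0 := hx
    have h2 : ‖x‖ = t * ‖A x‖ := by
      have := congrArg norm (eq_neg_of_add_eq_zero_left hx1)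
      rwa [norm_neg, norm_smul, Real.norm_of_nonneg ht.1] at this
    have h3 := A.le_opNorm x
    have h4 : 0 < ‖x‖ := norm_pos_iff.2 hx0
    have h5 : t * ‖A x‖ ≤ 1 * ‖A x‖ := mul_le_mul_of_nonneg_right ht.2 (norm_nonneg _)
    nlinarith
  by_contra hneg
  push Not at hneg
  have hF0 : F 0 = 1 := by simp [F, ContinuousLinearMap.det]
  have hF1 : F 1 ≤ 0 := by simpa [F] using hneg
  obtain ⟨t, ht, htt⟩ := intermediate_value_Icc' (zero_le_one' ℝ) hF.continuousOn
    (show (0 : ℝ) ∈ Icc (F 1) (F 0) from ⟨hF1, by rw [hF0]; exact zero_le_one⟩)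
  exact h0 t ht htt

theorem bijOn_ball_id_add {n : ℕ} {h : Vec n → Vec n} {L : ℝ≥0} (hL : LipschitzWith L h)
    (hL1 : L < 1) {R : ℝ} (hR : Function.support h ⊆ ball 0 R) :
    Function.Injective (fun x => x + h x) ∧ (fun x => x + h x) '' ball 0 R = ball 0 R := by
  have hinj : Function.Injective (fun x => x + h x) := by
    intro x y hxy
    have hxy : x + h x = y + h y := hxy
    have h1 : x - y = h y - h x := by
      rw [sub_eq_sub_iff_add_eq_add, hxy, add_comm]
    have h2 := hL.dist_le_mul y x
    rw [dist_eq_norm, dist_eq_norm, ← h1, norm_sub_rev y x] at h2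
    by_contra hne
    have h3 : 0 < ‖x - y‖ := norm_pos_iff.2 (sub_ne_zero.2 hne)
    have h4 : (L : ℝ) < 1 := by exact_mod_cast hL1
    nlinarith
  have hsurj : Function.Surjective (fun x => x + h x) := by
    intro y
    have hc : ContractingWith L (fun x => y - h x) := by
      refine ⟨hL1, ?_⟩
      refine LipschitzWith.of_dist_le_mul fun a b => ?_
      rw [dist_sub_left]
      exact hL.dist_le_mul a b
    refine ⟨hc.fixedPoint, ?_⟩
    have := hc.fixedPoint_isFixedPt
    have h1 : y - h hc.fixedPoint = hc.fixedPoint := this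
    exact (sub_eq_iff_eq_add.1 h1).symm
  have hz : ∀ x, x ∉ ball (0 : Vec n) R → x + h x = x := by
    intro x hx
    have : h x = 0 := by
      by_contra hne
      exact hx (hR hne)
    rw [this, add_zero]
  refine ⟨hinj, Subset.antisymm ?_ ?_⟩
  · rintro _ ⟨x, hx, rfl⟩
    by_contra hy
    have := hinj (hz _ hy)
    simp only at this hy
    rw [this] at hy
    exact hy hx
  · intro y hy
    obtain ⟨x, hx⟩ := hsurj y
    refine ⟨x, ?_, hx⟩
    by_contra hn
    have h2 := hz x hn
    simp only at hx
    rw [h2] at hx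
    exact hn (hx ▸ hy)

theorem integral_det_fderiv_eq_zero_of_contDiff {n : ℕ} (hn : 1 ≤ n) {h : Vec n → Vec n}
    (hc : ContDiff ℝ 1 h) (hs : HasCompactSupport h) :
    ∫ x, (fderiv ℝ h x).det = 0 := by
  obtain ⟨L, hL⟩ := hc.lipschitzWith_of_hasCompactSupport hs one_ne_zero
  obtain ⟨R, hR⟩ := hs.isBounded.subset_ball (0 : Vec n)
  have hR' : Function.support h ⊆ ball 0 R := (subset_tsupport h).trans hR
  have hcf : Continuous (fderiv ℝ h) := hc.continuous_fderiv one_ne_zero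
  have hd : Differentiable ℝ h := hc.differentiable one_ne_zero
  have key : ∀ s : ℝ, (L : ℝ) < s →
      ∫ x in ball 0 R, (s • ContinuousLinearMap.id ℝ (Vec n) + fderiv ℝ h x).det
        = s ^ n * volume.real (ball (0 : Vec n) R) := by
    intro s hsL
    have hs0 : 0 < s := L.2.trans_lt hsL
    set k : Vec n → Vec n := fun x => s⁻¹ • h x
    have hk : LipschitzWith (Real.toNNReal s⁻¹ * L) k := by
      refine LipschitzWith.of_dist_le_mul fun a b => ?_
      rw [dist_smul₀, Real.norm_of_nonneg (by positivity), NNReal.coe_mul,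
        Real.coe_toNNReal _ (by positivity), mul_assoc]
      gcongr
      exact hL.dist_le_mul a b
    have hk1 : Real.toNNReal s⁻¹ * L < 1 := by
      rw [← NNReal.coe_lt_coe, NNReal.coe_mul, Real.coe_toNNReal _ (by positivity),
        NNReal.coe_one, inv_mul_lt_iff₀ hs0]
      simpa using hsL
    have hkR : Function.support k ⊆ ball 0 R :=
      (Function.support_const_smul_subset s⁻¹ h).trans hR'
    obtain ⟨hi, him⟩ := bijOn_ball_id_add hk hk1 hkR
    have hder : ∀ x ∈ ball (0 : Vec n) R, HasFDerivWithinAt (fun x => x + k x)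
        (ContinuousLinearMap.id ℝ (Vec n) + s⁻¹ • fderiv ℝ h x) (ball 0 R) x := fun x _ =>
      ((hasFDerivAt_id x).add ((hd x).hasFDerivAt.const_smul s⁻¹)).hasFDerivWithinAt
    have := integral_image_eq_integral_abs_det_fderiv_smul volume measurableSet_ball hder
      hi.injOn (fun _ => (1 : ℝ))
    rw [him] at this
    simp only [integral_const, smul_eq_mul, mul_one, measureReal_restrict_apply_univ] at this
    rw [this, ← integral_const_mul]
    refine integral_congr_ae (Eventually.of_forall fun x => ?_)
    have hn1 : ‖s⁻¹ • fderiv ℝ h x‖ < 1 := by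
      rw [norm_smul, Real.norm_of_nonneg (by positivity), inv_mul_lt_iff₀ hs0, mul_one]
      exact (norm_fderiv_le_of_lipschitz ℝ hL).trans_lt hsL
    simp only
    rw [abs_of_pos (det_id_add_pos hn1)]
    have : s • ContinuousLinearMap.id ℝ (Vec n) + fderiv ℝ h x
        = s • (ContinuousLinearMap.id ℝ (Vec n) + s⁻¹ • fderiv ℝ h x) := by
      rw [smul_add, smul_smul, mul_inv_cancel₀ hs0.ne', one_smul]
    rw [this, ContinuousLinearMap.det, ContinuousLinearMap.toLinearMap_smul, LinearMap.det_smul]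
    simp [ContinuousLinearMap.det]
  have hzero : ∫ x, (fderiv ℝ h x).det = ∫ x in ball 0 R, (fderiv ℝ h x).det := by
    refine (setIntegral_eq_integral_of_forall_compl_eq_zero fun x hx => ?_).symm
    have hx' : fderiv ℝ h x = 0 := by
      by_contra hne
      exact hx (hR (support_fderiv_subset ℝ hne))
    have : Nonempty (Fin n) := ⟨⟨0, hn⟩⟩
    rw [hx', ContinuousLinearMap.det]
    simp
  rw [hzero]
  let v : Fin (n + 1) → ℝ := fun j => L + 1 + j
  have hv : Set.InjOn v (Finset.univ : Finset (Fin (n + 1))) := by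
    intro i _ j _ hij
    have : (i : ℝ) = j := by simpa [v] using hij
    exact Fin.ext (by exact_mod_cast this)
  let c : Fin (n + 1) → ℝ := fun j => (Lagrange.basis Finset.univ v j).eval 0
  have hq : ∀ q : Polynomial ℝ, q.degree < ((n + 1 : ℕ) : WithBot ℕ) →
      q.eval 0 = ∑ j, c j * q.eval (v j) := by
    intro q hq
    conv_lhs => rw [Lagrange.eq_interpolate (s := Finset.univ) hv (f := q) (by simpa using hq)]
    rw [Lagrange.interpolate_apply, Polynomial.eval_finsetSum]
    refine Finset.sum_congr rfl fun j _ => ?_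
    simp [c, mul_comm]
  have hpt : ∀ x, (fderiv ℝ h x).det
      = ∑ j, c j * (v j • ContinuousLinearMap.id ℝ (Vec n) + fderiv ℝ h x).det := by
    intro x
    obtain ⟨q, hq1, hq2⟩ := exists_polynomial_det_smul_id_add (fderiv ℝ h x)
    have := hq q hq1
    have e : (0 : ℝ) • ContinuousLinearMap.id ℝ (Vec n) + fderiv ℝ h x = fderiv ℝ h x := by
      ext v
      simp
    rw [← hq2 0, e] at this
    rw [this]
    exact Finset.sum_congr rfl fun j _ => by rw [hq2]
  have hint : ∀ j, IntegrableOn (fun x =>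
      (v j • ContinuousLinearMap.id ℝ (Vec n) + fderiv ℝ h x).det) (ball 0 R) volume := fun j =>
    ((continuous_clm_det.comp (by fun_prop)).continuousOn.integrableOn_compact
      (isCompact_closedBall 0 R)).mono_set ball_subset_closedBall
  simp_rw [hpt]
  rw [integral_finsetSum _ fun j _ => (hint j).const_mul _]
  have hvL : ∀ j, (L : ℝ) < v j := fun j => by
    have : (0 : ℝ) ≤ (j : ℕ) := Nat.cast_nonneg _
    simp only [v]; linarith
  simp_rw [integral_const_mul, key _ (hvL _)]
  have := hq (Polynomial.X ^ n) (by
    rw [Polynomial.degree_X_pow]; exact_mod_cast Nat.lt_succ_self n)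
  simp only [Polynomial.eval_pow, Polynomial.eval_X] at this
  simp_rw [← mul_assoc]
  rw [← Finset.sum_mul, ← this, zero_pow (by omega), zero_mul]

theorem tangent_le_pow {a c : ℝ} (ha : 0 ≤ a) (hc : 0 ≤ c) (k : ℕ) :
    c ^ (k + 1) + (k + 1) * c ^ k * (a - c) ≤ a ^ (k + 1) := by
  induction k with
  | zero => simp
  | succ k ih =>
    have h1 := mul_le_mul_of_nonneg_left ih ha
    have h2 : 0 ≤ (k + 1) * c ^ k * (a - c) ^ 2 := by positivity
    push_cast
    have e : a ^ (k + 1 + 1) = a * a ^ (k + 1) := by ring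
    rw [e]
    refine le_trans ?_ h1
    rw [← sub_nonneg]
    refine h2.trans_eq ?_
    ring

theorem pow_integral_mul_le {X : Type*} [MeasurableSpace X] {μ : Measure X} {ρ a : X → ℝ}
    (hρ : ∀ x, 0 ≤ ρ x) (ha : ∀ x, 0 ≤ a x) (h1 : ∫ x, ρ x ∂μ = 1) {n : ℕ} (hn : 1 ≤ n)
    (hi : Integrable (fun x => ρ x * a x) μ) (hin : Integrable (fun x => ρ x * a x ^ n) μ) :
    (∫ x, ρ x * a x ∂μ) ^ n ≤ ∫ x, ρ x * a x ^ n ∂μ := by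
  obtain ⟨k, rfl⟩ : ∃ k, n = k + 1 := ⟨n - 1, by omega⟩
  have hρi : Integrable ρ μ := by
    by_contra h
    rw [integral_undef h] at h1
    exact zero_ne_one h1
  set c := ∫ x, ρ x * a x ∂μ with hc
  have hc0 : 0 ≤ c := integral_nonneg fun x => mul_nonneg (hρ x) (ha x)
  have i1 : Integrable (fun x => ρ x * a x - c * ρ x) μ := hi.sub (hρi.const_mul _)
  have i2 : Integrable (fun x => (k + 1) * c ^ k * (ρ x * a x - c * ρ x)) μ := i1.const_mul _
  have h2 : ∫ x, (c ^ (k + 1) * ρ x + (k + 1) * c ^ k * (ρ x * a x - c * ρ x)) ∂μ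
      ≤ ∫ x, ρ x * a x ^ (k + 1) ∂μ := by
    refine integral_mono ((hρi.const_mul _).add i2) hin fun x => ?_
    have := mul_le_mul_of_nonneg_left (tangent_le_pow (ha x) hc0 k) (hρ x)
    refine le_trans (le_of_eq ?_) this
    ring
  rw [integral_add (hρi.const_mul _) i2,
    integral_const_mul, integral_const_mul, integral_sub hi (hρi.const_mul _),
    integral_const_mul, h1, ← hc] at h2
  linarith

open scoped Convolution

theorem fderiv_convolution_eq {n : ℕ} {h : Vec n → Vec n} {ρ : Vec n → ℝ}
    (hd : Differentiable ℝ h) (hDi : Integrable (fderiv ℝ h))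
    (hρ : ContDiff ℝ 1 ρ) (hρs : HasCompactSupport ρ) (x : Vec n) :
    HasFDerivAt (ρ ⋆[ContinuousLinearMap.lsmul ℝ ℝ, volume] h)
      ((ρ ⋆[ContinuousLinearMap.lsmul ℝ ℝ, volume] (fderiv ℝ h)) x) x := by
  have hli : LocallyIntegrable h volume := hd.continuous.locallyIntegrable
  have hA := hρs.hasFDerivAt_convolution_left (ContinuousLinearMap.lsmul ℝ ℝ) hρ hli x
  have hρ' : Continuous (fderiv ℝ ρ) := hρ.continuous_fderiv one_ne_zero
  have hρ's : HasCompactSupport (fderiv ℝ ρ) := hρs.fderiv ℝ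
  have ex1 : ConvolutionExistsAt ρ (fderiv ℝ h) x (ContinuousLinearMap.lsmul ℝ ℝ) volume :=
    hρs.convolutionExists_left (ContinuousLinearMap.lsmul ℝ ℝ) hρ.continuous
      hDi.locallyIntegrable x
  have ex2 : ConvolutionExistsAt (fderiv ℝ ρ) h x
      ((ContinuousLinearMap.lsmul ℝ ℝ).precompL (Vec n)) volume :=
    hρ's.convolutionExists_left _ hρ' hli x
  suffices e : (ρ ⋆[ContinuousLinearMap.lsmul ℝ ℝ, volume] (fderiv ℝ h)) x =
      ((fderiv ℝ ρ) ⋆[(ContinuousLinearMap.lsmul ℝ ℝ).precompL (Vec n), volume] h) x by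
    rw [e]
    exact hA
  ext1 v
  rw [convolution_def, convolution_def, ContinuousLinearMap.integral_apply ex1,
    ContinuousLinearMap.integral_apply ex2]
  have hg : ∀ t, HasFDerivAt (fun t => h (x - t)) (-(fderiv ℝ h (x - t))) t := fun t => by
    have h1 := (hd (x - t)).hasFDerivAt.comp t ((hasFDerivAt_const x t).sub (hasFDerivAt_id t))
    convert! h1 using 1
    ext w
    simp
  have i1 : Integrable (fun t => (fderiv ℝ ρ t v) • h (x - t)) volume := by
    have := ContinuousLinearMap.integrable_comp (ContinuousLinearMap.apply ℝ (Vec n) v) ex2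
    exact this
  have i2 : Integrable (fun t => ρ t • (-(fderiv ℝ h (x - t))) v) volume := by
    have := (ContinuousLinearMap.integrable_comp (ContinuousLinearMap.apply ℝ (Vec n) v) ex1).neg
    refine this.congr (Eventually.of_forall fun t => ?_)
    simp
  have i3 : Integrable (fun t => ρ t • h (x - t)) volume :=
    hρs.convolutionExists_left (ContinuousLinearMap.lsmul ℝ ℝ) hρ.continuous hli x
  have := integral_bilinear_hasFDerivAt_right_eq_neg_left_of_integrable (μ := volume)
    (B := ContinuousLinearMap.lsmul ℝ ℝ) (f := ρ) (f' := fderiv ℝ ρ) (g := fun t => h (x - t))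
    (g' := fun t => -(fderiv ℝ h (x - t))) (v := v) i1 i2 i3
    (fun t _ => (hρ.differentiable one_ne_zero t).hasFDerivAt) (fun t _ => hg t)
  simp only [ContinuousLinearMap.lsmul_apply, neg_apply, smul_neg,
    integral_neg, neg_inj] at this
  simpa [ContinuousLinearMap.precompL] using this

theorem integral_det_fderiv_nonpos {n : ℕ} (hn : 1 ≤ n) {h : Vec n → Vec n}
    (hd : Differentiable ℝ h) (hs : HasCompactSupport h)
    (hint : Integrable (fun x => ‖fderiv ℝ h x‖ ^ n)) :
    ∫ x, (fderiv ℝ h x).det ≤ 0 := by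
  have hm : Measurable (fderiv ℝ h) := measurable_fderiv ℝ h
  have hDs : HasCompactSupport (fderiv ℝ h) := hs.fderiv ℝ
  have hDi : Integrable (fderiv ℝ h) := by
    have i1 : Integrable ((tsupport (fderiv ℝ h)).indicator fun _ => (1 : ℝ)) :=
      (integrable_indicator_iff (isClosed_tsupport _).measurableSet).2
        (integrableOn_const (hDs.isCompact.measure_lt_top).ne)
    refine (i1.add hint).mono' hm.aestronglyMeasurable (Eventually.of_forall fun x => ?_)
    by_cases hx : x ∈ tsupport (fderiv ℝ h)
    · simp only [Pi.add_apply, indicator_of_mem hx]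
      rcases le_total ‖fderiv ℝ h x‖ 1 with h1 | h1
      · have : 0 ≤ ‖fderiv ℝ h x‖ ^ n := by positivity
        linarith
      · have := le_self_pow₀ h1 (by omega : n ≠ 0)
        linarith
    · rw [image_eq_zero_of_notMem_tsupport hx]
      simp only [norm_zero, Pi.add_apply, indicator_of_notMem hx, zero_add]
      positivity
  have hdetm : Measurable fun x => (fderiv ℝ h x).det := continuous_clm_det.measurable.comp hm
  have hdeti : Integrable fun x => (fderiv ℝ h x).det :=
    hint.mono' hdetm.aestronglyMeasurable (Eventually.of_forall fun x => abs_det_le_norm_pow _)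
  let φ : ℕ → ContDiffBump (0 : Vec n) := fun i =>
    ⟨1 / (i + 1), 2 / (i + 1), by positivity, by gcongr; norm_num⟩
  have hφ0 : Tendsto (fun i => (φ i).rOut) atTop (𝓝 0) :=
    tendsto_const_div_atTop_nhds_zero_nat 2 |>.comp (tendsto_add_atTop_nat 1) |>.congr fun i => by
      simp [φ]
  have hφK : ∀ᶠ i in atTop, (φ i).rOut ≤ 2 * (φ i).rIn := Eventually.of_forall fun i => by
    simp only [φ]
    exact le_of_eq (by ring)
  let ρ : ℕ → Vec n → ℝ := fun i => (φ i).normed volume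
  have hρc : ∀ i, ContDiff ℝ 1 (ρ i) := fun i => (φ i).contDiff_normed
  have hρs : ∀ i, HasCompactSupport (ρ i) := fun i => (φ i).hasCompactSupport_normed
  have hρ0 : ∀ i x, 0 ≤ ρ i x := fun i x => (φ i).nonneg_normed x
  have hρ1 : ∀ i, ∫ x, ρ i x = 1 := fun i => (φ i).integral_normed
  let g : ℕ → Vec n → Vec n := fun i => ρ i ⋆[ContinuousLinearMap.lsmul ℝ ℝ, volume] h
  let D : ℕ → Vec n → (Vec n →L[ℝ] Vec n) := fun i =>
    ρ i ⋆[ContinuousLinearMap.lsmul ℝ ℝ, volume] (fderiv ℝ h)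
  let G : ℕ → Vec n → ℝ := fun i =>
    ρ i ⋆[ContinuousLinearMap.lsmul ℝ ℝ, volume] (fun x => ‖fderiv ℝ h x‖ ^ n)
  have hgD : ∀ i x, fderiv ℝ (g i) x = D i x := fun i x =>
    (fderiv_convolution_eq hd hDi (hρc i) (hρs i) x).fderiv
  have hgc : ∀ i, ContDiff ℝ 1 (g i) := fun i =>
    (hρs i).contDiff_convolution_left _ (hρc i) hd.continuous.locallyIntegrable
  have hgs : ∀ i, HasCompactSupport (g i) := fun i => (hρs i).convolution _ hs
  have hzero : ∀ i, ∫ x, (D i x).det = 0 := fun i => by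
    simp_rw [← hgD]
    exact integral_det_fderiv_eq_zero_of_contDiff hn (hgc i) (hgs i)
  have hDG : ∀ i x, ‖D i x‖ ^ n ≤ G i x := by
    intro i x
    have e1 : Integrable (fun t => ρ i t • fderiv ℝ h (x - t)) :=
      (hρs i).convolutionExists_left (ContinuousLinearMap.lsmul ℝ ℝ) (hρc i).continuous
        hDi.locallyIntegrable x
    have e2 : Integrable (fun t => ρ i t * ‖fderiv ℝ h (x - t)‖ ^ n) :=
      (hρs i).convolutionExists_left (ContinuousLinearMap.lsmul ℝ ℝ) (hρc i).continuous
        hint.locallyIntegrable x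
    have e3 : Integrable (fun t => ρ i t * ‖fderiv ℝ h (x - t)‖) := by
      refine e1.norm.congr (Eventually.of_forall fun t => ?_)
      simp only [norm_smul, Real.norm_of_nonneg (hρ0 i t)]
    refine le_trans ?_ (pow_integral_mul_le (hρ0 i) (fun t => norm_nonneg _) (hρ1 i) hn e3 e2)
    refine pow_le_pow_left₀ (norm_nonneg _) ?_ n
    refine (norm_integral_le_integral_norm _).trans (le_of_eq ?_)
    refine integral_congr_ae (Eventually.of_forall fun t => ?_)
    simp [norm_smul, abs_of_nonneg (hρ0 i t)]
  have hGi : ∀ i, Integrable (G i) := fun i =>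
    Integrable.integrable_convolution _ ((hρc i).continuous.integrable_of_hasCompactSupport (hρs i))
      hint
  have hGint : ∀ i, ∫ x, G i x = ∫ x, ‖fderiv ℝ h x‖ ^ n := fun i => by
    simp only [G]
    rw [integral_convolution _ ((hρc i).continuous.integrable_of_hasCompactSupport (hρs i)) hint]
    simp [hρ1]
  have hDc : ∀ i, Continuous (D i) := fun i => by
    have := (hgc i).continuous_fderiv one_ne_zero
    rwa [show fderiv ℝ (g i) = D i from funext (hgD i)] at this
  have hDdi : ∀ i, Integrable fun x => (D i x).det := fun i =>
    (hGi i).mono' (continuous_clm_det.comp (hDc i)).aestronglyMeasurable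
      (Eventually.of_forall fun x => (abs_det_le_norm_pow _).trans (hDG i x))
  have hpos : ∀ i x, 0 ≤ G i x + (D i x).det := fun i x => by
    have h1 := neg_abs_le (D i x).det
    have h2 := abs_det_le_norm_pow (D i x)
    have h3 := hDG i x
    linarith
  have hpos' : ∀ x, 0 ≤ ‖fderiv ℝ h x‖ ^ n + (fderiv ℝ h x).det := fun x => by
    have h1 := neg_abs_le (fderiv ℝ h x).det
    have h2 := abs_det_le_norm_pow (fderiv ℝ h x)
    linarith
  have hlim : ∀ᵐ x, Tendsto (fun i => ENNReal.ofReal (G i x + (D i x).det)) atTop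
      (𝓝 (ENNReal.ofReal (‖fderiv ℝ h x‖ ^ n + (fderiv ℝ h x).det))) := by
    filter_upwards [ContDiffBump.ae_convolution_tendsto_right_of_locallyIntegrable hφ0 hφK
      hDi.locallyIntegrable, ContDiffBump.ae_convolution_tendsto_right_of_locallyIntegrable hφ0 hφK
      hint.locallyIntegrable] with x h1 h2
    exact (ENNReal.continuous_ofReal.tendsto _).comp
      (h2.add ((continuous_clm_det.tendsto _).comp h1))
  have hfatou := lintegral_liminf_le' (μ := volume) (u := atTop)
    (f := fun i x => ENNReal.ofReal (G i x + (D i x).det))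
    fun i => ((hGi i).add (hDdi i)).aestronglyMeasurable.aemeasurable.ennreal_ofReal
  have hc : ∀ i, ∫⁻ x, ENNReal.ofReal (G i x + (D i x).det)
      = ENNReal.ofReal (∫ x, ‖fderiv ℝ h x‖ ^ n) := fun i => by
    have hi : Integrable fun x => G i x + (D i x).det := (hGi i).add (hDdi i)
    rw [← ofReal_integral_eq_lintegral_ofReal hi (Eventually.of_forall (hpos i)),
      integral_add (hGi i) (hDdi i), hzero, add_zero, hGint]
  simp_rw [hc] at hfatou
  have hi' : Integrable fun x => ‖fderiv ℝ h x‖ ^ n + (fderiv ℝ h x).det := hint.add hdeti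
  rw [liminf_const, lintegral_congr_ae (hlim.mono fun x hx => hx.liminf_eq),
    ← ofReal_integral_eq_lintegral_ofReal hi' (Eventually.of_forall hpos'),
    integral_add hint hdeti, ENNReal.ofReal_le_ofReal_iff
      (integral_nonneg fun x => by positivity)] at hfatou
  linarith

theorem det_eq_mul_det_of_apply {n : ℕ} {A B : Vec n →L[ℝ] Vec n} {c : ℝ} (i : Fin n)
    (hi : ∀ v, B v i = c * A v i) (hj : ∀ v j, j ≠ i → B v j = A v j) : B.det = c * A.det := by
  set b := (EuclideanSpace.basisFun (Fin n) ℝ).toBasis with hb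
  have hA : A.det = (LinearMap.toMatrix b b (A : Vec n →ₗ[ℝ] Vec n)).det :=
    (LinearMap.det_toMatrix b _).symm
  have hB : B.det = (LinearMap.toMatrix b b (B : Vec n →ₗ[ℝ] Vec n)).det :=
    (LinearMap.det_toMatrix b _).symm
  have e : LinearMap.toMatrix b b (B : Vec n →ₗ[ℝ] Vec n) =
      (LinearMap.toMatrix b b (A : Vec n →ₗ[ℝ] Vec n)).updateRow i
        (c • (LinearMap.toMatrix b b (A : Vec n →ₗ[ℝ] Vec n)) i) := by
    ext j k
    by_cases h : j = i
    · subst h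
      simp [LinearMap.toMatrix_apply, hb, hi]
    · simp [LinearMap.toMatrix_apply, hb, h, hj]
  rw [hA, hB, e, Matrix.det_updateRow_smul, Matrix.updateRow_eq_self]

theorem eq_zero_of_fderiv_eq_zero_ae {n : ℕ} (i : Fin n) {u : Vec n → ℝ} (hd : Differentiable ℝ u)
    (hs : HasCompactSupport u) (h0 : ∀ᵐ x, fderiv ℝ u x = 0) : u = 0 := by
  let p : Vec n →L[ℝ] ℝ := EuclideanSpace.proj i
  have hpd : Differentiable ℝ p := p.differentiable
  have hus : HasCompactSupport fun x => u x ^ 2 := hs.comp_left (g := fun t : ℝ => t ^ 2) (by simp)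
  have hud : Differentiable ℝ fun x => u x ^ 2 := hd.pow 2
  have hui : Integrable fun x => u x ^ 2 := hud.continuous.integrable_of_hasCompactSupport hus
  have hf : ∀ᵐ x, fderiv ℝ (fun x => u x ^ 2) x = 0 := by
    filter_upwards [h0] with x hx
    have := ((hd x).hasFDerivAt.pow 2).fderiv
    rw [this, hx, smul_zero]
  have hp1 : ∀ x, fderiv ℝ p x (EuclideanSpace.single i (1 : ℝ)) = 1 := fun x => by
    rw [p.fderiv]
    simp [p]
  have key := integral_mul_fderiv_eq_neg_fderiv_mul_of_integrable (μ := volume) (f := p)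
    (g := fun x => u x ^ 2) (v := EuclideanSpace.single i (1 : ℝ)) (by simpa only [hp1, one_mul] using hui)
    ((integrable_zero _ _ _).congr (by
      filter_upwards [hf] with x hx
      simp [hx]))
    ((hpd.continuous.mul hud.continuous).integrable_of_hasCompactSupport hus.mul_left)
    (fun x _ => hpd x) (fun x _ => hud x)
  rw [integral_congr_ae (g := fun _ => (0 : ℝ)) (by
    filter_upwards [hf] with x hx
    simp [hx])] at key
  simp only [hp1, one_mul, integral_zero] at key
  have h2 : ∫ x, u x ^ 2 = 0 := by linarith
  funext x
  by_contra hx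
  exact (hud.continuous.integral_pos_of_hasCompactSupport_nonneg_nonzero (μ := volume) hus
    (fun x => sq_nonneg _) (pow_ne_zero 2 hx)).ne' h2

set_option maxHeartbeats 1000000 in
/-- A truncation of a coordinate of a quasiregular map vanishes inside if it vanishes on the
frontier. -/
theorem truncation_eq_zero {n : ℕ} (i : Fin n) {Ω U : Set (Vec n)} {f : Vec n → Vec n} {K : ℝ}
    (hΩ : IsOpen Ω) (hU : IsOpen U) (hUc : IsCompact (closure U)) (hUΩ : closure U ⊆ Ω)
    (hd : ∀ x ∈ Ω, DifferentiableAt ℝ f x)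
    (hqr : ∀ᵐ x ∂(volume.restrict Ω), ‖fderiv ℝ f x‖ ^ n ≤ K * (fderiv ℝ f x).det)
    (hK : 0 < K)
    (hint : ∀ S ⊆ Ω, IsCompact S → IntegrableOn (fun x => ‖fderiv ℝ f x‖ ^ n) S)
    {ψ ψ' : ℝ → ℝ} (hψ : ∀ s, HasDerivAt ψ (ψ' s) s) (hψc : Continuous ψ') (hψ0 : ∀ s, 0 ≤ ψ' s)
    (hfr : ∀ x ∈ frontier U, ψ (f x i) = 0 ∧ ψ' (f x i) = 0) :
    ∀ x ∈ U, ψ (f x i) = 0 := by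
  have hn : n ≠ 0 := fun h => by subst h; exact i.elim0
  have hfi : ∀ x ∈ Ω, HasFDerivAt (fun y => f y i)
      ((EuclideanSpace.proj i : Vec n →L[ℝ] ℝ).comp (fderiv ℝ f x)) x := fun x hx =>
    (EuclideanSpace.proj i : Vec n →L[ℝ] ℝ).hasFDerivAt.comp x (hd x hx).hasFDerivAt
  have hcomp : ∀ x ∈ Ω, HasFDerivAt (fun y => ψ (f y i))
      (ψ' (f x i) • (EuclideanSpace.proj i : Vec n →L[ℝ] ℝ).comp (fderiv ℝ f x)) x :=
    fun x hx => (hψ (f x i)).comp_hasFDerivAt x (hfi x hx)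
  have hUsub : U ⊆ Ω := subset_closure.trans hUΩ
  set u : Vec n → ℝ := U.indicator fun x => ψ (f x i) with hu
  have hu1 : ∀ x ∈ U, HasFDerivAt u
      (ψ' (f x i) • (EuclideanSpace.proj i : Vec n →L[ℝ] ℝ).comp (fderiv ℝ f x)) x := by
    intro x hx
    refine (hcomp x (hUsub hx)).congr_of_eventuallyEq ?_
    filter_upwards [hU.mem_nhds hx] with y hy
    simp [hu, hy]
  have hu2 : ∀ x ∉ U, HasFDerivAt u (0 : Vec n →L[ℝ] ℝ) x := by
    intro x hx
    by_cases hxc : x ∈ closure U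
    · have hxf : x ∈ frontier U := by
        rw [hU.frontier_eq]; exact ⟨hxc, hx⟩
      have h1 := hcomp x (hUΩ hxc)
      rw [(hfr x hxf).2, zero_smul] at h1
      rw [hasFDerivAt_iff_isLittleO_nhds_zero] at h1 ⊢
      refine (Asymptotics.IsBigO.of_norm_le fun y => ?_).trans_isLittleO h1.norm_left
      have h3 : u x = 0 := indicator_of_notMem hx _
      simp only [h3, (hfr x hxf).1, zero_apply, sub_zero]
      exact norm_indicator_le_norm_self _ _
    · refine (hasFDerivAt_const (0 : ℝ) x).congr_of_eventuallyEq ?_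
      filter_upwards [isClosed_closure.isOpen_compl.mem_nhds hxc] with y hy
      exact indicator_of_notMem (fun h => hy (subset_closure h)) _
  have hud : Differentiable ℝ u := fun x => by
    by_cases hx : x ∈ U
    · exact (hu1 x hx).differentiableAt
    · exact (hu2 x hx).differentiableAt
  have hus : HasCompactSupport u := HasCompactSupport.intro hUc fun x hx =>
    indicator_of_notMem (fun h => hx (subset_closure h)) _
  obtain ⟨χ, hχ1, hχs, hχsupp, hχsm⟩ : ∃ χ : Vec n → ℝ, (∀ x ∈ closure U, χ x = 1) ∧
      HasCompactSupport χ ∧ tsupport χ ⊆ Ω ∧ ContDiff ℝ 1 χ := by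
    obtain ⟨V, hVo, hUV, hVΩ, hVc⟩ := exists_open_between_and_isCompact_closure hUc hΩ hUΩ
    obtain ⟨χ, h1, -, h3, h4⟩ := exists_contMDiff_support_eq_eq_one_iff (n := 1)
      (modelWithCornersSelf ℝ (Vec n)) hVo isClosed_closure hUV
    have h5 : tsupport χ = closure V := by rw [tsupport, h3]
    refine ⟨χ, fun x hx => (h4 x).1 hx, ?_, h5 ▸ hVΩ, contMDiff_iff_contDiff.1 h1⟩
    rw [HasCompactSupport, h5]
    exact hVc
  set F : Vec n → Vec n := fun x => χ x • f x with hF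
  have hF1 : ∀ x ∈ Ω, HasFDerivAt F (χ x • fderiv ℝ f x + (fderiv ℝ χ x).smulRight (f x)) x :=
    fun x hx => ((hχsm.differentiable one_ne_zero x).hasFDerivAt).smul (hd x hx).hasFDerivAt
  have hF2 : ∀ x ∉ tsupport χ, HasFDerivAt F (0 : Vec n →L[ℝ] Vec n) x := by
    intro x hx
    refine (hasFDerivAt_const (0 : Vec n) x).congr_of_eventuallyEq ?_
    filter_upwards [(isClosed_tsupport χ).isOpen_compl.mem_nhds hx] with y hy
    simp [hF, image_eq_zero_of_notMem_tsupport hy]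
  have hFd : Differentiable ℝ F := fun x => by
    by_cases hx : x ∈ tsupport χ
    · exact (hF1 x (hχsupp hx)).differentiableAt
    · exact (hF2 x hx).differentiableAt
  have hFs : HasCompactSupport F := hχs.smul_right
  set e : Vec n := EuclideanSpace.single i (1 : ℝ) with he
  set h : Vec n → Vec n := fun x => F x + (u x - F x i) • e with hh

  have hFi : ∀ x, HasFDerivAt (fun x => F x i) ((EuclideanSpace.proj i : Vec n →L[ℝ] ℝ).comp
      (fderiv ℝ F x)) x := fun x =>
    (EuclideanSpace.proj i : Vec n →L[ℝ] ℝ).hasFDerivAt.comp x (hFd x).hasFDerivAt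
  have hhF : ∀ x, HasFDerivAt h (fderiv ℝ F x + (fderiv ℝ u x -
      (EuclideanSpace.proj i : Vec n →L[ℝ] ℝ).comp (fderiv ℝ F x)).smulRight e) x := fun x =>
    (hFd x).hasFDerivAt.fun_add (((hud x).hasFDerivAt.fun_sub (hFi x)).smul_const e)
  have hhD : ∀ x v, fderiv ℝ h x v =
      fderiv ℝ F x v + (fderiv ℝ u x v - fderiv ℝ F x v i) • e := by
    intro x v
    rw [(hhF x).fderiv]
    simp
  have hhd : Differentiable ℝ h := fun x => (hhF x).differentiableAt
  have hhs : HasCompactSupport h := by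
    refine HasCompactSupport.intro (hFs.isCompact.union hus.isCompact) fun x hx => ?_
    rw [mem_union, not_or] at hx
    simp only [hh, image_eq_zero_of_notMem_tsupport hx.1, image_eq_zero_of_notMem_tsupport hx.2]
    simp
  have hDi : ∀ x v, fderiv ℝ h x v i = fderiv ℝ u x v := fun x v => by
    rw [hhD]; simp [he]
  have hDj : ∀ x v j, j ≠ i → fderiv ℝ h x v j = fderiv ℝ F x v j := fun x v j hj => by
    rw [hhD]; simp [he, hj]
  have hFU : ∀ x ∈ U, fderiv ℝ F x = fderiv ℝ f x := by
    intro x hx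
    refine Filter.EventuallyEq.fderiv_eq ?_
    filter_upwards [hU.mem_nhds hx] with y hy
    simp [hF, hχ1 y (subset_closure hy)]
  have hdet1 : ∀ x ∈ U, (fderiv ℝ h x).det = ψ' (f x i) * (fderiv ℝ f x).det := by
    intro x hx
    refine det_eq_mul_det_of_apply i (fun v => ?_) fun v j hj => ?_
    · rw [hDi, (hu1 x hx).fderiv]; simp
    · rw [hDj x v j hj, hFU x hx]
  have hdet2 : ∀ x ∉ U, (fderiv ℝ h x).det = 0 := by
    intro x hx
    rw [← zero_mul (fderiv ℝ h x).det]
    refine det_eq_mul_det_of_apply i (fun v => ?_) fun v j hj => rfl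
    rw [hDi, (hu2 x hx).fderiv]; simp
  have hqr' : ∀ᵐ x, x ∈ Ω → ‖fderiv ℝ f x‖ ^ n ≤ K * (fderiv ℝ f x).det :=
    (ae_restrict_iff' hΩ.measurableSet).1 hqr
  have hdet0 : ∀ᵐ x, 0 ≤ (fderiv ℝ h x).det := by
    filter_upwards [hqr'] with x hx
    by_cases hxU : x ∈ U
    · rw [hdet1 x hxU]
      refine mul_nonneg (hψ0 _) ?_
      have h1 : 0 ≤ K * (fderiv ℝ f x).det := le_trans (by positivity) (hx (hUsub hxU))
      exact nonneg_of_mul_nonneg_right h1 hK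
    · exact (hdet2 x hxU).ge
  have hinth : Integrable fun x => ‖fderiv ℝ h x‖ ^ n := by
    have hfc : ContinuousOn f Ω := fun x hx => (hd x hx).continuousAt.continuousWithinAt
    obtain ⟨A, hA⟩ := hχs.isCompact.exists_bound_of_continuousOn hχsm.continuous.continuousOn
    obtain ⟨B, hB⟩ := hχs.isCompact.exists_bound_of_continuousOn
      ((hχsm.continuous_fderiv one_ne_zero).norm.continuousOn.mul (hfc.mono hχsupp).norm)
    obtain ⟨C, hC⟩ := hUc.exists_bound_of_continuousOn (hψc.comp_continuousOn
      ((EuclideanSpace.proj i : Vec n →L[ℝ] ℝ).continuous.comp_continuousOn (hfc.mono hUΩ)))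
    have hu3 : ∀ x ∈ tsupport χ, ‖fderiv ℝ u x‖ ≤ |C| * ‖fderiv ℝ f x‖ := by
      intro x hx
      by_cases hxU : x ∈ U
      · rw [(hu1 x hxU).fderiv, norm_smul]
        refine mul_le_mul ((hC x (subset_closure hxU)).trans (le_abs_self C)) ?_ (norm_nonneg _)
          (abs_nonneg _)
        refine ContinuousLinearMap.opNorm_le_bound _ (norm_nonneg _) fun v => ?_
        exact (PiLp.norm_apply_le _ i).trans ((fderiv ℝ f x).le_opNorm v)
      · rw [(hu2 x hxU).fderiv, norm_zero]
        positivity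
    have hF3 : ∀ x ∈ tsupport χ, ‖fderiv ℝ F x‖ ≤ |A| * ‖fderiv ℝ f x‖ + |B| := by
      intro x hx
      rw [(hF1 x (hχsupp hx)).fderiv]
      refine (norm_add_le _ _).trans (add_le_add ?_ ?_)
      · rw [norm_smul]
        exact mul_le_mul_of_nonneg_right ((hA x hx).trans (le_abs_self A)) (norm_nonneg _)
      · rw [ContinuousLinearMap.norm_smulRight_apply]
        exact ((le_abs_self _).trans (hB x hx)).trans (le_abs_self B)
    have hD : ∀ x, ‖fderiv ℝ h x‖ ≤ 2 * ‖fderiv ℝ F x‖ + ‖fderiv ℝ u x‖ := by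
      intro x
      refine ContinuousLinearMap.opNorm_le_bound _ (by positivity) fun v => ?_
      have he1 : ‖e‖ = 1 := by simp [he]
      rw [hhD]
      have b1 := (fderiv ℝ F x).le_opNorm v
      have b2 := (fderiv ℝ u x).le_opNorm v
      have b3 := PiLp.norm_apply_le (fderiv ℝ F x v) i
      calc _ ≤ ‖fderiv ℝ F x v‖ + ‖(fderiv ℝ u x v - fderiv ℝ F x v i) • e‖ := norm_add_le _ _
        _ ≤ ‖fderiv ℝ F x v‖ + (‖fderiv ℝ u x v‖ + ‖fderiv ℝ F x v i‖) := by
          rw [norm_smul, he1, mul_one]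
          gcongr
          exact norm_sub_le _ _
        _ ≤ _ := by linarith
    have hbound : Integrable ((tsupport χ).indicator fun x => 2 ^ (n - 1) *
        (((2 * |A| + |C|) * ‖fderiv ℝ f x‖) ^ n + (2 * |B|) ^ n)) := by
      rw [integrable_indicator_iff (isClosed_tsupport _).measurableSet]
      refine Integrable.const_mul (Integrable.add ?_ ?_) _
      · simp_rw [mul_pow]
        exact (hint _ hχsupp hχs.isCompact).const_mul _
      · exact integrableOn_const (hχs.isCompact.measure_lt_top).ne
    refine hbound.mono' ((measurable_fderiv ℝ h).norm.pow_const n).aestronglyMeasurable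
      (Eventually.of_forall fun x => ?_)
    rw [Real.norm_of_nonneg (by positivity)]
    by_cases hx : x ∈ tsupport χ
    · rw [indicator_of_mem hx]
      refine le_trans ?_ (add_pow_le (by positivity) (by positivity) n)
      refine pow_le_pow_left₀ (norm_nonneg _) ((hD x).trans ?_) n
      have b1 := hu3 x hx
      have b2 := hF3 x hx
      linarith
    · have hxU : x ∉ U := fun hxU => hx (subset_tsupport χ (by
        rw [Function.mem_support, hχ1 x (subset_closure hxU)]; exact one_ne_zero))
      have := hD x
      rw [(hF2 x hx).fderiv, (hu2 x hxU).fderiv, norm_zero, norm_zero] at this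
      rw [indicator_of_notMem hx, le_antisymm (this.trans (by norm_num)) (norm_nonneg _),
        zero_pow hn]
  have hI := integral_det_fderiv_nonpos (Nat.one_le_iff_ne_zero.2 hn) hhd hhs hinth
  have hdeti : Integrable fun x => (fderiv ℝ h x).det :=
    hinth.mono' (continuous_clm_det.measurable.comp (measurable_fderiv ℝ h)).aestronglyMeasurable
      (Eventually.of_forall fun x => abs_det_le_norm_pow _)
  have hz : ∀ᵐ x, (fderiv ℝ h x).det = 0 :=
    (integral_eq_zero_iff_of_nonneg_ae hdet0 hdeti).1 (le_antisymm hI (integral_nonneg_of_ae hdet0))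
  have hu0 : u = 0 := by
    refine eq_zero_of_fderiv_eq_zero_ae i hud hus ?_
    filter_upwards [hz, hqr'] with x hx1 hx2
    by_cases hxU : x ∈ U
    · rw [hdet1 x hxU] at hx1
      rw [(hu1 x hxU).fderiv]
      rcases mul_eq_zero.1 hx1 with h0 | h0
      · rw [h0]
        ext v; simp
      · have h3 := hx2 (hUsub hxU)
        rw [h0, mul_zero] at h3
        have h4 : fderiv ℝ f x = 0 := by
          have := le_antisymm h3 (by positivity)
          exact norm_eq_zero.1 (pow_eq_zero_iff hn |>.1 this)
        rw [h4]
        ext v; simp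
    · exact (hu2 x hxU).fderiv
  intro x hx
  have := congrFun hu0 x
  simpa [hu, hx] using this

theorem hasDerivAt_max_zero_sq (s : ℝ) :
    HasDerivAt (fun t : ℝ => max t 0 ^ 2) (2 * max s 0) s := by
  rcases lt_trichotomy s 0 with h | h | h
  · rw [max_eq_right h.le, mul_zero]
    refine (hasDerivAt_const s (0 : ℝ)).congr_of_eventuallyEq ?_
    filter_upwards [Iio_mem_nhds h] with t ht
    simp [max_eq_right (le_of_lt (mem_Iio.1 ht))]
  · subst h
    rw [hasDerivAt_iff_isLittleO]
    have h1 : HasDerivAt (fun t : ℝ => t ^ 2) 0 0 := by simpa using hasDerivAt_pow 2 (0 : ℝ)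
    rw [hasDerivAt_iff_isLittleO] at h1
    refine (Asymptotics.IsBigO.of_norm_le fun t => ?_).trans_isLittleO h1.norm_left
    rcases le_total t 0 with h | h
    · simp [max_eq_right h, sq_nonneg]
    · simp [max_eq_left h]
  · rw [max_eq_left h.le]
    have h1 : HasDerivAt (fun t : ℝ => t ^ 2) (2 * s) s := by simpa using hasDerivAt_pow 2 s
    refine h1.congr_of_eventuallyEq ?_
    filter_upwards [Ioi_mem_nhds h] with t ht
    simp [max_eq_left (le_of_lt (mem_Ioi.1 ht))]

/-- The coordinates of a quasiregular map satisfy the maximum and the minimum principle. -/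
theorem coord_mem_Icc_of_frontier {n : ℕ} (i : Fin n) {Ω U : Set (Vec n)} {f : Vec n → Vec n}
    {K : ℝ} (hΩ : IsOpen Ω) (hU : IsOpen U) (hUc : IsCompact (closure U)) (hUΩ : closure U ⊆ Ω)
    (hd : ∀ x ∈ Ω, DifferentiableAt ℝ f x)
    (hqr : ∀ᵐ x ∂(volume.restrict Ω), ‖fderiv ℝ f x‖ ^ n ≤ K * (fderiv ℝ f x).det)
    (hK : 0 < K)
    (hint : ∀ S ⊆ Ω, IsCompact S → IntegrableOn (fun x => ‖fderiv ℝ f x‖ ^ n) S)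
    {m M : ℝ} (hfr : ∀ x ∈ frontier U, f x i ∈ Icc m M) :
    ∀ x ∈ U, f x i ∈ Icc m M := by
  intro x hx
  constructor
  · have h := truncation_eq_zero i hΩ hU hUc hUΩ hd hqr hK hint
      (ψ := fun s => -(max (m - s) 0 ^ 2)) (ψ' := fun s => 2 * max (m - s) 0) (fun s => by
        have h1 := ((hasDerivAt_max_zero_sq (m - s)).comp s
          ((hasDerivAt_const s m).sub (hasDerivAt_id s))).neg
        convert! h1 using 1
        ring) (by fun_prop) (fun s => mul_nonneg zero_le_two (le_max_right _ _)) (fun y hy => by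
        have := (hfr y hy).1
        simp [max_eq_right (sub_nonpos.2 this)]) x hx
    simpa using h
  · have h := truncation_eq_zero i hΩ hU hUc hUΩ hd hqr hK hint
      (ψ := fun s => max (s - M) 0 ^ 2) (ψ' := fun s => 2 * max (s - M) 0) (fun s => by
        have h1 := (hasDerivAt_max_zero_sq (s - M)).comp s
          ((hasDerivAt_id s).sub (hasDerivAt_const s M))
        convert! h1 using 1
        ring) (by fun_prop) (fun s => mul_nonneg zero_le_two (le_max_right _ _)) (fun y hy => by
        have := (hfr y hy).2
        simp [max_eq_right (sub_nonpos.2 this)]) x hx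
    simpa using h

theorem enorm_sub_le_lintegral_deriv {F : Type*} [NormedAddCommGroup F] [NormedSpace ℝ F]
    [CompleteSpace F] {φ φ' : ℝ → F} {a b : ℝ} (hab : a ≤ b)
    (hφ : ∀ t ∈ Icc a b, HasDerivAt φ (φ' t) t) :
    ‖φ b - φ a‖ₑ ≤ ∫⁻ t in Ioc a b, ‖φ' t‖ₑ := by
  have he : ∀ t ∈ Ioc a b, ‖deriv φ t‖ₑ = ‖φ' t‖ₑ := fun t ht => by
    rw [(hφ t (Ioc_subset_Icc_self ht)).deriv]
  rw [← setLIntegral_congr_fun measurableSet_Ioc he]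
  by_cases hfin : ∫⁻ t in Ioc a b, ‖deriv φ t‖ₑ = ⊤
  · rw [hfin]; exact le_top
  have hi : IntegrableOn (deriv φ) (Ioc a b) volume :=
    ⟨(stronglyMeasurable_deriv φ).aestronglyMeasurable, lt_top_iff_ne_top.2 hfin⟩
  have := intervalIntegral.integral_eq_sub_of_hasDerivAt (f := φ) (f' := deriv φ) (a := a) (b := b)
    (fun t ht => by
      rw [uIcc_of_le hab] at ht
      exact (hφ t ht).differentiableAt.hasDerivAt)
    ((intervalIntegrable_iff_integrableOn_Ioc_of_le hab).2 hi)
  rw [← this, intervalIntegral.integral_of_le hab]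
  exact enorm_integral_le_lintegral_enorm _

theorem lintegral_pow_le {X : Type*} [MeasurableSpace X] {μ : Measure X} {g : X → ℝ≥0∞}
    (hg : AEMeasurable g μ) (m : ℕ) :
    (∫⁻ x, g x ∂μ) ^ (m + 1) ≤ μ univ ^ m * ∫⁻ x, g x ^ (m + 1) ∂μ := by
  rcases Nat.eq_zero_or_pos m with rfl | hm
  · simp
  have hm' : (0 : ℝ) < m := by exact_mod_cast hm
  have hpq : ((m + 1 : ℕ) : ℝ).HolderConjugate ((m + 1) / m) := by
    rw [Real.holderConjugate_iff]
    constructor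
    · push_cast; linarith
    · push_cast; field_simp; ring
  have h := ENNReal.lintegral_mul_le_Lp_mul_Lq μ hpq hg (aemeasurable_const (b := (1 : ℝ≥0∞)))
  simp only [Pi.mul_apply, mul_one, ENNReal.rpow_natCast, ENNReal.one_rpow, lintegral_const,
    one_mul] at h
  refine (pow_le_pow_left₀ zero_le h (m + 1)).trans (le_of_eq ?_)
  rw [mul_pow, mul_comm, ← ENNReal.rpow_natCast, ← ENNReal.rpow_natCast, ← ENNReal.rpow_mul,
    ← ENNReal.rpow_mul, ← ENNReal.rpow_natCast]
  congr 1
  · congr 1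
    push_cast
    field_simp
  · rw [one_div, inv_mul_cancel₀ (by positivity), ENNReal.rpow_one]

theorem lintegral_comp_smul_add {m : ℕ} {G : (Fin m → ℝ) → ℝ≥0∞} (hG : Measurable G) {t : ℝ}
    (ht : 0 < t) (z : Fin m → ℝ) :
    ∫⁻ y, G (t • y + z) = ENNReal.ofReal t⁻¹ ^ m * ∫⁻ y, G y := by
  have h1 : ∫⁻ y, G (t • y + z) = ∫⁻ y, G (y + z) ∂(Measure.map (fun y => t • y) volume) := by
    rw [lintegral_map (f := fun y => G (y + z)) (hG.comp (measurable_add_const z))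
      (measurable_const_smul t)]
  rw [h1, Measure.map_addHaar_smul volume ht.ne', lintegral_smul_measure,
    lintegral_add_right_eq_self G z]
  simp only [Module.finrank_fintype_fun_eq_card, Fintype.card_fin, smul_eq_mul]
  rw [abs_of_pos (by positivity), ← inv_pow, ENNReal.ofReal_pow (by positivity)]

theorem lintegral_cube_enorm_sub_le {m : ℕ} {F : Type*} [NormedAddCommGroup F] [NormedSpace ℝ F]
    [CompleteSpace F] {v : (Fin m → ℝ) → F} {c : Fin m → ℝ} {s : ℝ} (hs : 0 < s)
    (hv : ∀ y ∈ closedBall c s, DifferentiableAt ℝ v y) {x : Fin m → ℝ}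
    (hx : x ∈ closedBall c s) :
    ∫⁻ y in closedBall c s, ‖v y - v x‖ₑ ≤ ENNReal.ofReal (2 * s) * (m + 1) *
      (ENNReal.ofReal (2 * s) ^ m) ^ ((m : ℝ) / (m + 1)) *
      (∫⁻ y in closedBall c s, ‖fderiv ℝ v y‖ₑ ^ (m + 1)) ^ (1 / ((m : ℝ) + 1)) := by
  set Q := closedBall c s with hQ
  set E := ∫⁻ y in Q, ‖fderiv ℝ v y‖ₑ ^ (m + 1) with hE
  have hQm : MeasurableSet Q := measurableSet_closedBall
  have hconv : Convex ℝ Q := convex_closedBall c s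
  have hseg : ∀ y ∈ Q, ∀ t ∈ Icc (0 : ℝ) 1, t • y + (1 - t) • x ∈ Q := fun y hy t ht =>
    hconv hy hx ht.1 (by linarith [ht.2]) (by ring)
  have hgm : Measurable fun y => ‖fderiv ℝ v y‖ₑ := (measurable_fderiv ℝ v).enorm
  have h1 : ∀ y ∈ Q, ‖v y - v x‖ₑ ≤
      ENNReal.ofReal (2 * s) * ∫⁻ t in Ioc (0 : ℝ) 1, ‖fderiv ℝ v (t • y + (1 - t) • x)‖ₑ := by
    intro y hy
    have hyx : ‖y - x‖ₑ ≤ ENNReal.ofReal (2 * s) := by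
      rw [← ofReal_norm, ← dist_eq_norm]
      refine ENNReal.ofReal_le_ofReal ((dist_triangle_right y x c).trans ?_)
      have := mem_closedBall.1 hy
      have := mem_closedBall.1 hx
      linarith
    have h2 := enorm_sub_le_lintegral_deriv (φ := fun t : ℝ => v (t • y + (1 - t) • x))
      (φ' := fun t => fderiv ℝ v (t • y + (1 - t) • x) (y - x)) zero_le_one fun t ht => by
        have e1 : HasDerivAt (fun t : ℝ => t • y + (1 - t) • x) (y - x) t := by
          have := ((hasDerivAt_id t).smul_const y).add
            (((hasDerivAt_const t (1 : ℝ)).sub (hasDerivAt_id t)).smul_const x)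
          convert! this using 1
          simp [sub_eq_add_neg]
        exact (hv _ (hseg y hy t ht)).hasFDerivAt.comp_hasDerivAt t e1
    simp only [one_smul, sub_self, zero_smul, add_zero, zero_add, sub_zero] at h2
    refine h2.trans ?_
    rw [← lintegral_const_mul' _ _ ENNReal.ofReal_ne_top]
    refine lintegral_mono fun t => ?_
    rw [mul_comm]
    exact (ContinuousLinearMap.le_opENorm _ _).trans (mul_le_mul_right hyx _)
  have h3 : ∀ t ∈ Ioc (0 : ℝ) 1, ∫⁻ y in Q, ‖fderiv ℝ v (t • y + (1 - t) • x)‖ₑ ≤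
      ENNReal.ofReal (t ^ (-((m : ℝ) / (m + 1)))) *
        ((ENNReal.ofReal (2 * s) ^ m) ^ ((m : ℝ) / (m + 1)) * E ^ (1 / ((m : ℝ) + 1))) := by
    intro t ht
    have ha : Measurable fun y : Fin m → ℝ => t • y + (1 - t) • x := by fun_prop
    have h4 := lintegral_pow_le (μ := volume.restrict Q)
      (hgm.comp ha).aemeasurable m
    have h5 : ∫⁻ y in Q, (‖fderiv ℝ v (t • y + (1 - t) • x)‖ₑ) ^ (m + 1) ≤
        ENNReal.ofReal t⁻¹ ^ m * E := by
      rw [hE, ← lintegral_indicator hQm, ← lintegral_indicator hQm, ← lintegral_comp_smul_add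
        ((hgm.pow_const _).indicator hQm) ht.1 ((1 - t) • x)]
      refine lintegral_mono fun y => ?_
      by_cases hy : y ∈ Q
      · rw [indicator_of_mem hy, indicator_of_mem (hseg y hy t (Ioc_subset_Icc_self ht))]
      · rw [indicator_of_notMem hy]; exact zero_le
    have hvol : volume Q = ENNReal.ofReal (2 * s) ^ m := by
      rw [hQ, Real.volume_pi_closedBall _ hs.le, Fintype.card_fin, ENNReal.ofReal_pow (by positivity)]
    have hm1 : (0 : ℝ) < (m : ℝ) + 1 := by positivity
    have h6 : (∫⁻ y in Q, ‖fderiv ℝ v (t • y + (1 - t) • x)‖ₑ) ^ ((m : ℝ) + 1) ≤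
        (ENNReal.ofReal (2 * s) ^ m) ^ (m : ℝ) * (ENNReal.ofReal t⁻¹ ^ (m : ℝ) * E) := by
      have := h4.trans (mul_le_mul_right h5 _)
      rw [Measure.restrict_apply_univ, hvol] at this
      exact_mod_cast this
    rw [← ENNReal.le_rpow_inv_iff hm1] at h6
    refine h6.trans (le_of_eq ?_)
    rw [ENNReal.mul_rpow_of_nonneg _ _ (by positivity), ENNReal.mul_rpow_of_nonneg _ _
      (by positivity), ← ENNReal.rpow_mul, ← ENNReal.rpow_mul, ENNReal.ofReal_rpow_of_pos
      (inv_pos.2 ht.1), Real.inv_rpow ht.1.le, ← Real.rpow_neg ht.1.le, one_div, div_eq_mul_inv]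
    ring
  have hint : ∫⁻ t in Ioc (0 : ℝ) 1, ENNReal.ofReal (t ^ (-((m : ℝ) / (m + 1)))) = m + 1 := by
    have hr : -1 < -((m : ℝ) / (m + 1)) := by
      rw [neg_lt_neg_iff, div_lt_one (by positivity)]; linarith
    rw [← ofReal_integral_eq_lintegral_ofReal
      ((intervalIntegrable_iff_integrableOn_Ioc_of_le zero_le_one).1
        (intervalIntegral.intervalIntegrable_rpow' hr))
      ((ae_restrict_iff' measurableSet_Ioc).2 (Eventually.of_forall fun t ht =>
        Real.rpow_nonneg ht.1.le _)), ← intervalIntegral.integral_of_le zero_le_one,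
      integral_rpow (Or.inl hr)]
    have hm1 : (m : ℝ) + 1 ≠ 0 := by positivity
    have e : -((m : ℝ) / (m + 1)) + 1 = (m + 1 : ℝ)⁻¹ := by field_simp; ring
    rw [e, Real.one_rpow, Real.zero_rpow (inv_ne_zero hm1), sub_zero, one_div, inv_inv]
    rw [ENNReal.ofReal_add (by positivity) zero_le_one, ENNReal.ofReal_natCast, ENNReal.ofReal_one]
  calc ∫⁻ y in Q, ‖v y - v x‖ₑ
      ≤ ∫⁻ y in Q, ENNReal.ofReal (2 * s) *
          ∫⁻ t in Ioc (0 : ℝ) 1, ‖fderiv ℝ v (t • y + (1 - t) • x)‖ₑ :=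
        setLIntegral_mono' hQm h1
    _ = ENNReal.ofReal (2 * s) * ∫⁻ t in Ioc (0 : ℝ) 1,
          ∫⁻ y in Q, ‖fderiv ℝ v (t • y + (1 - t) • x)‖ₑ := by
        rw [lintegral_const_mul' _ _ ENNReal.ofReal_ne_top, lintegral_lintegral_swap]
        refine (hgm.comp ?_).aemeasurable
        fun_prop
    _ ≤ ENNReal.ofReal (2 * s) * ∫⁻ t in Ioc (0 : ℝ) 1, ENNReal.ofReal (t ^ (-((m : ℝ) / (m + 1)))) *
        ((ENNReal.ofReal (2 * s) ^ m) ^ ((m : ℝ) / (m + 1)) * E ^ (1 / ((m : ℝ) + 1))) := by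
        exact mul_le_mul_right (setLIntegral_mono' measurableSet_Ioc h3) _
    _ = _ := by
        rw [lintegral_mul_const _ (by fun_prop), hint]
        ring

/-- Morrey's inequality on a cube, with the exponent one above the dimension. -/
theorem morrey_cube {m : ℕ} {F : Type*} [NormedAddCommGroup F] [NormedSpace ℝ F]
    [CompleteSpace F] {v : (Fin m → ℝ) → F} {c : Fin m → ℝ} {s : ℝ} (hs : 0 < s)
    (hv : ∀ y ∈ closedBall c s, DifferentiableAt ℝ v y) {x x' : Fin m → ℝ}
    (hx : x ∈ closedBall c s) (hx' : x' ∈ closedBall c s) :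
    ‖v x - v x'‖ₑ ^ (m + 1) ≤ (2 * (m + 1)) ^ (m + 1) * ENNReal.ofReal (2 * s) *
      ∫⁻ y in closedBall c s, ‖fderiv ℝ v y‖ₑ ^ (m + 1) := by
  have h1 := lintegral_cube_enorm_sub_le hs hv hx
  have h2 := lintegral_cube_enorm_sub_le hs hv hx'
  set Q := closedBall c s with hQ
  set E := ∫⁻ y in Q, ‖fderiv ℝ v y‖ₑ ^ (m + 1) with hE
  set S := ENNReal.ofReal (2 * s) with hS
  have hS0 : S ≠ 0 := by simp [hS, hs]
  have hSt : S ≠ ⊤ := ENNReal.ofReal_ne_top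
  have hm1 : (0 : ℝ) < (m : ℝ) + 1 := by positivity
  have hvol : volume Q = S ^ m := by
    rw [hQ, Real.volume_pi_closedBall _ hs.le, Fintype.card_fin, ENNReal.ofReal_pow (by positivity)]
  have hcont : ContinuousOn v Q := fun y hy => (hv y hy).continuousAt.continuousWithinAt
  have h3 : ‖v x - v x'‖ₑ * S ^ m ≤ 2 * (S * (m + 1) * (S ^ m) ^ ((m : ℝ) / (m + 1)) *
      E ^ (1 / ((m : ℝ) + 1))) := by
    calc ‖v x - v x'‖ₑ * S ^ m = ∫⁻ y in Q, ‖v x - v x'‖ₑ := by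
          rw [setLIntegral_const, hvol]
      _ ≤ ∫⁻ y in Q, (‖v y - v x‖ₑ + ‖v y - v x'‖ₑ) := by
          refine lintegral_mono fun y => ?_
          rw [show v x - v x' = (v y - v x') - (v y - v x) by abel, add_comm]
          exact enorm_sub_le
      _ = (∫⁻ y in Q, ‖v y - v x‖ₑ) + ∫⁻ y in Q, ‖v y - v x'‖ₑ := by
          refine lintegral_add_left' ?_ _
          exact ((hcont.sub continuousOn_const).aestronglyMeasurable
            measurableSet_closedBall).enorm
      _ ≤ _ := by rw [two_mul]; exact add_le_add h1 h2
  have h4 : (‖v x - v x'‖ₑ * S ^ m) ^ (m + 1) ≤ ((2 * (m + 1)) ^ (m + 1) * S * E) *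
      (S ^ m) ^ (m + 1) := by
    refine (pow_le_pow_left₀ zero_le h3 (m + 1)).trans (le_of_eq ?_)
    have e1 : ((S ^ m) ^ ((m : ℝ) / (m + 1))) ^ (m + 1) = (S ^ m) ^ m := by
      rw [← ENNReal.rpow_natCast, ← ENNReal.rpow_mul, ← ENNReal.rpow_natCast (S ^ m) m]
      congr 1
      push_cast
      field_simp
    have e2 : (E ^ (1 / ((m : ℝ) + 1))) ^ (m + 1) = E := by
      rw [← ENNReal.rpow_natCast, ← ENNReal.rpow_mul]
      push_cast
      rw [one_div, inv_mul_cancel₀ hm1.ne', ENNReal.rpow_one]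
    rw [mul_pow, mul_pow, mul_pow, mul_pow, e1, e2, mul_pow]
    ring
  rw [mul_pow] at h4
  exact (ENNReal.mul_le_mul_iff_left (by simp [hS0]) (by simp [hSt])).1 h4

theorem insertNth_mem_closedBall_iff {m : ℕ} {c : Fin (m + 1) → ℝ} {i : Fin (m + 1)} {S r : ℝ}
    (hS : 0 ≤ S) {y : Fin m → ℝ} :
    (i.insertNth r y : Fin (m + 1) → ℝ) ∈ closedBall c S ↔
      |r - c i| ≤ S ∧ y ∈ closedBall (i.removeNth c) S := by
  simp only [mem_closedBall, dist_pi_le_iff hS, Real.dist_eq]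
  rw [Fin.forall_iff_succAbove i]
  simp [Fin.removeNth]

theorem lintegral_lintegral_insertNth {m : ℕ} {G : (Fin (m + 1) → ℝ) → ℝ≥0∞} (hG : Measurable G)
    (c : Fin (m + 1) → ℝ) (i : Fin (m + 1)) {S : ℝ} (hS : 0 ≤ S) :
    ∫⁻ r in {r : ℝ | |r - c i| ≤ S}, ∫⁻ y in closedBall (i.removeNth c) S,
      G (i.insertNth r y) = ∫⁻ x in closedBall c S, G x := by
  have hm : Measurable ((closedBall c S).indicator G) := hG.indicator measurableSet_closedBall
  have hmr : MeasurableSet {r : ℝ | |r - c i| ≤ S} :=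
    measurableSet_le (by fun_prop) measurable_const
  have hpres := (volume_preserving_piFinSuccAbove (fun _ : Fin (m + 1) => ℝ) i).symm
  have hme := (MeasurableEquiv.piFinSuccAbove (fun _ : Fin (m + 1) => ℝ) i).symm.measurable
  rw [← lintegral_indicator measurableSet_closedBall, ← hpres.lintegral_comp hm,
    Measure.volume_eq_prod, lintegral_prod (fun p => (closedBall c S).indicator G
      ((MeasurableEquiv.piFinSuccAbove (fun _ : Fin (m + 1) => ℝ) i).symm p))
      (hm.comp hme).aemeasurable, ← lintegral_indicator hmr]
  refine lintegral_congr fun r => ?_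
  have e : ∀ y : Fin m → ℝ, (MeasurableEquiv.piFinSuccAbove (fun _ : Fin (m + 1) => ℝ) i).symm (r, y)
    = i.insertNth r y := fun y => rfl
  simp_rw [e]
  by_cases hr : |r - c i| ≤ S
  · rw [indicator_of_mem (by exact hr), ← lintegral_indicator measurableSet_closedBall]
    refine lintegral_congr fun y => ?_
    by_cases hy : y ∈ closedBall (i.removeNth c) S
    · rw [indicator_of_mem hy, indicator_of_mem ((insertNth_mem_closedBall_iff hS).2 ⟨hr, hy⟩)]
    · rw [indicator_of_notMem hy, indicator_of_notMem fun h =>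
        hy ((insertNth_mem_closedBall_iff hS).1 h).2]
  · rw [indicator_of_notMem (by exact hr)]
    refine (lintegral_eq_zero_of_ae_eq_zero (Eventually.of_forall fun y => ?_)).symm
    exact indicator_of_notMem (fun h => hr ((insertNth_mem_closedBall_iff hS).1 h).1) _

theorem exists_small_face_energies {m : ℕ} {G : (Fin (m + 1) → ℝ) → ℝ≥0∞} (hG : Measurable G)
    (c : Fin (m + 1) → ℝ) {s₀ : ℝ} (hs : 0 < s₀) :
    ∃ s ∈ Ioc s₀ (2 * s₀), ∀ i : Fin (m + 1), ∀ r : ℝ, |r - c i| = s →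
      ∫⁻ y in closedBall (i.removeNth c) (2 * s₀), G (i.insertNth r y) ≤
        2 * (m + 1) * (∫⁻ x in closedBall c (2 * s₀), G x) / ENNReal.ofReal s₀ := by
  set E := ∫⁻ x in closedBall c (2 * s₀), G x with hE
  let Φ : Fin (m + 1) → ℝ → ℝ≥0∞ := fun i r =>
    ∫⁻ y in closedBall (i.removeNth c) (2 * s₀), G (i.insertNth r y)
  have hΦm : ∀ i, Measurable (Φ i) := fun i => by
    have hme := (MeasurableEquiv.piFinSuccAbove (fun _ : Fin (m + 1) => ℝ) i).symm.measurable
    exact Measurable.lintegral_prod_right' (f := fun p : ℝ × (Fin m → ℝ) => G (i.insertNth p.1 p.2))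
      (hG.comp hme)
  have hmr : ∀ i, MeasurableSet {r : ℝ | |r - c i| ≤ 2 * s₀} := fun i =>
    measurableSet_le (by fun_prop) measurable_const
  have hplus : ∀ i, ∫⁻ s in Ioc s₀ (2 * s₀), Φ i (c i + s) ≤ E := fun i => by
    rw [hE, ← lintegral_lintegral_insertNth hG c i (by positivity), ← lintegral_indicator
      measurableSet_Ioc, ← lintegral_indicator (hmr i)]
    refine le_trans (lintegral_mono fun s => ?_) (lintegral_add_left_eq_self
      ({r : ℝ | |r - c i| ≤ 2 * s₀}.indicator (Φ i)) (c i)).le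
    by_cases h : s ∈ Ioc s₀ (2 * s₀)
    · rw [indicator_of_mem h, indicator_of_mem]
      rw [mem_ofPred_eq, add_sub_cancel_left, abs_of_pos (hs.trans h.1)]
      exact h.2
    · rw [indicator_of_notMem h]; exact zero_le
  have hminus : ∀ i, ∫⁻ s in Ioc s₀ (2 * s₀), Φ i (c i - s) ≤ E := fun i => by
    rw [hE, ← lintegral_lintegral_insertNth hG c i (by positivity), ← lintegral_indicator
      measurableSet_Ioc, ← lintegral_indicator (hmr i)]
    refine le_trans (lintegral_mono fun s => ?_) (lintegral_sub_left_eq_self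
      ({r : ℝ | |r - c i| ≤ 2 * s₀}.indicator (Φ i)) (c i)).le
    by_cases h : s ∈ Ioc s₀ (2 * s₀)
    · rw [indicator_of_mem h, indicator_of_mem]
      rw [mem_ofPred_eq, sub_sub_cancel_left, abs_neg, abs_of_pos (hs.trans h.1)]
      exact h.2
    · rw [indicator_of_notMem h]; exact zero_le
  have hvol : volume (Ioc s₀ (2 * s₀)) = ENNReal.ofReal s₀ := by
    rw [Real.volume_Ioc]; congr 1; ring
  have hm1 : ∀ i, Measurable fun s => Φ i (c i + s) := fun i => (hΦm i).comp (by fun_prop)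
  have hm2 : ∀ i, Measurable fun s => Φ i (c i - s) := fun i => (hΦm i).comp (by fun_prop)
  have hm12 : ∀ i, Measurable fun s => Φ i (c i + s) + Φ i (c i - s) := fun i =>
    (hm1 i).add (hm2 i)
  obtain ⟨s, hs1, hs2⟩ := exists_le_setLAverage (μ := volume) (s := Ioc s₀ (2 * s₀))
    (f := fun s => ∑ i, (Φ i (c i + s) + Φ i (c i - s)))
    (by rw [hvol]; simp [hs]) (by rw [hvol]; exact ENNReal.ofReal_ne_top)
    (Finset.measurable_sum _ fun i _ => hm12 i).aemeasurable
  have hsum : ∫⁻ s in Ioc s₀ (2 * s₀), ∑ i, (Φ i (c i + s) + Φ i (c i - s)) ≤ 2 * (m + 1) * E := by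
    rw [lintegral_finsetSum _ fun i _ => hm12 i]
    calc _ ≤ ∑ i : Fin (m + 1), (E + E) := Finset.sum_le_sum fun i _ => by
          rw [lintegral_add_left (hm1 i)]
          exact add_le_add (hplus i) (hminus i)
      _ = _ := by
          rw [Finset.sum_const, Finset.card_univ, Fintype.card_fin, nsmul_eq_mul]
          push_cast
          ring
  rw [setLAverage_eq, hvol] at hs2
  refine ⟨s, hs1, fun i r hr => ?_⟩
  have h1 : Φ i r ≤ ∑ i, (Φ i (c i + s) + Φ i (c i - s)) := by
    refine le_trans ?_ (Finset.single_le_sum (f := fun i => Φ i (c i + s) + Φ i (c i - s))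
      (fun _ _ => zero_le) (Finset.mem_univ i))
    rcases abs_choice (r - c i) with h | h
    · have : r = c i + s := by linarith
      rw [this]; exact le_self_add
    · have : r = c i - s := by linarith
      rw [this]; exact le_add_self
  exact h1.trans (hs2.trans (ENNReal.div_le_div_right hsum _))

theorem face_enorm_sub_pow_le {m : ℕ} {V : Type*} [NormedAddCommGroup V] [NormedSpace ℝ V]
    [CompleteSpace V] {F : (Fin (m + 1) → ℝ) → V} {c : Fin (m + 1) → ℝ} {s : ℝ} (hs : 0 < s)
    (hF : ∀ y ∈ closedBall c s, DifferentiableAt ℝ F y) {i : Fin (m + 1)}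
    {p q : Fin (m + 1) → ℝ} (hp : p ∈ closedBall c s) (hq : q ∈ closedBall c s) (hpq : p i = q i) :
    ‖F p - F q‖ₑ ^ (m + 1) ≤ (2 * (m + 1)) ^ (m + 1) * ENNReal.ofReal (2 * s) *
      ∫⁻ y in closedBall (i.removeNth c) s, ‖fderiv ℝ F (i.insertNth (p i) y)‖ₑ ^ (m + 1) := by
  have ep : i.insertNth (p i) (i.removeNth p) = p := Fin.insertNth_self_removeNth i p
  have eq : i.insertNth (p i) (i.removeNth q) = q := by
    rw [hpq]; exact Fin.insertNth_self_removeNth i q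
  have hp' := (insertNth_mem_closedBall_iff hs.le).1 (ep.symm ▸ hp)
  have hq' := (insertNth_mem_closedBall_iff hs.le).1 (eq.symm ▸ hq)
  let L : (Fin m → ℝ) →L[ℝ] (Fin (m + 1) → ℝ) := ContinuousLinearMap.pi fun j =>
    (Fin.insertNth i 0 (fun k => ContinuousLinearMap.proj k) :
      Fin (m + 1) → ((Fin m → ℝ) →L[ℝ] ℝ)) j
  have hL : ∀ y, L y = i.insertNth 0 y := fun y => by
    funext j
    refine Fin.succAboveCases i ?_ (fun k => ?_) j <;> simp [L]
  have hL1 : ‖L‖ₑ ≤ 1 := by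
    rw [← ofReal_norm]
    refine ENNReal.ofReal_le_one.2 (ContinuousLinearMap.opNorm_le_bound _ zero_le_one fun y => ?_)
    rw [hL, one_mul, pi_norm_le_iff_of_nonneg (norm_nonneg _), Fin.forall_iff_succAbove i]
    refine ⟨by simp, fun k => ?_⟩
    simpa using norm_le_pi_norm y k
  have hd : ∀ y ∈ closedBall (i.removeNth c) s, HasFDerivAt (fun y => F (i.insertNth (p i) y))
      ((fderiv ℝ F (i.insertNth (p i) y)).comp L) y := by
    intro y hy
    have h1 : HasFDerivAt (fun y : Fin m → ℝ => (i.insertNth (p i) y : Fin (m + 1) → ℝ)) L y := by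
      have e : (fun y : Fin m → ℝ => (i.insertNth (p i) y : Fin (m + 1) → ℝ)) =
          fun y => L y + i.insertNth (p i) 0 := by
        funext y j
        rw [hL]
        refine Fin.succAboveCases i ?_ (fun k => ?_) j <;> simp
      rw [e]
      exact L.hasFDerivAt.add_const _
    exact (hF _ ((insertNth_mem_closedBall_iff hs.le).2 ⟨hp'.1, hy⟩)).hasFDerivAt.comp y h1
  have := morrey_cube (v := fun y => F (i.insertNth (p i) y)) hs
    (fun y hy => (hd y hy).differentiableAt) hp'.2 hq'.2
  simp only [ep, eq] at this
  refine this.trans (mul_le_mul_right (setLIntegral_mono' measurableSet_closedBall fun y hy => ?_) _)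
  rw [(hd y hy).fderiv]
  refine pow_le_pow_left₀ zero_le ?_ _
  refine (ContinuousLinearMap.opENorm_comp_le _ _).trans ?_
  exact (mul_le_mul_right hL1 _).trans (mul_one _).le

/-- A map with finite energy oscillates little on the boundary of some cube. -/
theorem exists_cube_boundary_osc {m : ℕ} (hm : 1 ≤ m) {V : Type*} [NormedAddCommGroup V]
    [NormedSpace ℝ V] [CompleteSpace V] {F : (Fin (m + 1) → ℝ) → V} {c : Fin (m + 1) → ℝ} {s₀ : ℝ}
    (hs : 0 < s₀) (hF : ∀ y ∈ closedBall c (2 * s₀), DifferentiableAt ℝ F y) :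
    ∃ s ∈ Ioc s₀ (2 * s₀), ∀ p ∈ sphere c s, ∀ q ∈ sphere c s,
      ‖F p - F q‖ₑ ≤ 4 * ((2 * (m + 1)) ^ (m + 1) * (8 * (m + 1)) *
        ∫⁻ y in closedBall c (2 * s₀), ‖fderiv ℝ F y‖ₑ ^ (m + 1)) ^ (1 / ((m : ℝ) + 1)) := by
  set E := ∫⁻ y in closedBall c (2 * s₀), ‖fderiv ℝ F y‖ₑ ^ (m + 1) with hE
  obtain ⟨s, hs1, hs2⟩ := exists_small_face_energies (G := fun y => ‖fderiv ℝ F y‖ₑ ^ (m + 1))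
    ((measurable_fderiv ℝ F).enorm.pow_const _) c hs
  have hs0 : 0 < s := hs.trans hs1.1
  refine ⟨s, hs1, ?_⟩
  set D := ((2 * (m + 1)) ^ (m + 1) * (8 * (m + 1)) * E) ^ (1 / ((m : ℝ) + 1)) with hD
  have key : ∀ i : Fin (m + 1), ∀ p ∈ closedBall c s, ∀ q ∈ closedBall c s, p i = q i →
      |p i - c i| = s → ‖F p - F q‖ₑ ≤ D := by
    intro i p hp q hq hpq hpi
    have h1 := face_enorm_sub_pow_le hs0 (fun y hy => hF y (closedBall_subset_closedBall hs1.2 hy))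
      hp hq hpq
    have h2 : ∫⁻ y in closedBall (i.removeNth c) s, ‖fderiv ℝ F (i.insertNth (p i) y)‖ₑ ^ (m + 1) ≤
        2 * (m + 1) * E / ENNReal.ofReal s₀ :=
      (lintegral_mono_set (closedBall_subset_closedBall hs1.2)).trans (hs2 i (p i) hpi)
    have h3 : ‖F p - F q‖ₑ ^ (m + 1) ≤ (2 * (m + 1)) ^ (m + 1) * (8 * (m + 1)) * E := by
      refine h1.trans ?_
      calc _ ≤ (2 * (m + 1)) ^ (m + 1) * ENNReal.ofReal (4 * s₀) *
            (2 * (m + 1) * E / ENNReal.ofReal s₀) := by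
            refine mul_le_mul' (mul_le_mul_right (ENNReal.ofReal_le_ofReal ?_) _) h2
            linarith [hs1.2]
        _ = (2 * (m + 1)) ^ (m + 1) * (8 * (m + 1)) * E *
            (ENNReal.ofReal s₀ * (ENNReal.ofReal s₀)⁻¹) := by
            rw [ENNReal.ofReal_mul (by norm_num), div_eq_mul_inv,
              show ENNReal.ofReal 4 = 4 by simp]
            ring
        _ = _ := by
            rw [ENNReal.mul_inv_cancel (by simp [hs]) ENNReal.ofReal_ne_top, mul_one]
    rw [hD, one_div, ENNReal.le_rpow_inv_iff (by positivity)]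
    exact_mod_cast h3
  have tri : ∀ x y z : Fin (m + 1) → ℝ, ‖F x - F z‖ₑ ≤ ‖F x - F y‖ₑ + ‖F y - F z‖ₑ := fun x y z => by
    rw [← sub_add_sub_cancel (F x) (F y) (F z)]
    exact enorm_add_le _ _
  have sym : ∀ x y : Fin (m + 1) → ℝ, ‖F x - F y‖ₑ = ‖F y - F x‖ₑ := fun x y => by
    rw [← enorm_neg, neg_sub]
  have hcorner : ∀ x : Fin (m + 1) → ℝ, (∀ k, |x k - c k| = s) → x ∈ closedBall c s := by
    intro x hx
    rw [mem_closedBall, dist_pi_le_iff hs0.le]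
    intro k
    rw [Real.dist_eq, hx k]
  have base : ∀ p ∈ sphere c s, ‖F p - F (fun k => c k + s)‖ₑ ≤ D + D := by
    intro p hp
    have hpb := sphere_subset_closedBall hp
    obtain ⟨i, hi⟩ : ∃ i, |p i - c i| = s := by
      by_contra! h
      have h1 : dist p c < s := by
        rw [dist_pi_lt_iff hs0]
        intro k
        refine lt_of_le_of_ne ?_ (by rw [Real.dist_eq]; exact h k)
        exact (dist_le_pi_dist p c k).trans (mem_closedBall.1 hpb)
      exact h1.ne (mem_sphere.1 hp)
    set w : Fin (m + 1) → ℝ := Function.update (fun k => c k + s) i (p i) with hw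
    have hwi : w i = p i := by simp [hw]
    have hwk : ∀ k, k ≠ i → w k = c k + s := fun k hk => by simp [hw, hk]
    have hwb : w ∈ closedBall c s := hcorner w fun k => by
      by_cases hk : k = i
      · rw [hk, hwi, hi]
      · rw [hwk k hk, add_sub_cancel_left, abs_of_pos hs0]
    obtain ⟨k, hk⟩ : ∃ k : Fin (m + 1), k ≠ i := by
      have : Nontrivial (Fin (m + 1)) := Fin.nontrivial_iff_two_le.2 (by omega)
      exact exists_ne i
    refine (tri p w _).trans (add_le_add (key i p hpb w hwb hwi.symm hi) ?_)
    refine key k w hwb _ (hcorner _ fun j => ?_) (hwk k hk) ?_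
    · rw [add_sub_cancel_left, abs_of_pos hs0]
    · rw [hwk k hk, add_sub_cancel_left, abs_of_pos hs0]
  intro p hp q hq
  refine (tri p (fun k => c k + s) q).trans ?_
  rw [sym _ q]
  refine (add_le_add (base p hp) (base q hq)).trans (le_of_eq ?_)
  ring

/-- Oscillation of a map satisfying the quasiregularity inequality in terms of its energy. -/
theorem exists_osc_const {n : ℕ} (hn : 2 ≤ n) : ∃ C : ℝ≥0∞, C ≠ ⊤ ∧
    ∀ (Ω : Set (EuclideanSpace ℝ (Fin n))) (f : EuclideanSpace ℝ (Fin n) → EuclideanSpace ℝ (Fin n))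
      (K : ℝ), IsOpen Ω → (∀ x ∈ Ω, DifferentiableAt ℝ f x) →
      (∀ᵐ x ∂(volume.restrict Ω), ‖fderiv ℝ f x‖ ^ n ≤ K * (fderiv ℝ f x).det) → 0 < K →
      (∀ S ⊆ Ω, IsCompact S → IntegrableOn (fun x => ‖fderiv ℝ f x‖ ^ n) S) →
      ∀ (x : EuclideanSpace ℝ (Fin n)) (r : ℝ), 0 < r → closedBall x (2 * n * r) ⊆ Ω →
      ∀ z ∈ closedBall x r, ‖f z - f x‖ₑ ≤
        C * (∫⁻ y in closedBall x (2 * n * r), ‖fderiv ℝ f y‖ₑ ^ n) ^ (1 / (n : ℝ)) := by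
  obtain ⟨m, rfl⟩ : ∃ m, n = m + 1 := ⟨n - 1, by omega⟩
  refine ⟨(m + 1) * (2 * (4 * (((2 * (m + 1)) ^ (m + 1) * (8 * (m + 1)) * (m + 1) ^ (m + 1)) ^
    (1 / ((m : ℝ) + 1))))), ?_, ?_⟩
  · have h1 : (((2 * (m + 1)) ^ (m + 1) * (8 * (m + 1)) * (m + 1) ^ (m + 1) : ℝ≥0∞)) ≠ ⊤ := by
      exact_mod_cast ENNReal.natCast_ne_top ((2 * (m + 1)) ^ (m + 1) * (8 * (m + 1)) * (m + 1) ^ (m + 1))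
    have h2 := ENNReal.rpow_ne_top_of_nonneg (show (0:ℝ) ≤ 1 / ((m : ℝ) + 1) by positivity) h1
    have h3 : (m + 1 : ℝ≥0∞) ≠ ⊤ := by exact_mod_cast ENNReal.natCast_ne_top (m + 1)
    exact ENNReal.mul_ne_top h3 (ENNReal.mul_ne_top (by simp) (ENNReal.mul_ne_top (by simp) h2))
  intro Ω f K hΩ hd hqr hK hint x r hr hball z hz
  have hmc : (((m + 1 : ℕ) : ℝ)) = (m : ℝ) + 1 := by push_cast; ring
  have hm0 : (0 : ℝ) < (m : ℝ) + 1 := by positivity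
  let e := PiLp.continuousLinearEquiv 2 ℝ (fun _ : Fin (m + 1) => ℝ)
  have he1 : ∀ v, ‖e v‖ ≤ ‖v‖ := fun v => by
    rw [pi_norm_le_iff_of_nonneg (norm_nonneg _)]
    exact fun i => PiLp.norm_apply_le v i
  have he2 : ∀ v, ‖v‖ ≤ (m + 1) * ‖e v‖ := fun v => by
    rw [EuclideanSpace.norm_eq]
    refine Real.sqrt_le_iff.2 ⟨by positivity, ?_⟩
    calc ∑ i, ‖v i‖ ^ 2 ≤ ∑ i : Fin (m + 1), ‖e v‖ ^ 2 := Finset.sum_le_sum fun i _ =>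
          pow_le_pow_left₀ (norm_nonneg _) (norm_le_pi_norm (e v) i) 2
      _ = (m + 1) * ‖e v‖ ^ 2 := by simp
      _ ≤ _ := by
        rw [mul_pow]
        refine mul_le_mul_of_nonneg_right ?_ (by positivity)
        nlinarith [(m.cast_nonneg : (0 : ℝ) ≤ m)]
  have hsub : ∀ s, s ≤ 2 * r → e ⁻¹' closedBall (e x) s ⊆ closedBall x (2 * (m + 1 : ℕ) * r) := by
    intro s hs v hv
    rw [mem_closedBall, dist_eq_norm]
    rw [mem_preimage, mem_closedBall, dist_eq_norm, ← map_sub] at hv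
    refine (he2 _).trans ?_
    rw [hmc]
    nlinarith
  set E := ∫⁻ y in closedBall x (2 * (m + 1 : ℕ) * r), ‖fderiv ℝ f y‖ₑ ^ (m + 1) with hE
  have hEfin : E ≠ ⊤ := by
    have := (hint _ hball (isCompact_closedBall _ _)).2
    refine ne_top_of_le_ne_top this.ne (le_of_eq (lintegral_congr fun y => ?_))
    rw [Real.enorm_eq_ofReal (by positivity), ENNReal.ofReal_pow (norm_nonneg _), ofReal_norm]
  have hFd : ∀ y ∈ closedBall (e x) (2 * r),
      HasFDerivAt (f ∘ e.symm) ((fderiv ℝ f (e.symm y)).comp (e.symm : _ →L[ℝ] _)) y := by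
    intro y hy
    refine HasFDerivAt.comp y (hd _ (hball ?_)).hasFDerivAt e.symm.hasFDerivAt
    exact hsub _ le_rfl (by simpa using hy)
  have hesymm : ‖(e.symm : (Fin (m + 1) → ℝ) →L[ℝ] EuclideanSpace ℝ (Fin (m + 1)))‖ₑ ≤ m + 1 := by
    rw [← ofReal_norm]
    have : ‖(e.symm : (Fin (m + 1) → ℝ) →L[ℝ] EuclideanSpace ℝ (Fin (m + 1)))‖ ≤ (m + 1 : ℕ) := by
      refine ContinuousLinearMap.opNorm_le_bound _ (by positivity) fun y => ?_
      have := he2 (e.symm y)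
      rw [hmc]
      simpa using this
    refine (ENNReal.ofReal_le_ofReal this).trans ?_
    rw [ENNReal.ofReal_natCast]; push_cast; exact le_rfl
  have hen : ∫⁻ y in closedBall (e x) (2 * r), ‖fderiv ℝ (f ∘ e.symm) y‖ₑ ^ (m + 1) ≤
      (m + 1) ^ (m + 1) * E := by
    have hpres : MeasurePreserving e volume volume := PiLp.volume_preserving_ofLp (Fin (m + 1))
    calc _ ≤ ∫⁻ y in closedBall (e x) (2 * r), (m + 1) ^ (m + 1) * ‖fderiv ℝ f (e.symm y)‖ₑ ^ (m + 1) := by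
          refine setLIntegral_mono' measurableSet_closedBall fun y hy => ?_
          rw [(hFd y hy).fderiv, ← mul_pow, mul_comm]
          refine pow_le_pow_left₀ zero_le ?_ _
          exact (ContinuousLinearMap.opENorm_comp_le _ _).trans (mul_le_mul_right hesymm _)
      _ = (m + 1) ^ (m + 1) * ∫⁻ y in closedBall (e x) (2 * r), ‖fderiv ℝ f (e.symm y)‖ₑ ^ (m + 1) := by
          rw [lintegral_const_mul' _ _ (by exact_mod_cast ENNReal.natCast_ne_top ((m + 1) ^ (m + 1)))]
      _ ≤ _ := by
          refine mul_le_mul_right ?_ _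
          rw [← hpres.setLIntegral_comp_preimage measurableSet_closedBall
            (f := fun y => ‖fderiv ℝ f (e.symm y)‖ₑ ^ (m + 1))
            (((measurable_fderiv ℝ f).comp e.symm.continuous.measurable).enorm.pow_const _)]
          simp only [ContinuousLinearEquiv.symm_apply_apply]
          exact lintegral_mono_set (hsub _ le_rfl)
  obtain ⟨s, hs1, hs2⟩ := exists_cube_boundary_osc (F := f ∘ e.symm) (c := e x) (by omega) hr
    fun y hy => (hFd y hy).differentiableAt
  have hs0 : 0 < s := hr.trans hs1.1
  set D : ℝ≥0∞ := 4 * (((2 * (m + 1)) ^ (m + 1) * (8 * (m + 1)) * (m + 1) ^ (m + 1)) ^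
    (1 / ((m : ℝ) + 1)) * E ^ (1 / ((m : ℝ) + 1))) with hD
  have hDfin : D ≠ ⊤ := by
    have h1 : (((2 * (m + 1)) ^ (m + 1) * (8 * (m + 1)) * (m + 1) ^ (m + 1) : ℝ≥0∞)) ≠ ⊤ := by
      exact_mod_cast ENNReal.natCast_ne_top ((2 * (m + 1)) ^ (m + 1) * (8 * (m + 1)) * (m + 1) ^ (m + 1))
    have hp : (0:ℝ) ≤ 1 / ((m : ℝ) + 1) := by positivity
    exact ENNReal.mul_ne_top (by simp) (ENNReal.mul_ne_top
      (ENNReal.rpow_ne_top_of_nonneg hp h1) (ENNReal.rpow_ne_top_of_nonneg hp hEfin))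
  have hosc : ∀ p ∈ sphere (e x) s, ∀ q ∈ sphere (e x) s, ‖f (e.symm p) - f (e.symm q)‖ ≤ D.toReal := by
    intro p hp q hq
    rw [← ENNReal.ofReal_le_iff_le_toReal hDfin, ofReal_norm]
    refine (hs2 p hp q hq).trans ?_
    rw [hD, ← ENNReal.mul_rpow_of_nonneg _ _ (by positivity)]
    refine mul_le_mul_right (ENNReal.rpow_le_rpow ?_ (by positivity)) _
    refine (mul_le_mul_right hen _).trans (le_of_eq ?_)
    ring
  let U : Set (EuclideanSpace ℝ (Fin (m + 1))) := e ⁻¹' ball (e x) s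
  have hUo : IsOpen U := isOpen_ball.preimage e.continuous
  have hUcl : closure U = e ⁻¹' closedBall (e x) s := by
    rw [← closure_ball (e x) hs0.ne']
    exact (e.toHomeomorph.preimage_closure _).symm
  have hUfr : frontier U = e ⁻¹' sphere (e x) s := by
    rw [← frontier_ball (e x) hs0.ne']
    exact (e.toHomeomorph.preimage_frontier _).symm
  have hUc : IsCompact (closure U) := by
    rw [hUcl]
    exact e.toHomeomorph.isCompact_preimage.2 (isCompact_closedBall _ _)
  have hUΩ : closure U ⊆ Ω := by
    rw [hUcl]
    exact (hsub _ hs1.2).trans hball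
  let p₀ : Fin (m + 1) → ℝ := fun k => e x k + s
  have hp₀ : p₀ ∈ sphere (e x) s := by
    have : p₀ - e x = fun _ => s := by funext k; simp [p₀]
    rw [mem_sphere, dist_eq_norm, this, pi_norm_const, Real.norm_of_nonneg hs0.le]
  have hin : ∀ i, ∀ y ∈ U, f y i ∈ Icc (f (e.symm p₀) i - D.toReal) (f (e.symm p₀) i + D.toReal) :=
    fun i => coord_mem_Icc_of_frontier i hΩ hUo hUc hUΩ hd hqr hK hint fun y hy => by
      rw [hUfr] at hy
      have h1 := hosc (e y) hy p₀ hp₀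
      rw [ContinuousLinearEquiv.symm_apply_apply] at h1
      have h2 := (PiLp.norm_apply_le (f y - f (e.symm p₀)) i).trans h1
      rw [PiLp.sub_apply, Real.norm_eq_abs, abs_le] at h2
      constructor <;> linarith
  have hxU : x ∈ U := mem_ball_self hs0
  have hzU : z ∈ U := by
    change e z ∈ ball (e x) s
    rw [mem_ball, dist_eq_norm, ← map_sub]
    refine ((he1 _).trans ?_).trans_lt hs1.1
    rw [← dist_eq_norm]
    exact hz
  have hfin : ‖f z - f x‖ ≤ (m + 1) * (2 * D.toReal) := by
    refine (he2 _).trans (mul_le_mul_of_nonneg_left ?_ hm0.le)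
    rw [pi_norm_le_iff_of_nonneg (by positivity)]
    intro i
    have h1 := hin i x hxU
    have h2 := hin i z hzU
    change ‖(f z - f x) i‖ ≤ _
    rw [PiLp.sub_apply, Real.norm_eq_abs, abs_le]
    constructor <;> linarith [h1.1, h1.2, h2.1, h2.2]
  rw [← ofReal_norm]
  refine (ENNReal.ofReal_le_ofReal hfin).trans (le_of_eq ?_)
  rw [ENNReal.ofReal_mul hm0.le, ENNReal.ofReal_mul (by norm_num), ENNReal.ofReal_toReal hDfin,
    ENNReal.ofReal_add (by positivity) (by norm_num), ENNReal.ofReal_natCast, hD, hmc]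
  simp only [ENNReal.ofReal_one, ENNReal.ofReal_ofNat]
  ring

/-- Change of variables inequality for maps of bounded multiplicity. -/
theorem lintegral_abs_det_mul_comp_le {E : Type*} [NormedAddCommGroup E] [NormedSpace ℝ E]
    [FiniteDimensional ℝ E] [MeasurableSpace E] [BorelSpace E] (μ : Measure E)
    [μ.IsAddHaarMeasure] {f : E → E} {S T : Set E} (hS : MeasurableSet S) (hT : MeasurableSet T)
    (hf : ∀ x ∈ S, DifferentiableAt ℝ f x) (hST : MapsTo f S T) {φ : E → ℝ≥0∞}
    (hφ : Measurable φ) {N : ℝ≥0∞} (hN : ∀ y, (({x ∈ S | f x = y}).encard : ℝ≥0∞) ≤ N) :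
    ∫⁻ x in S, ENNReal.ofReal |(fderiv ℝ f x).det| * φ (f x) ∂μ ≤ N * ∫⁻ y in T, φ y ∂μ := by
  have hdm : Measurable fun x => (fderiv ℝ f x).det :=
    ContinuousLinearMap.continuous_det.measurable.comp (measurable_fderiv ℝ f)
  set S₀ := S ∩ {x | (fderiv ℝ f x).det ≠ 0} with hS₀
  have hZ : MeasurableSet {x | (fderiv ℝ f x).det ≠ 0} :=
    (measurableSet_eq_fun hdm measurable_const).compl
  have hS₀m : MeasurableSet S₀ := hS.inter hZ
  have hd : ∀ x ∈ S₀, HasFDerivAt f (fderiv ℝ f x) x := fun x hx => (hf x hx.1).hasFDerivAt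
  have hred : ∫⁻ x in S, ENNReal.ofReal |(fderiv ℝ f x).det| * φ (f x) ∂μ ≤
      ∫⁻ x in S₀, ENNReal.ofReal |(fderiv ℝ f x).det| * φ (f x) ∂μ := by
    rw [← lintegral_indicator hS, ← lintegral_indicator hS₀m]
    refine lintegral_mono fun x => ?_
    by_cases hx : x ∈ S
    · rw [indicator_of_mem hx]
      by_cases h0 : (fderiv ℝ f x).det = 0
      · simp [h0]
      · rw [indicator_of_mem (show x ∈ S₀ from ⟨hx, h0⟩)]
    · rw [indicator_of_notMem hx]; exact zero_le
  refine hred.trans ?_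
  rcases S₀.eq_empty_or_nonempty with he | hne
  · rw [he]; simp
  let r : (E →L[ℝ] E) → NNReal := fun A => if h : A.det = 0 then 1 else
    if Subsingleton E then 1 else ‖((A.toContinuousLinearEquivOfDetNeZero h).symm : E →L[ℝ] E)‖₊⁻¹ / 2
  have hr : ∀ A, r A ≠ 0 := by
    intro A
    simp only [r]
    split_ifs with h h' <;> try exact one_ne_zero
    have : Nontrivial E := not_subsingleton_iff_nontrivial.1 h'
    have h1 := (A.toContinuousLinearEquivOfDetNeZero h).nnnorm_symm_pos
    positivity
  obtain ⟨t, A, hdisj, htm, hcov, happ, hA⟩ := exists_partition_approximatesLinearOn_of_hasFDerivWithinAt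
    f S₀ (fderiv ℝ f) (fun x hx => (hd x hx).hasFDerivWithinAt) r hr
  have hinj : ∀ k, InjOn f (S₀ ∩ t k) := by
    intro k
    obtain ⟨y, hy, hAy⟩ := hA hne k
    have hdet : (A k).det ≠ 0 := by rw [hAy]; exact hy.2
    have h1 := happ k
    rw [← ContinuousLinearMap.coe_toContinuousLinearEquivOfDetNeZero (A k) hdet] at h1
    refine h1.injOn ?_
    by_cases hs : Subsingleton E
    · exact Or.inl hs
    · right
      have : Nontrivial E := not_subsingleton_iff_nontrivial.1 hs
      rw [ContinuousLinearMap.coe_toContinuousLinearEquivOfDetNeZero]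
      simp only [r, hdet, hs, dif_neg, not_false_eq_true, if_false]
      have h1 := ((A k).toContinuousLinearEquivOfDetNeZero hdet).nnnorm_symm_pos
      exact half_lt_self (by positivity)
  have hpm : ∀ k, MeasurableSet (S₀ ∩ t k) := fun k => hS₀m.inter (htm k)
  have hpd : ∀ k, ∀ x ∈ S₀ ∩ t k, HasFDerivWithinAt f (fderiv ℝ f x) (S₀ ∩ t k) x :=
    fun k x hx => (hd x hx.1).hasFDerivWithinAt
  have hdis : Pairwise (Function.onFun Disjoint fun k => S₀ ∩ t k) := fun i j hij =>
    (hdisj hij).mono inter_subset_right inter_subset_right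
  have hun : S₀ = ⋃ k, S₀ ∩ t k := by
    rw [← inter_iUnion]
    exact (inter_eq_left.2 hcov).symm
  have hfm : ∀ k, MeasurableSet (f '' (S₀ ∩ t k)) := fun k =>
    measurable_image_of_fderivWithin (hpm k) (hpd k) (hinj k)
  have hsum : ∀ y, ∑' k, (f '' (S₀ ∩ t k)).indicator φ y ≤ T.indicator (fun y => N * φ y) y := by
    intro y
    have h1 : ∑' k, (f '' (S₀ ∩ t k)).indicator φ y =
        (({k | y ∈ f '' (S₀ ∩ t k)}).encard : ℝ≥0∞) * φ y := by
      rw [← ENNReal.tsum_set_const, tsum_subtype {k | y ∈ f '' (S₀ ∩ t k)} fun _ => φ y]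
      rfl
    by_cases hy : y ∈ T
    · rw [h1, indicator_of_mem hy]
      refine mul_le_mul_left ((ENat.toENNReal_le.2 ?_).trans (hN y)) _
      choose! x hx using fun k (hk : y ∈ f '' (S₀ ∩ t k)) => hk
      refine encard_le_encard_of_injOn (f := x) (fun k hk => ⟨(hx k hk).1.1.1, (hx k hk).2⟩) ?_
      intro i hi j hj hij
      by_contra hne
      exact (disjoint_left.1 (hdis hne)) (hx i hi).1 (hij ▸ (hx j hj).1)
    · rw [indicator_of_notMem hy, h1]
      have : {k | y ∈ f '' (S₀ ∩ t k)} = ∅ := by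
        ext k
        simp only [mem_empty_iff_false, iff_false]
        rintro ⟨x, hx, rfl⟩
        exact hy (hST hx.1.1)
      rw [this]; simp
  calc ∫⁻ x in S₀, ENNReal.ofReal |(fderiv ℝ f x).det| * φ (f x) ∂μ
      = ∑' k, ∫⁻ x in S₀ ∩ t k, ENNReal.ofReal |(fderiv ℝ f x).det| * φ (f x) ∂μ := by
        conv_lhs => rw [hun]
        exact lintegral_iUnion hpm hdis _
    _ = ∑' k, ∫⁻ y, (f '' (S₀ ∩ t k)).indicator φ y ∂μ := by
        refine tsum_congr fun k => ?_
        rw [lintegral_indicator (hfm k),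
          lintegral_image_eq_lintegral_abs_det_fderiv_mul μ (hpm k) (hpd k) (hinj k)]
    _ = ∫⁻ y, ∑' k, (f '' (S₀ ∩ t k)).indicator φ y ∂μ :=
        (lintegral_tsum fun k => (hφ.indicator (hfm k)).aemeasurable).symm
    _ ≤ ∫⁻ y, T.indicator (fun y => N * φ y) y ∂μ := lintegral_mono hsum
    _ = N * ∫⁻ y in T, φ y ∂μ := by
        rw [lintegral_indicator hT, lintegral_const_mul _ hφ]

/-- The quantity `1 - ‖T_x z‖ ^ 2`. -/
def mobiusGap {n : ℕ} (x z : Vec n) : ℝ :=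
  (1 - ‖x‖ ^ 2) * (1 - ‖z‖ ^ 2) / (‖x - z‖ ^ 2 + (1 - ‖x‖ ^ 2) * (1 - ‖z‖ ^ 2))

theorem mobiusT_eq {n : ℕ} (x y : Vec n) : mobiusT n (-x) y =
    (1 + 2 * inner ℝ x y + ‖x‖ ^ 2 * ‖y‖ ^ 2)⁻¹ •
      ((1 - ‖x‖ ^ 2) • y + (1 + 2 * inner ℝ x y + ‖y‖ ^ 2) • x) := by
  by_cases hx : x = 0
  · simp [mobiusT, hx]
  have hx0 : ‖x‖ ≠ 0 := norm_ne_zero_iff.2 hx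
  rw [mobiusT, if_neg (neg_ne_zero.2 hx), norm_neg, sub_neg_eq_add, smul_neg, sub_neg_eq_add,
    smul_neg, sub_neg_eq_add]
  have h1 : ‖x‖ ^ 2 * ‖y + (‖x‖ ^ 2)⁻¹ • x‖ ^ 2 = 1 + 2 * inner ℝ x y + ‖x‖ ^ 2 * ‖y‖ ^ 2 := by
    rw [norm_add_sq_real, inner_smul_right, norm_smul, real_inner_comm, norm_inv, norm_pow,
      norm_norm]
    field_simp
    ring
  have h2 : ‖y + x‖ ^ 2 = ‖y‖ ^ 2 + 2 * inner ℝ x y + ‖x‖ ^ 2 := by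
    rw [norm_add_sq_real, real_inner_comm]
  rw [h1, h2]
  congr 1
  module

theorem mobiusT_zero_right {n : ℕ} (x : Vec n) : mobiusT n (-x) 0 = x := by
  rw [mobiusT_eq]
  simp

theorem one_sub_sq_norm_pos {n : ℕ} {x : Vec n} (hx : x ∈ unitBall n) : 0 < 1 - ‖x‖ ^ 2 := by
  have : ‖x‖ < 1 := mem_ball_zero_iff.1 hx
  nlinarith [norm_nonneg x]

theorem mobius_denominator_eq {n : ℕ} (x z : Vec n) :
    1 + 2 * inner ℝ (-x) z + ‖(-x : Vec n)‖ ^ 2 * ‖z‖ ^ 2 =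
      ‖x - z‖ ^ 2 + (1 - ‖x‖ ^ 2) * (1 - ‖z‖ ^ 2) := by
  rw [inner_neg_left, norm_neg, norm_sub_sq_real]
  ring

theorem exists_mobiusT_eq {n : ℕ} {x z : Vec n} (hx : x ∈ unitBall n) (hz : z ∈ unitBall n) :
    ∃ y : Vec n, mobiusT n (-x) y = z ∧ ‖y‖ ^ 2 = 1 - mobiusGap x z := by
  have hX := one_sub_sq_norm_pos hx
  have hZ := one_sub_sq_norm_pos hz
  have hXZ := mul_pos hX hZ
  have hD' := mobius_denominator_eq x z
  set D := 1 + 2 * inner ℝ (-x) z + ‖(-x : Vec n)‖ ^ 2 * ‖z‖ ^ 2 with hD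
  have hDpos : 0 < D := by rw [hD']; positivity
  rw [inner_neg_left, norm_neg] at hD
  set s := inner ℝ x z with hs
  have hy := mobiusT_eq (-x) z
  rw [norm_neg, inner_neg_left, ← hD, ← hs] at hy
  set y := mobiusT n (- -x) z with hydef
  have hyn : ‖y‖ ^ 2 = (‖z‖ ^ 2 - 2 * s + ‖x‖ ^ 2) / D := by
    rw [hy, norm_smul, mul_pow, norm_add_sq_real, norm_smul, norm_smul, inner_smul_left,
      inner_smul_right, inner_neg_right, real_inner_comm, ← hs, norm_neg]
    simp only [mul_pow, Real.norm_eq_abs, sq_abs, conj_trivial, inv_pow]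
    rw [eq_div_iff hDpos.ne', inv_mul_eq_div, div_mul_eq_mul_div, div_eq_iff (by positivity)]
    rw [hD]
    ring
  have hxy : inner ℝ x y = ((1 - ‖x‖ ^ 2) * s - (1 - 2 * s + ‖z‖ ^ 2) * ‖x‖ ^ 2) / D := by
    rw [hy, inner_smul_right, inner_add_right, inner_smul_right, inner_smul_right, inner_neg_right,
      real_inner_self_eq_norm_sq, ← hs]
    field_simp
    ring
  refine ⟨y, ?_, ?_⟩
  · have hDxy : 1 + 2 * inner ℝ x y + ‖x‖ ^ 2 * ‖y‖ ^ 2 = (1 - ‖x‖ ^ 2) ^ 2 / D := by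
      rw [hxy, hyn]
      field_simp
      rw [hD]
      ring
    have hc : 1 + 2 * inner ℝ x y + ‖y‖ ^ 2 = (1 - ‖x‖ ^ 2) * (1 + ‖z‖ ^ 2 - 2 * s) / D := by
      rw [hxy, hyn]
      field_simp
      rw [hD]
      ring
    rw [mobiusT_eq x y, hDxy, hc, hy]
    have hX' := hX.ne'
    have hD0 := hDpos.ne'
    match_scalars
    · field_simp
    · field_simp
      ring
  · rw [hyn, mobiusGap, ← hD', eq_sub_iff_add_eq, ← add_div, div_eq_one_iff_eq hDpos.ne', hD]
    ring

/-- Harnack inequality for maps in the Miniowitz class. -/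
theorem harnack_of_le_mobiusGap {n : ℕ} {C₀ α : ℝ} (hC₀ : 1 ≤ C₀) (hα : 0 < α) {f : Vec n → Vec n}
    (hf0 : ∀ x ∈ unitBall n, f x ≠ 0) (hmin : InMiniowitz n C₀ α f) {x z : Vec n}
    (hx : x ∈ unitBall n) (hz : z ∈ unitBall n) {δ : ℝ} (hδ : 0 < δ) (hgap : δ ≤ mobiusGap x z) :
    ‖f z‖ ≤ C₀ * (4 / δ) ^ α * ‖f x‖ ∧ C₀⁻¹ * (4 / δ) ^ (-α) * ‖f x‖ ≤ ‖f z‖ := by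
  obtain ⟨y, hy1, hy2⟩ := exists_mobiusT_eq hx hz
  have hy3 : ‖y‖ ^ 2 ≤ 1 - δ := by linarith
  have hy0 := norm_nonneg y
  have hy4 : ‖y‖ ≤ 1 - δ / 2 := by nlinarith [sq_nonneg (1 - ‖y‖)]
  obtain ⟨h1, h2⟩ := hmin x hx y (mem_ball_zero_iff.2 (by linarith))
  rw [hy1, mobiusT_zero_right] at h1 h2
  have hfx : 0 < ‖f x‖ := norm_pos_iff.2 (hf0 x hx)
  rw [div_le_iff₀ hfx] at h2
  rw [le_div_iff₀ hfx] at h1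
  have hq : (1 + ‖y‖) / (1 - ‖y‖) ≤ 4 / δ := by
    rw [div_le_div_iff₀ (by linarith) hδ]
    nlinarith
  have hq0 : 0 < (1 + ‖y‖) / (1 - ‖y‖) := div_pos (by linarith) (by linarith)
  constructor
  · refine h2.trans ?_
    gcongr
  · refine le_trans ?_ h1
    rw [← inv_div (1 + ‖y‖), Real.inv_rpow hq0.le, Real.rpow_neg (by positivity)]
    gcongr

/-- The surface measure obtained from Lebesgue measure by polar coordinates. -/
def polarSphere (n : ℕ) : Measure (Vec n) :=
  (volume : Measure (Vec n)).toSphere.map Subtype.val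

instance {n : ℕ} : IsFiniteMeasure (polarSphere n) := by
  unfold polarSphere
  infer_instance

theorem lintegral_polarSphere {n : ℕ} {G : Vec n → ℝ≥0∞} (hG : Measurable G) :
    ∫⁻ ω, G ω ∂(polarSphere n) = ∫⁻ ω : sphere (0 : Vec n) 1, G ω ∂(volume : Measure (Vec n)).toSphere :=
  lintegral_map hG measurable_subtype_coe

theorem ae_polarSphere_mem_unitSphere (n : ℕ) : ∀ᵐ ω ∂(polarSphere n), ω ∈ unitSphere n := by
  refine (ae_map_iff measurable_subtype_coe.aemeasurable ?_).2 (Eventually.of_forall fun ω => ω.2)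
  exact isClosed_sphere.measurableSet

/-- Integration in polar coordinates. -/
theorem lintegral_eq_polar {n : ℕ} (hn : 1 ≤ n) {G : Vec n → ℝ≥0∞} (hG : Measurable G) :
    ∫⁻ x, G x = ∫⁻ ω, (∫⁻ r in Ioi (0 : ℝ), ENNReal.ofReal (r ^ (n - 1)) * G (r • ω))
      ∂(polarSphere n) := by
  have : Nontrivial (Vec n) := by
    refine Module.nontrivial_of_finrank_pos (R := ℝ) ?_
    rw [finrank_euclideanSpace_fin]
    omega
  have hinner : Measurable fun ω : Vec n =>
      ∫⁻ r in Ioi (0 : ℝ), ENNReal.ofReal (r ^ (n - 1)) * G (r • ω) := by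
    refine Measurable.lintegral_prod_right'
      (f := fun q : Vec n × ℝ => ENNReal.ofReal (q.2 ^ (n - 1)) * G (q.2 • q.1)) ?_
    exact (by fun_prop : Measurable fun q : Vec n × ℝ => ENNReal.ofReal (q.2 ^ (n - 1))).mul
      (hG.comp (by fun_prop))
  rw [lintegral_polarSphere hinner]
  have h0 : ∫⁻ x, G x = ∫⁻ x in ({0}ᶜ : Set (Vec n)), G x := by
    rw [restrict_compl_singleton]
  rw [h0, ← lintegral_subtype_comap (measurableSet_singleton _).compl]
  have hmp := (volume : Measure (Vec n)).measurePreserving_homeomorphUnitSphereProd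
  have hg : Measurable fun q : sphere (0 : Vec n) 1 × Ioi (0 : ℝ) => G (q.2.1 • q.1.1) :=
    hG.comp (by fun_prop)
  have h1 := hmp.lintegral_comp hg
  rw [finrank_euclideanSpace_fin] at h1
  have h2 : ∀ x : ({0}ᶜ : Set (Vec n)), G (((homeomorphUnitSphereProd (Vec n) x).2 : ℝ) •
      ((homeomorphUnitSphereProd (Vec n) x).1 : Vec n)) = G x := fun x => by
    rw [← homeomorphUnitSphereProd_symm_apply_coe, Homeomorph.symm_apply_apply]
  simp only [h2] at h1
  rw [h1, lintegral_prod _ hg.aemeasurable]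
  refine lintegral_congr fun ω => ?_
  have hG' : Measurable fun r : ℝ => G (r • (ω : Vec n)) := hG.comp (by fun_prop)
  refine (lintegral_withDensity_eq_lintegral_mul (Measure.comap Subtype.val volume)
    (f := fun r : Ioi (0 : ℝ) => ENNReal.ofReal (r.1 ^ (n - 1))) (by fun_prop)
    (hG'.comp measurable_subtype_coe)).trans ?_
  exact lintegral_subtype_comap measurableSet_Ioi
    (fun r : ℝ => ENNReal.ofReal (r ^ (n - 1)) * G (r • (ω : Vec n)))

theorem lintegral_annulus_le {n : ℕ} (hn : 1 ≤ n) {m M : ℝ} (hm : 0 < m) (hmM : m ≤ M) :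
    ∫⁻ v in {v : Vec n | m ≤ ‖v‖ ∧ ‖v‖ ≤ M}, (‖v‖ₑ ^ n)⁻¹ ≤
      polarSphere n univ * ENNReal.ofReal (Real.log (M / m)) := by
  have hA : MeasurableSet {v : Vec n | m ≤ ‖v‖ ∧ ‖v‖ ≤ M} :=
    (measurableSet_le measurable_const measurable_norm).inter
      (measurableSet_le measurable_norm measurable_const)
  rw [← lintegral_indicator hA, lintegral_eq_polar hn ((by fun_prop : Measurable
    fun v : Vec n => (‖v‖ₑ ^ n)⁻¹).indicator hA), mul_comm, ← lintegral_const]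
  refine lintegral_mono_ae ((ae_polarSphere_mem_unitSphere n).mono fun ω hω => ?_)
  have hω1 : ‖ω‖ = 1 := mem_sphere_zero_iff_norm.1 hω
  have hM : 0 < M := hm.trans_le hmM
  have hlog : ∫⁻ r in Icc m M, ENNReal.ofReal r⁻¹ = ENNReal.ofReal (Real.log (M / m)) := by
    rw [← integral_inv_of_pos hm hM, intervalIntegral.integral_of_le hmM,
      ← integral_Icc_eq_integral_Ioc, ofReal_integral_eq_lintegral_ofReal]
    · refine ContinuousOn.integrableOn_Icc (continuousOn_inv₀.mono fun r hr => ?_)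
      exact (hm.trans_le hr.1).ne'
    · refine (ae_restrict_iff' measurableSet_Icc).2 (Eventually.of_forall fun r hr => ?_)
      exact inv_nonneg.2 (hm.le.trans hr.1)
  rw [← hlog, ← lintegral_indicator measurableSet_Ioi, ← lintegral_indicator measurableSet_Icc]
  refine lintegral_mono fun r => ?_
  by_cases hr : r ∈ Ioi (0 : ℝ)
  · rw [indicator_of_mem hr]
    have hr0 : 0 < r := hr
    have hnr : ‖r • ω‖ = r := by rw [norm_smul, hω1, mul_one, Real.norm_of_nonneg hr0.le]
    by_cases hr2 : r ∈ Icc m M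
    · rw [indicator_of_mem hr2, indicator_of_mem (by simpa [hnr] using hr2), ← ofReal_norm, hnr,
        ← ENNReal.ofReal_pow hr0.le, ← ENNReal.ofReal_inv_of_pos (by positivity),
        ← ENNReal.ofReal_mul (by positivity)]
      refine ENNReal.ofReal_le_ofReal (le_of_eq ?_)
      obtain ⟨k, rfl⟩ : ∃ k, n = k + 1 := ⟨n - 1, by omega⟩
      rw [Nat.add_sub_cancel, pow_succ]
      field_simp
    · rw [indicator_of_notMem (fun h => hr2 (by simpa [hnr] using h)), mul_zero]
      exact zero_le
  · rw [indicator_of_notMem hr]; exact zero_le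

/-- The hypotheses on the map `f` in the Hardy space characterization. -/
structure IsHardyMap (n : ℕ) (K C₀ α a C₁ : ℝ) (f : Vec n → Vec n) : Prop where
  qr : IsQR n K f
  ne_zero : ∀ x ∈ unitBall n, f x ≠ 0
  miniowitz : InMiniowitz n C₀ α f
  mult : MultCond n a C₁ f

/-- The quantity `‖Df‖ / ‖f‖` on the unit ball, extended by zero. -/
def logGrad (n : ℕ) (f : Vec n → Vec n) : Vec n → ℝ≥0∞ :=
  (unitBall n).indicator fun x => ‖fderiv ℝ f x‖ₑ / ‖f x‖ₑ

theorem isOpen_unitBall (n : ℕ) : IsOpen (unitBall n) := isOpen_ball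

theorem measurable_logGrad {n : ℕ} {f : Vec n → Vec n} (hf : ContinuousOn f (unitBall n)) :
    Measurable (logGrad n f) := by
  have h1 : Measurable ((unitBall n).indicator f) := by
    have := hf.measurable_piecewise (g := fun _ => (0 : Vec n)) continuousOn_const
      (isOpen_unitBall n).measurableSet
    exact this
  have h2 : logGrad n f = (unitBall n).indicator
      fun x => ‖fderiv ℝ f x‖ₑ / ‖(unitBall n).indicator f x‖ₑ := by
    funext x
    by_cases hx : x ∈ unitBall n <;> simp [logGrad, hx]
  rw [h2]
  exact ((measurable_fderiv ℝ f).enorm.div h1.enorm).indicator (isOpen_unitBall n).measurableSet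

theorem enorm_fderiv_eq {n : ℕ} {f : Vec n → Vec n} (hf0 : ∀ x ∈ unitBall n, f x ≠ 0) {x : Vec n}
    (hx : x ∈ unitBall n) : ‖fderiv ℝ f x‖ₑ = logGrad n f x * ‖f x‖ₑ := by
  rw [logGrad, indicator_of_mem hx, ENNReal.div_mul_cancel (by simpa using hf0 x hx) (by simp)]

theorem encard_fiber_le {n : ℕ} {a C₁ : ℝ} {f : Vec n → Vec n} (hmult : MultCond n a C₁ f)
    {x : Vec n} (hx : x ∈ unitBall n) {δ : ℝ} (hδ : 0 < δ) (hδ1 : δ ≤ 1) {S : Set (Vec n)}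
    (hS : S ⊆ unitBall n) (hgap : ∀ z ∈ S, δ ≤ mobiusGap x z) (v : Vec n) :
    (({z ∈ S | f z = v}).encard : ℝ≥0∞) ≤ ENNReal.ofReal (C₁ * (4 / δ) ^ a) := by
  have h := hmult x hx (1 - δ / 4) (by linarith) (by linarith) v
  have e : C₁ / (1 - (1 - δ / 4)) ^ a = C₁ * (4 / δ) ^ a := by
    rw [sub_sub_cancel, div_eq_mul_inv, ← Real.inv_rpow (by positivity), inv_div]
  rw [e] at h
  refine (ENat.toENNReal_le.2 ?_).trans h
  choose! y hy1 hy2 using fun z (hz : z ∈ S) => exists_mobiusT_eq hx (hS hz)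
  refine encard_le_encard_of_injOn (f := y) (fun z hz => ⟨?_, ?_⟩) fun z hz w hw hzw => ?_
  · have h1 := hgap z hz.1
    have h2 := hy2 z hz.1
    rw [mem_ball_zero_iff]
    nlinarith [norm_nonneg (y z), sq_nonneg (1 - ‖y z‖)]
  · rw [hy1 z hz.1]; exact hz.2
  · rw [← hy1 z hz.1, ← hy1 w hw.1, hzw]

/-- Conformally invariant energy estimate. -/
theorem exists_energy_const {n : ℕ} (hn : 1 ≤ n) {K C₀ α a b C₁ : ℝ} (hK : 1 ≤ K) (hC₀ : 1 ≤ C₀)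
    (hα : 0 < α) (hC₁ : 0 < C₁) (hab : a < b) : ∃ C : ℝ, 0 ≤ C ∧ ∀ f : Vec n → Vec n,
      IsHardyMap n K C₀ α a C₁ f → ∀ x ∈ unitBall n, ∀ δ : ℝ, 0 < δ → δ ≤ 1 →
      ∀ S ⊆ unitBall n, MeasurableSet S → (∀ z ∈ S, δ ≤ mobiusGap x z) →
      ∫⁻ z in S, logGrad n f z ^ n ≤ ENNReal.ofReal (C * δ ^ (-b)) := by
  set A := (polarSphere n univ).toReal with hA
  have hA0 : 0 ≤ A := ENNReal.toReal_nonneg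
  have hε : 0 < b - a := sub_pos.2 hab
  have hlogC : 0 ≤ Real.log C₀ := Real.log_nonneg hC₀
  refine ⟨K * (C₁ * (A * (2 * Real.log C₀ + 2 * α / (b - a)))) * 4 ^ b, by positivity, ?_⟩
  intro f hf x hx δ hδ hδ1 S hS hSm hgap
  set q := 4 / δ with hq
  have hq1 : 1 ≤ q := by rw [hq, one_le_div hδ]; linarith
  have hq0 : 0 < q := by linarith
  have hfx : 0 < ‖f x‖ := norm_pos_iff.2 (hf.ne_zero x hx)
  set m := C₀⁻¹ * q ^ (-α) * ‖f x‖ with hm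
  set M := C₀ * q ^ α * ‖f x‖ with hM
  have hC0 : 0 < C₀ := by linarith
  have hm0 : 0 < m := by positivity
  have hqα : 1 ≤ q ^ α := Real.one_le_rpow hq1 hα.le
  have hMm : M / m = C₀ ^ 2 * (q ^ α) ^ 2 := by
    rw [hM, hm, Real.rpow_neg hq0.le]
    field_simp
  have hmM : m ≤ M := by
    rw [← one_le_div hm0, hMm]
    exact one_le_mul_of_one_le_of_one_le (one_le_pow₀ hC₀) (one_le_pow₀ hqα)
  have hlog : Real.log (M / m) ≤ (2 * Real.log C₀ + 2 * α / (b - a)) * q ^ (b - a) := by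
    rw [hMm, Real.log_mul (by positivity) (by positivity), Real.log_pow, Real.log_pow,
      Real.log_rpow hq0]
    have h1 := Real.log_le_rpow_div hq0.le hε
    have h2 : 1 ≤ q ^ (b - a) := Real.one_le_rpow hq1 hε.le
    push_cast
    calc 2 * Real.log C₀ + 2 * (α * Real.log q)
        ≤ 2 * Real.log C₀ * q ^ (b - a) + 2 * (α * (q ^ (b - a) / (b - a))) := by
          refine add_le_add (le_mul_of_one_le_right (by positivity) h2) ?_
          gcongr
      _ = _ := by ring
  have hT : MeasurableSet {v : Vec n | m ≤ ‖v‖ ∧ ‖v‖ ≤ M} :=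
    (measurableSet_le measurable_const measurable_norm).inter
      (measurableSet_le measurable_norm measurable_const)
  have hmaps : MapsTo f S {v : Vec n | m ≤ ‖v‖ ∧ ‖v‖ ≤ M} := fun z hz =>
    (harnack_of_le_mobiusGap hC₀ hα hf.ne_zero hf.miniowitz hx (hS hz) hδ (hgap z hz)).symm
  have harea := lintegral_abs_det_mul_comp_le volume hSm hT (fun z hz => hf.qr.2.1 z (hS hz)) hmaps
    (φ := fun v => (‖v‖ₑ ^ n)⁻¹) (by fun_prop)
    (fun v => encard_fiber_le hf.mult hx hδ hδ1 hS hgap v)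
  have hae : ∀ᵐ z ∂(volume.restrict S),
      ‖fderiv ℝ f z‖ ^ n ≤ K * (fderiv ℝ f z).det := ae_restrict_of_ae_restrict_of_subset hS hf.qr.2.2
  have hAe : polarSphere n univ = ENNReal.ofReal A := by
    rw [hA, ENNReal.ofReal_toReal (measure_ne_top _ _)]
  calc ∫⁻ z in S, logGrad n f z ^ n
      ≤ ∫⁻ z in S, ENNReal.ofReal K *
          (ENNReal.ofReal |(fderiv ℝ f z).det| * (‖f z‖ₑ ^ n)⁻¹) := by
        refine lintegral_mono_ae ?_
        filter_upwards [hae, ae_restrict_mem hSm] with z hz hzS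
        rw [logGrad, indicator_of_mem (hS hzS), ENNReal.div_eq_inv_mul, mul_pow, ← ENNReal.inv_pow,
          mul_comm, ← mul_assoc]
        refine mul_le_mul_left ?_ _
        rw [← ENNReal.ofReal_mul (by positivity), ← ofReal_norm, ← ENNReal.ofReal_pow (norm_nonneg _)]
        refine ENNReal.ofReal_le_ofReal (hz.trans ?_)
        gcongr
        exact le_abs_self _
    _ = ENNReal.ofReal K * ∫⁻ z in S,
          (ENNReal.ofReal |(fderiv ℝ f z).det| * (‖f z‖ₑ ^ n)⁻¹) :=
        lintegral_const_mul' _ _ ENNReal.ofReal_ne_top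
    _ ≤ ENNReal.ofReal K * (ENNReal.ofReal (C₁ * q ^ a) *
          (ENNReal.ofReal A * ENNReal.ofReal (Real.log (M / m)))) := by
        refine mul_le_mul_right (harea.trans (mul_le_mul_right ?_ _)) _
        rw [← hAe]
        exact lintegral_annulus_le hn hm0 hmM
    _ = ENNReal.ofReal (K * ((C₁ * q ^ a) * (A * Real.log (M / m)))) := by
        rw [← ENNReal.ofReal_mul hA0, ← ENNReal.ofReal_mul (by positivity),
          ← ENNReal.ofReal_mul (by positivity)]
    _ ≤ _ := by
        refine ENNReal.ofReal_le_ofReal ?_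
        calc K * ((C₁ * q ^ a) * (A * Real.log (M / m)))
            ≤ K * ((C₁ * q ^ a) * (A * ((2 * Real.log C₀ + 2 * α / (b - a)) * q ^ (b - a)))) := by
              gcongr
          _ = K * (C₁ * (A * (2 * Real.log C₀ + 2 * α / (b - a)))) * (q ^ a * q ^ (b - a)) := by ring
          _ = _ := by
              rw [← Real.rpow_add hq0, add_sub_cancel, hq, Real.div_rpow (by norm_num) hδ.le,
                Real.rpow_neg hδ.le]
              ring

theorem le_mobiusGap_of_dist_le {n : ℕ} {x z : Vec n} (hx : x ∈ unitBall n) (hz : z ∈ unitBall n)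
    {A : ℝ} (hA : 0 ≤ A) (hxz : dist z x ≤ A * (1 - ‖x‖)) :
    (1 - ‖z‖) / ((A + 2) ^ 2 * (1 - ‖x‖)) ≤ mobiusGap x z := by
  have hx1 : ‖x‖ < 1 := mem_ball_zero_iff.1 hx
  have hz1 : ‖z‖ < 1 := mem_ball_zero_iff.1 hz
  have hX := one_sub_sq_norm_pos hx
  have hZ := one_sub_sq_norm_pos hz
  have hd : ‖x - z‖ ≤ A * (1 - ‖x‖) := by rwa [norm_sub_rev, ← dist_eq_norm]
  have htri : 1 - ‖z‖ ≤ (A + 1) * (1 - ‖x‖) := by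
    have := norm_sub_norm_le x z
    linarith
  set h := 1 - ‖x‖ with hh
  set t := 1 - ‖z‖ with ht
  have hh0 : 0 < h := by linarith
  have ht0 : 0 < t := by linarith
  have hXh : h ≤ 1 - ‖x‖ ^ 2 ∧ 1 - ‖x‖ ^ 2 ≤ 2 * h := by
    constructor <;> nlinarith [norm_nonneg x]
  have hZt : t ≤ 1 - ‖z‖ ^ 2 ∧ 1 - ‖z‖ ^ 2 ≤ 2 * t := by
    constructor <;> nlinarith [norm_nonneg z]
  have hP1 : h * t ≤ (1 - ‖x‖ ^ 2) * (1 - ‖z‖ ^ 2) :=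
    mul_le_mul hXh.1 hZt.1 ht0.le hX.le
  have hP2 : (1 - ‖x‖ ^ 2) * (1 - ‖z‖ ^ 2) ≤ 4 * (h * t) := by
    have := mul_le_mul hXh.2 hZt.2 hZ.le (by positivity)
    linarith
  set P := (1 - ‖x‖ ^ 2) * (1 - ‖z‖ ^ 2) with hP
  have hP0 : 0 < P := mul_pos hX hZ
  rw [mobiusGap, ← hP, div_le_div_iff₀ (by positivity) (by positivity)]
  have hs : ‖x - z‖ ^ 2 ≤ A ^ 2 * h ^ 2 := by
    rw [← mul_pow]
    exact pow_le_pow_left₀ (norm_nonneg _) hd 2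
  have h1 : ‖x - z‖ ^ 2 + P ≤ (A + 2) ^ 2 * h ^ 2 := by
    have : h * t ≤ h * ((A + 1) * h) := mul_le_mul_of_nonneg_left htri hh0.le
    nlinarith
  calc t * (‖x - z‖ ^ 2 + P) ≤ t * ((A + 2) ^ 2 * h ^ 2) := mul_le_mul_of_nonneg_left h1 ht0.le
    _ = (h * t) * ((A + 2) ^ 2 * h) := by ring
    _ ≤ P * ((A + 2) ^ 2 * h) := mul_le_mul_of_nonneg_right hP1 (by positivity)

/-- Weighted energy estimate over Carleson boxes. -/
theorem exists_box_const {n : ℕ} (hn : 1 ≤ n) {K C₀ α a b C₁ : ℝ} (hK : 1 ≤ K) (hC₀ : 1 ≤ C₀)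
    (hα : 0 < α) (ha : 0 ≤ a) (hC₁ : 0 < C₁) (hab : a < b) {A : ℝ} (hA : 0 ≤ A) :
    ∃ C : ℝ, 0 ≤ C ∧ ∀ f : Vec n → Vec n, IsHardyMap n K C₀ α a C₁ f → ∀ x ∈ unitBall n,
      ∫⁻ z in unitBall n ∩ closedBall x (A * (1 - ‖x‖)),
        logGrad n f z ^ n * ENNReal.ofReal ((1 - ‖z‖) ^ b) ≤ ENNReal.ofReal (C * (1 - ‖x‖) ^ b) := by
  set b' := (a + b) / 2 with hb'
  obtain ⟨C, hC, hE⟩ := exists_energy_const hn hK hC₀ hα hC₁ (show a < b' by rw [hb']; linarith)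
  have hb0 : 0 ≤ b := by linarith
  set q : ℝ := (1 / 2) ^ (b - b') with hq
  have hq0 : 0 ≤ q := by positivity
  have hq1 : q < 1 := Real.rpow_lt_one (by norm_num) (by norm_num) (by rw [hb']; linarith)
  set c : ℝ := (1 + A) / 2 / (A + 2) ^ 2 with hc
  have hc0 : 0 < c := by positivity
  have hc1 : c ≤ 1 := by
    rw [hc, div_le_one (by positivity)]
    nlinarith
  refine ⟨C * c ^ (-b') * (1 + A) ^ b * (1 - q)⁻¹, by
    have : 0 < 1 - q := by linarith
    positivity, ?_⟩
  intro f hf x hx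
  have hx1 : ‖x‖ < 1 := mem_ball_zero_iff.1 hx
  set h := 1 - ‖x‖ with hh
  have hh0 : 0 < h := by linarith
  let L : ℕ → Set (Vec n) := fun k => (unitBall n ∩ closedBall x (A * h)) ∩
    {z | (1 + A) * h * (1 / 2) ^ (k + 1) < 1 - ‖z‖ ∧ 1 - ‖z‖ ≤ (1 + A) * h * (1 / 2) ^ k}
  have hLm : ∀ k, MeasurableSet (L k) := fun k =>
    ((isOpen_unitBall n).measurableSet.inter measurableSet_closedBall).inter
      ((measurableSet_lt measurable_const (f := fun _ => (1 + A) * h * (1 / 2) ^ (k + 1))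
          (g := fun z : Vec n => 1 - ‖z‖) (by fun_prop)).inter
        (measurableSet_le (f := fun z : Vec n => 1 - ‖z‖)
          (g := fun _ => (1 + A) * h * (1 / 2) ^ k) (by fun_prop) measurable_const))
  have hcov : unitBall n ∩ closedBall x (A * h) ⊆ ⋃ k, L k := by
    intro z hz
    have hz1 : ‖z‖ < 1 := mem_ball_zero_iff.1 hz.1
    have hp : 0 < (1 + A) * h := by positivity
    have hle : 1 - ‖z‖ ≤ (1 + A) * h := by
      have h1 := norm_sub_norm_le x z
      have h2 : ‖x - z‖ ≤ A * h := by
        rw [norm_sub_rev, ← dist_eq_norm]; exact hz.2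
      linarith
    obtain ⟨k, hk1, hk2⟩ := exists_nat_pow_near_of_lt_one (x := (1 - ‖z‖) / ((1 + A) * h))
      (y := 1 / 2) (by apply div_pos <;> linarith) ((div_le_one hp).2 hle)
      (by norm_num) (by norm_num)
    rw [lt_div_iff₀ hp] at hk1
    rw [div_le_iff₀ hp] at hk2
    exact mem_iUnion.2 ⟨k, hz, by linarith, by linarith⟩
  have hlayer : ∀ k, ∫⁻ z in L k, logGrad n f z ^ n * ENNReal.ofReal ((1 - ‖z‖) ^ b) ≤
      ENNReal.ofReal (C * c ^ (-b') * (1 + A) ^ b * h ^ b * q ^ k) := by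
    intro k
    have hk0 : (0 : ℝ) < (1 / 2) ^ k := by positivity
    have hk1 : ((1 : ℝ) / 2) ^ k ≤ 1 := pow_le_one₀ (by norm_num) (by norm_num)
    have h1 := hE f hf x hx (c * (1 / 2) ^ k) (by positivity)
      (mul_le_one₀ hc1 hk0.le hk1) (L k) (fun z hz => hz.1.1) (hLm k) (fun z hz => by
        refine le_trans ?_ (le_mobiusGap_of_dist_le hx hz.1.1 hA hz.1.2)
        rw [le_div_iff₀ (by positivity), hc]
        refine le_trans (le_of_eq ?_) hz.2.1.le
        rw [← hh]
        field_simp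
        ring)
    calc ∫⁻ z in L k, logGrad n f z ^ n * ENNReal.ofReal ((1 - ‖z‖) ^ b)
        ≤ ∫⁻ z in L k, logGrad n f z ^ n * ENNReal.ofReal (((1 + A) * h * (1 / 2) ^ k) ^ b) := by
          refine setLIntegral_mono' (hLm k) fun z hz => mul_le_mul_right
            (ENNReal.ofReal_le_ofReal (Real.rpow_le_rpow ?_ hz.2.2 hb0)) _
          have hz1 : ‖z‖ < 1 := mem_ball_zero_iff.1 hz.1.1
          linarith
      _ = (∫⁻ z in L k, logGrad n f z ^ n) * ENNReal.ofReal (((1 + A) * h * (1 / 2) ^ k) ^ b) :=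
          lintegral_mul_const' _ _ ENNReal.ofReal_ne_top
      _ ≤ ENNReal.ofReal (C * (c * (1 / 2) ^ k) ^ (-b')) *
            ENNReal.ofReal (((1 + A) * h * (1 / 2) ^ k) ^ b) := mul_le_mul_left h1 _
      _ = _ := by
          rw [← ENNReal.ofReal_mul (by positivity)]
          congr 1
          rw [Real.mul_rpow hc0.le hk0.le, Real.mul_rpow (by positivity) hk0.le,
            Real.mul_rpow (by positivity) hh0.le, hq, ← Real.rpow_natCast, ← Real.rpow_natCast,
            ← Real.rpow_mul (by norm_num), ← Real.rpow_mul (by norm_num),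
            ← Real.rpow_mul (by norm_num)]
          have : ((1 : ℝ) / 2) ^ ((b - b') * k) =
              (1 / 2) ^ ((k : ℝ) * -b') * (1 / 2) ^ ((k : ℝ) * b) := by
            rw [← Real.rpow_add (by norm_num)]
            congr 1
            ring
          rw [this]
          ring
  calc _ ≤ ∫⁻ z in ⋃ k, L k, logGrad n f z ^ n * ENNReal.ofReal ((1 - ‖z‖) ^ b) :=
        lintegral_mono_set hcov
    _ ≤ ∑' k, ∫⁻ z in L k, logGrad n f z ^ n * ENNReal.ofReal ((1 - ‖z‖) ^ b) :=
        lintegral_iUnion_le _ _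
    _ ≤ ∑' k : ℕ, ENNReal.ofReal (C * c ^ (-b') * (1 + A) ^ b * h ^ b * q ^ k) :=
        ENNReal.tsum_le_tsum hlayer
    _ = ENNReal.ofReal (∑' k : ℕ, C * c ^ (-b') * (1 + A) ^ b * h ^ b * q ^ k) :=
        (ENNReal.ofReal_tsum_of_nonneg (fun k => by positivity)
          ((summable_geometric_of_lt_one hq0 hq1).mul_left _)).symm
    _ = _ := by
        rw [tsum_mul_left, tsum_geometric_of_lt_one hq0 hq1]
        congr 1
        ring

theorem exists_polarSphere_closedBall_le {n : ℕ} (hn : 1 ≤ n) : ∃ C : ℝ, 0 < C ∧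
    ∀ ω ∈ unitSphere n, ∀ r : ℝ, 0 < r →
      polarSphere n (closedBall ω r) ≤ ENNReal.ofReal (C * r ^ (n - 1)) := by
  set V := (volume (ball (0 : Vec n) 1)).toReal with hV
  set A := (polarSphere n univ).toReal with hA
  have hV0 : 0 ≤ V := ENNReal.toReal_nonneg
  have hA0 : 0 ≤ A := ENNReal.toReal_nonneg
  have hVe : volume (ball (0 : Vec n) 1) = ENNReal.ofReal V :=
    (ENNReal.ofReal_toReal measure_ball_lt_top.ne).symm
  have hAe : polarSphere n univ = ENNReal.ofReal A := (ENNReal.ofReal_toReal (measure_ne_top _ _)).symm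
  refine ⟨2 ^ (2 * n - 1) * V + A * 2 ^ (n - 1) + 1, by positivity, fun ω hω r hr => ?_⟩
  rcases le_or_gt r (1 / 2) with hr2 | hr2
  · have hpol := lintegral_eq_polar hn (G := (closedBall ω (2 * r)).indicator fun _ => (1 : ℝ≥0∞))
      (measurable_const.indicator measurableSet_closedBall)
    rw [lintegral_indicator measurableSet_closedBall, setLIntegral_one,
      Measure.addHaar_closedBall _ _ (by positivity), finrank_euclideanSpace_fin, hVe] at hpol
    have hlow : ENNReal.ofReal (r * (1 / 2) ^ (n - 1)) * polarSphere n (closedBall ω r) ≤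
        ∫⁻ ω', (∫⁻ s in Ioi (0 : ℝ), ENNReal.ofReal (s ^ (n - 1)) *
          (closedBall ω (2 * r)).indicator (fun _ => (1 : ℝ≥0∞)) (s • ω')) ∂(polarSphere n) := by
      rw [← setLIntegral_const, ← lintegral_indicator measurableSet_closedBall]
      refine lintegral_mono_ae ((ae_polarSphere_mem_unitSphere n).mono fun ω' hω' => ?_)
      by_cases h : ω' ∈ closedBall ω r
      · rw [indicator_of_mem h]
        have h1 : ‖ω'‖ = 1 := mem_sphere_zero_iff_norm.1 hω'
        calc ENNReal.ofReal (r * (1 / 2) ^ (n - 1))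
            = ∫⁻ s in Icc (1 - r) 1, ENNReal.ofReal ((1 / 2) ^ (n - 1)) := by
              rw [setLIntegral_const, Real.volume_Icc, sub_sub_cancel,
                ← ENNReal.ofReal_mul (by positivity), mul_comm]
          _ ≤ ∫⁻ s in Icc (1 - r) 1, ENNReal.ofReal (s ^ (n - 1)) *
                (closedBall ω (2 * r)).indicator (fun _ => (1 : ℝ≥0∞)) (s • ω') := by
              refine setLIntegral_mono' measurableSet_Icc fun s hs => ?_
              have hs2 : 1 / 2 ≤ s := by linarith [hs.1]
              rw [indicator_of_mem, mul_one]
              · exact ENNReal.ofReal_le_ofReal (pow_le_pow_left₀ (by norm_num) hs2 _)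
              · rw [mem_closedBall, dist_eq_norm,
                  show s • ω' - ω = (s - 1) • ω' + (ω' - ω) by module]
                refine (norm_add_le _ _).trans ?_
                rw [norm_smul, h1, mul_one, Real.norm_eq_abs, abs_of_nonpos (by linarith [hs.2]),
                  ← dist_eq_norm]
                linarith [hs.1, mem_closedBall.1 h]
          _ ≤ _ := lintegral_mono_set fun s hs => by
              rw [mem_Ioi]; linarith [hs.1]
      · rw [indicator_of_notMem h]; exact zero_le
    rw [← hpol, ← ENNReal.ofReal_mul (by positivity), mul_comm,
      ← ENNReal.le_div_iff_mul_le (Or.inl (by simp; positivity)) (Or.inl ENNReal.ofReal_ne_top),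
      ← ENNReal.ofReal_div_of_pos (by positivity)] at hlow
    refine hlow.trans (ENNReal.ofReal_le_ofReal ?_)
    obtain ⟨k, rfl⟩ : ∃ k, n = k + 1 := ⟨n - 1, by omega⟩
    rw [div_le_iff₀ (by positivity)]
    have e1 : 2 * (k + 1) - 1 = k + (k + 1) := by omega
    rw [Nat.add_sub_cancel, e1]
    have e2 : (2 : ℝ) ^ k * (1 / 2) ^ k = 1 := by rw [← mul_pow]; norm_num
    calc (2 * r) ^ (k + 1) * V = 2 ^ (k + (k + 1)) * V * r ^ k * (r * (1 / 2) ^ k) := by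
          rw [mul_pow, pow_add 2 k (k + 1), pow_succ r k]
          linear_combination (-(2 ^ (k + 1) * (r ^ k * r) * V)) * e2
      _ ≤ _ := by
          gcongr
          have : 0 ≤ A * 2 ^ k := by positivity
          linarith
  · refine (measure_mono (subset_univ _)).trans ?_
    rw [hAe]
    refine ENNReal.ofReal_le_ofReal ?_
    have h1 : 1 ≤ (2 * r) ^ (n - 1) := one_le_pow₀ (by linarith)
    have h2 : A ≤ A * (2 * r) ^ (n - 1) := le_mul_of_one_le_right hA0 h1
    rw [mul_pow] at h2
    have h3 : 0 ≤ r ^ (n - 1) := by positivity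
    have h4 : 0 ≤ 2 ^ (2 * n - 1) * V * r ^ (n - 1) := by positivity
    nlinarith

theorem exists_le_polarSphere_closedBall {n : ℕ} (hn : 1 ≤ n) : ∃ c : ℝ, 0 < c ∧
    ∀ ω ∈ unitSphere n, ∀ r : ℝ, 0 < r → r ≤ 2 →
      ENNReal.ofReal (c * r ^ (n - 1)) ≤ polarSphere n (closedBall ω r) := by
  set V := (volume (ball (0 : Vec n) 1)).toReal with hV
  have hV0 : 0 < V := ENNReal.toReal_pos (measure_ball_pos _ _ one_pos).ne' measure_ball_lt_top.ne
  have hVe : volume (ball (0 : Vec n) 1) = ENNReal.ofReal V :=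
    (ENNReal.ofReal_toReal measure_ball_lt_top.ne).symm
  have : Nontrivial (Vec n) := by
    refine Module.nontrivial_of_finrank_pos (R := ℝ) ?_
    rw [finrank_euclideanSpace_fin]; omega
  refine ⟨(1 / 2) ^ (2 * n - 1) * V, by positivity, fun ω hω r hr hr2 => ?_⟩
  have hω1 : ‖ω‖ = 1 := mem_sphere_zero_iff_norm.1 hω
  set ρ := r / 2 with hρ
  have hρ0 : 0 < ρ := by positivity
  have hρ1 : ρ ≤ 1 := by linarith
  have hpol := lintegral_eq_polar hn (G := (ball ω ρ).indicator fun _ => (1 : ℝ≥0∞))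
    (measurable_const.indicator measurableSet_ball)
  rw [lintegral_indicator measurableSet_ball, setLIntegral_one,
    Measure.addHaar_ball _ _ hρ0.le, finrank_euclideanSpace_fin, hVe,
    ← ENNReal.ofReal_mul (by positivity)] at hpol
  have hup : ∫⁻ ω', (∫⁻ s in Ioi (0 : ℝ), ENNReal.ofReal (s ^ (n - 1)) *
          (ball ω ρ).indicator (fun _ => (1 : ℝ≥0∞)) (s • ω')) ∂(polarSphere n) ≤
      ENNReal.ofReal (r * 2 ^ (n - 1)) * polarSphere n (closedBall ω r) := by
    rw [← setLIntegral_const, ← lintegral_indicator measurableSet_closedBall]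
    refine lintegral_mono_ae ((ae_polarSphere_mem_unitSphere n).mono fun ω' hω' => ?_)
    have h1 : ‖ω'‖ = 1 := mem_sphere_zero_iff_norm.1 hω'
    have habs : ∀ s : ℝ, 0 < s → s • ω' ∈ ball ω ρ → |s - 1| < ρ := fun s hs hsω => by
      rw [mem_ball, dist_eq_norm] at hsω
      refine lt_of_le_of_lt ?_ hsω
      have := abs_norm_sub_norm_le (s • ω') ω
      rwa [norm_smul, h1, hω1, mul_one, Real.norm_of_nonneg hs.le] at this
    by_cases h : ω' ∈ closedBall ω r
    · rw [indicator_of_mem h]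
      calc _ ≤ ∫⁻ s in Ioi (0 : ℝ), (Icc (1 - ρ) (1 + ρ)).indicator
              (fun _ => ENNReal.ofReal (2 ^ (n - 1))) s := by
            refine setLIntegral_mono' measurableSet_Ioi fun s hs => ?_
            by_cases hsω : s • ω' ∈ ball ω ρ
            · have h2 := abs_lt.1 (habs s hs hsω)
              rw [indicator_of_mem hsω, mul_one, indicator_of_mem
                (show s ∈ Icc (1 - ρ) (1 + ρ) from ⟨by linarith, by linarith⟩)]
              exact ENNReal.ofReal_le_ofReal (pow_le_pow_left₀ (le_of_lt hs) (by linarith) _)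
            · rw [indicator_of_notMem hsω, mul_zero]; exact zero_le
        _ ≤ ∫⁻ s, (Icc (1 - ρ) (1 + ρ)).indicator (fun _ => ENNReal.ofReal (2 ^ (n - 1))) s :=
            setLIntegral_le_lintegral _ _
        _ = _ := by
            rw [lintegral_indicator measurableSet_Icc, setLIntegral_const, Real.volume_Icc,
              ← ENNReal.ofReal_mul (by positivity)]
            congr 1
            rw [hρ]; ring
    · rw [indicator_of_notMem h]
      refine (setLIntegral_mono' (g := 0) measurableSet_Ioi fun s hs => ?_).trans (by simp)
      rw [indicator_of_notMem, mul_zero]; · exact le_rfl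
      intro hsω
      apply h
      have h2 := habs s hs hsω
      rw [mem_ball, dist_eq_norm] at hsω
      rw [mem_closedBall, dist_eq_norm, show ω' - ω = (1 - s) • ω' + (s • ω' - ω) by module]
      refine (norm_add_le _ _).trans ?_
      rw [norm_smul, h1, mul_one, Real.norm_eq_abs, abs_sub_comm]
      linarith
  rw [← hpol, mul_comm (ENNReal.ofReal (r * 2 ^ (n - 1))),
    ← ENNReal.div_le_iff_le_mul (Or.inl (by simp; positivity))
    (Or.inl ENNReal.ofReal_ne_top), ← ENNReal.ofReal_div_of_pos (by positivity)] at hup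
  refine le_trans (ENNReal.ofReal_le_ofReal (le_of_eq ?_)) hup
  obtain ⟨k, rfl⟩ : ∃ k, n = k + 1 := ⟨n - 1, by omega⟩
  rw [eq_div_iff (by positivity)]
  have e1 : 2 * (k + 1) - 1 = k + (k + 1) := by omega
  rw [Nat.add_sub_cancel, e1, hρ]
  have e2 : (2 : ℝ) ^ k * (1 / 2) ^ k = 1 := by rw [← mul_pow]; norm_num
  rw [div_eq_mul_one_div r 2, mul_pow, pow_add (1 / 2 : ℝ) k (k + 1), pow_succ r k]
  linear_combination ((1 / 2) ^ (k + 1) * (r ^ k * r) * V) * e2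

theorem exists_vitali_cover {n m : ℕ} {μ : Measure (Vec n)} {E : Set (Vec n)} {δ : ℝ}
    (h : ∀ ω ∈ E, ∃ r : ℝ, 0 < r ∧ r ≤ δ ∧ ENNReal.ofReal (r ^ m) ≤ μ (closedBall ω r)) :
    ∃ (u : Set (Vec n)) (r : Vec n → ℝ), u ⊆ E ∧ u.Countable ∧ (∀ b ∈ u, 0 < r b ∧ r b ≤ δ) ∧
      E ⊆ (⋃ b : u, closedBall (b : Vec n) (5 * r b)) ∧
      ∑' b : u, ENNReal.ofReal (r b ^ m) ≤ μ univ := by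
  choose! r hr0 hrδ hrμ using h
  obtain ⟨u, huE, hdis, hcov⟩ := Vitali.exists_disjoint_subfamily_covering_enlargement_closedBall
    E (fun ω => ω) r δ hrδ 5 (by norm_num)
  have hc : u.Countable := hdis.countable_of_nonempty_interior fun i hi =>
    ⟨i, mem_interior_iff_mem_nhds.2 (closedBall_mem_nhds _ (hr0 i (huE hi)))⟩
  refine ⟨u, r, huE, hc, fun b hb => ⟨hr0 b (huE hb), hrδ b (huE hb)⟩, fun ω hω => ?_, ?_⟩
  · obtain ⟨b, hb, hsub⟩ := hcov ω hω
    exact mem_iUnion.2 ⟨⟨b, hb⟩, hsub (mem_closedBall_self (hr0 ω hω).le)⟩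
  · have : Countable u := hc.to_subtype
    calc _ ≤ ∑' b : u, μ (closedBall (b : Vec n) (r b)) :=
          ENNReal.tsum_le_tsum fun b => hrμ b (huE b.2)
      _ = μ (⋃ b : u, closedBall (b : Vec n) (r b)) :=
          (measure_iUnion (f := fun b : u => closedBall (b : Vec n) (r b))
            (fun i j hij => hdis i.2 j.2 fun h => hij (Subtype.ext h))
            fun b => measurableSet_closedBall).symm
      _ ≤ _ := measure_mono (subset_univ _)

theorem rpow_sub_one_eq_pow {n : ℕ} (hn : 1 ≤ n) (t : ℝ≥0∞) :
    t ^ ((n : ℝ) - 1) = t ^ (n - 1) := by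
  rw [← ENNReal.rpow_natCast, Nat.cast_sub hn, Nat.cast_one]

theorem exists_polarSphere_le_smul {n : ℕ} (hn : 2 ≤ n) :
    ∃ C : ℝ≥0∞, C ≠ ⊤ ∧ polarSphere n ≤ C • sphMeasure n := by
  obtain ⟨C, hC, hball⟩ := exists_polarSphere_closedBall_le (show 1 ≤ n by omega)
  have hC0 : ENNReal.ofReal C ≠ 0 := by simpa using hC
  have key : (ENNReal.ofReal C)⁻¹ • polarSphere n ≤ μH[(n : ℝ) - 1] := by
    refine Measure.le_hausdorffMeasure _ _ 1 one_pos fun s hs => ?_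
    rw [rpow_sub_one_eq_pow (by omega), Measure.smul_apply, smul_eq_mul,
      ENNReal.inv_mul_le_iff hC0 ENNReal.ofReal_ne_top]
    by_cases hne : (s ∩ unitSphere n).Nonempty
    · obtain ⟨ω, hωs, hω⟩ := hne
      have hfin : ediam s ≠ ⊤ := ne_top_of_le_ne_top ENNReal.one_ne_top hs
      have hb : ∀ r : ℝ, (ediam s).toReal ≤ r → s ⊆ closedBall ω r := fun r hr y hy => by
        have h1 := edist_le_ediam_of_mem hy hωs
        rw [mem_closedBall, ← ENNReal.toReal_ofReal dist_nonneg, ← edist_dist]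
        exact (ENNReal.toReal_mono hfin h1).trans hr
      have hle : ∀ r : ℝ, (ediam s).toReal < r →
          polarSphere n s ≤ ENNReal.ofReal (C * r ^ (n - 1)) := fun r hr =>
        (measure_mono (hb r hr.le)).trans (hball ω hω r (ENNReal.toReal_nonneg.trans_lt hr))
      have hlim : Tendsto (fun r : ℝ => ENNReal.ofReal (C * r ^ (n - 1)))
          (𝓝[>] (ediam s).toReal) (𝓝 (ENNReal.ofReal (C * (ediam s).toReal ^ (n - 1)))) :=
        ((ENNReal.continuous_ofReal.comp (show Continuous fun r : ℝ => C * r ^ (n - 1) by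
          fun_prop)).tendsto _).mono_left nhdsWithin_le_nhds
      refine (ge_of_tendsto hlim (eventually_nhdsWithin_of_forall hle)).trans (le_of_eq ?_)
      rw [ENNReal.ofReal_mul hC.le, ENNReal.ofReal_pow ENNReal.toReal_nonneg,
        ENNReal.ofReal_toReal hfin]
    · refine le_of_eq_of_le ?_ zero_le
      refine measure_mono_null (fun y hy hyS => hne ⟨y, hy, hyS⟩)
        (ae_iff.1 (ae_polarSphere_mem_unitSphere n))
  refine ⟨ENNReal.ofReal C, ENNReal.ofReal_ne_top, Measure.le_iff.2 fun s hs => ?_⟩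
  have h1 : polarSphere n s = polarSphere n (s ∩ unitSphere n) := by
    refine measure_congr ?_
    filter_upwards [ae_polarSphere_mem_unitSphere n] with ω hω
    exact propext ⟨fun h => ⟨h, hω⟩, fun h => h.1⟩
  rw [h1, Measure.smul_apply, sphMeasure, Measure.restrict_apply hs, smul_eq_mul,
    ← ENNReal.inv_mul_le_iff hC0 ENNReal.ofReal_ne_top]
  exact key _

theorem exists_sphMeasure_le_smul {n : ℕ} (hn : 2 ≤ n) :
    ∃ C : ℝ≥0∞, C ≠ ⊤ ∧ sphMeasure n ≤ C • polarSphere n := by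
  obtain ⟨c, hc, hball⟩ := exists_le_polarSphere_closedBall (show 1 ≤ n by omega)
  have hc0 : ENNReal.ofReal c ≠ 0 := by simpa using hc
  refine ⟨10 ^ (n - 1) * (ENNReal.ofReal c)⁻¹, ENNReal.mul_ne_top (by simp)
    (ENNReal.inv_ne_top.2 hc0), Measure.le_iff.2 fun A hA => ?_⟩
  rw [sphMeasure, Measure.restrict_apply hA, Measure.smul_apply, smul_eq_mul]
  set E := A ∩ unitSphere n with hE
  have hU : ∀ U : Set (Vec n), IsOpen U → A ⊆ U →
      μH[(n : ℝ) - 1] E ≤ 10 ^ (n - 1) * (ENNReal.ofReal c)⁻¹ * polarSphere n U := by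
    intro U hUo hAU
    have hcov : ∀ k : ℕ, ∃ (u : Set (Vec n)) (r : Vec n → ℝ), u ⊆ E ∧ u.Countable ∧
        (∀ b ∈ u, 0 < r b ∧ r b ≤ (1 / 2) ^ k) ∧
        E ⊆ (⋃ b : u, closedBall (b : Vec n) (5 * r b)) ∧
        ∑' b : u, ENNReal.ofReal (r b ^ (n - 1)) ≤
          ((ENNReal.ofReal c)⁻¹ • (polarSphere n).restrict U) univ := fun k => by
      refine exists_vitali_cover fun ω hω => ?_
      obtain ⟨ε, hε, hεU⟩ := nhds_basis_closedBall.mem_iff.1 (hUo.mem_nhds (hAU hω.1))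
      have hr : 0 < min ε ((1 / 2) ^ k) := by positivity
      refine ⟨min ε ((1 / 2) ^ k), hr, min_le_right _ _, ?_⟩
      rw [Measure.smul_apply, smul_eq_mul, Measure.restrict_apply measurableSet_closedBall,
        inter_eq_left.2 ((closedBall_subset_closedBall (min_le_left _ _)).trans hεU)]
      have h2 : min ε ((1 / 2 : ℝ) ^ k) ≤ 2 := (min_le_right _ _).trans
        ((pow_le_one₀ (by norm_num) (by norm_num)).trans one_le_two)
      have h3 := hball ω hω.2 _ hr h2
      rw [ENNReal.ofReal_mul hc.le] at h3
      rw [mul_comm, ← div_eq_mul_inv, ENNReal.le_div_iff_mul_le (Or.inl hc0)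
        (Or.inl ENNReal.ofReal_ne_top), mul_comm]
      exact h3
    choose u r huE huc hr hEu hsum using hcov
    have : ∀ k, Countable (u k) := fun k => (huc k).to_subtype
    have hdiam : ∀ k (b : u k), ediam (closedBall (b : Vec n) (5 * r k b)) ≤
        10 * ENNReal.ofReal (r k b) := fun k b => by
      rw [← Metric.closedEBall_ofReal (by have := (hr k b b.2).1; positivity)]
      refine ediam_closedEBall_le.trans (le_of_eq ?_)
      rw [ENNReal.ofReal_mul (by norm_num), ← mul_assoc, ENNReal.ofReal_ofNat]
      norm_num
    refine (Measure.hausdorffMeasure_le_liminf_tsum (l := atTop) ((n : ℝ) - 1) E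
      (fun k : ℕ => 10 * ENNReal.ofReal ((1 / 2) ^ k)) ?_
      (fun k (b : u k) => closedBall (b : Vec n) (5 * r k b)) ?_ ?_).trans ?_
    · have h1 : Tendsto (fun k : ℕ => ENNReal.ofReal ((1 / 2) ^ k)) atTop (𝓝 0) := by
        rw [← ENNReal.ofReal_zero]
        exact ENNReal.tendsto_ofReal (tendsto_pow_atTop_nhds_zero_of_lt_one (by norm_num)
          (by norm_num))
      simpa using ENNReal.Tendsto.const_mul h1 (Or.inr (by simp : (10 : ℝ≥0∞) ≠ ⊤))
    · exact .of_forall fun k b => (hdiam k b).trans (by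
        gcongr; exact (hr k b b.2).2)
    · exact .of_forall hEu
    · refine liminf_le_of_le (by isBoundedDefault) fun x hx => ?_
      obtain ⟨k, hk⟩ := hx.exists
      refine hk.trans ?_
      calc _ ≤ ∑' b : u k, 10 ^ (n - 1) * ENNReal.ofReal (r k b ^ (n - 1)) := by
            refine ENNReal.tsum_le_tsum fun b => ?_
            rw [rpow_sub_one_eq_pow (by omega), ENNReal.ofReal_pow (hr k b b.2).1.le, ← mul_pow]
            exact pow_le_pow_left' (hdiam k b) _
        _ ≤ _ := by
            rw [ENNReal.tsum_mul_left, mul_assoc]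
            gcongr
            refine (hsum k).trans (le_of_eq ?_)
            rw [Measure.smul_apply, Measure.restrict_apply_univ, smul_eq_mul]
  set D := 10 ^ (n - 1) * (ENNReal.ofReal c)⁻¹ with hD
  have : (D • polarSphere n).OuterRegular := Measure.OuterRegular.smul _
    (ENNReal.mul_ne_top (by simp) (ENNReal.inv_ne_top.2 hc0))
  rw [← smul_eq_mul, ← Measure.smul_apply, A.measure_eq_iInf_isOpen]
  exact le_iInf₂ fun U hAU => le_iInf fun hUo => hU U hUo hAU

theorem lintegral_Ioo_one_sub {h : ℝ} (F : ℝ → ℝ≥0∞) :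
    ∫⁻ r in Ioo (1 - h) 1, F (1 - r) = ∫⁻ t in Ioo 0 h, F t := by
  rw [← lintegral_indicator measurableSet_Ioo, ← lintegral_indicator measurableSet_Ioo,
    ← lintegral_sub_left_eq_self _ (1 : ℝ)]
  refine lintegral_congr fun r => ?_
  by_cases hr : r ∈ Ioo 0 h
  · rw [indicator_of_mem hr, indicator_of_mem, sub_sub_cancel]
    exact ⟨by linarith [hr.2], by linarith [hr.1]⟩
  · rw [indicator_of_notMem hr, indicator_of_notMem]
    exact fun h' => hr ⟨by linarith [h'.2], by linarith [h'.1]⟩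

theorem lintegral_rpow_Ioo_zero {h q : ℝ} (hh : 0 ≤ h) (hq : -1 < q) :
    ∫⁻ t in Ioo 0 h, ENNReal.ofReal (t ^ q) = ENNReal.ofReal (h ^ (q + 1) / (q + 1)) := by
  have hi : IntegrableOn (fun t : ℝ => t ^ q) (Ioc 0 h) :=
    (intervalIntegrable_iff_integrableOn_Ioc_of_le hh).1 (intervalIntegral.intervalIntegrable_rpow' hq)
  rw [setLIntegral_congr Ioo_ae_eq_Ioc, ← ofReal_integral_eq_lintegral_ofReal hi
    ((ae_restrict_iff' measurableSet_Ioc).2 (.of_forall fun t ht => Real.rpow_nonneg ht.1.le _)),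
    ← intervalIntegral.integral_of_le hh, integral_rpow (Or.inl hq), Real.zero_rpow (by linarith),
    sub_zero]

theorem exists_lintegral_pow_le_weight {n : ℕ} (hn : 2 ≤ n) {b : ℝ} (hb : b < (n : ℝ) - 1) :
    ∃ C : ℝ, 0 ≤ C ∧ ∀ w : ℝ → ℝ≥0∞, Measurable w → ∀ h : ℝ, 0 < h →
      (∫⁻ r in Ioo (1 - h) 1, w r) ^ n ≤ ENNReal.ofReal (C * h ^ ((n : ℝ) - 1 - b)) *
        ∫⁻ r in Ioo (1 - h) 1, w r ^ n * ENNReal.ofReal ((1 - r) ^ b) := by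
  obtain ⟨k, rfl⟩ : ∃ k, n = k + 1 := ⟨n - 1, by omega⟩
  have hk : (0 : ℝ) < k := by exact_mod_cast (show 0 < k by omega)
  push_cast at hb ⊢
  rw [add_sub_cancel_right] at hb ⊢
  set β := b / k with hβ
  have hβ1 : β < 1 := by rw [hβ, div_lt_one hk]; exact hb
  refine ⟨(1 - β)⁻¹ ^ k, by have := sub_pos.2 hβ1; positivity, fun w hw h hh => ?_⟩
  have hφ : ∀ q : ℝ, Measurable fun r : ℝ => ENNReal.ofReal ((1 - r) ^ q) := fun q =>
    ((measurable_const.sub measurable_id).pow_const q).ennreal_ofReal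
  have hG : Measurable fun r => w r * ENNReal.ofReal ((1 - r) ^ β) := hw.mul (hφ β)
  set μ := (volume.restrict (Ioo (1 - h) 1)).withDensity
    fun r => ENNReal.ofReal ((1 - r) ^ (-β)) with hμ
  have hmass : μ univ = ENNReal.ofReal (h ^ (1 - β) / (1 - β)) := by
    rw [hμ, withDensity_apply _ MeasurableSet.univ, Measure.restrict_univ,
      lintegral_Ioo_one_sub fun t => ENNReal.ofReal (t ^ (-β)),
      lintegral_rpow_Ioo_zero hh.le (by linarith)]
    ring_nf
  have hL : ∫⁻ r in Ioo (1 - h) 1, w r = ∫⁻ r, w r * ENNReal.ofReal ((1 - r) ^ β) ∂μ := by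
    rw [hμ, lintegral_withDensity_eq_lintegral_mul _ (hφ _) hG]
    refine setLIntegral_congr_fun measurableSet_Ioo fun r hr => ?_
    have h0 : 0 < 1 - r := by linarith [hr.2]
    simp only [Pi.mul_apply]
    rw [mul_left_comm, ← ENNReal.ofReal_mul (by positivity), ← Real.rpow_add h0, neg_add_cancel,
      Real.rpow_zero, ENNReal.ofReal_one, mul_one]
  have hR : ∫⁻ r in Ioo (1 - h) 1, w r ^ (k + 1) * ENNReal.ofReal ((1 - r) ^ b) =
      ∫⁻ r, (w r * ENNReal.ofReal ((1 - r) ^ β)) ^ (k + 1) ∂μ := by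
    rw [hμ, lintegral_withDensity_eq_lintegral_mul _ (hφ _) (hG.pow_const _)]
    refine setLIntegral_congr_fun measurableSet_Ioo fun r hr => ?_
    have h0 : 0 < 1 - r := by linarith [hr.2]
    simp only [Pi.mul_apply]
    rw [mul_pow, mul_left_comm, ← ENNReal.ofReal_pow (by positivity),
      ← ENNReal.ofReal_mul (by positivity), ← Real.rpow_mul_natCast h0.le, ← Real.rpow_add h0]
    congr 3
    rw [hβ]; push_cast; field_simp; ring
  rw [hL, hR]
  refine (lintegral_pow_le hG.aemeasurable k).trans ?_
  gcongr
  have h1 := sub_pos.2 hβ1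
  rw [hmass, ← ENNReal.ofReal_pow (by positivity)]
  refine ENNReal.ofReal_le_ofReal (le_of_eq ?_)
  rw [div_eq_inv_mul, mul_pow, ← Real.rpow_mul_natCast hh.le]
  congr 2
  rw [hβ]; field_simp

theorem exists_lintegral_radial_pow_le {n : ℕ} (hn : 2 ≤ n) {b : ℝ} (hb : b < (n : ℝ) - 1) :
    ∃ C : ℝ, 0 ≤ C ∧ ∀ w : Vec n → ℝ≥0∞, Measurable w → ∀ h : ℝ, 0 < h → h ≤ 1 / 2 →
      ∀ T D : Set (Vec n), MeasurableSet T → MeasurableSet D →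
        (∀ ω ∈ T ∩ unitSphere n, ∀ r ∈ Ioo (1 - h) 1, r • ω ∈ D) →
        ∫⁻ ω in T, (∫⁻ r in Ioo (1 - h) 1, w (r • ω)) ^ n ∂(polarSphere n) ≤
          ENNReal.ofReal (C * h ^ ((n : ℝ) - 1 - b)) *
            ∫⁻ x in D, w x ^ n * ENNReal.ofReal ((1 - ‖x‖) ^ b) := by
  obtain ⟨C, hC, hHolder⟩ := exists_lintegral_pow_le_weight hn hb
  refine ⟨C * 2 ^ (n - 1), by positivity, fun w hw h hh hh2 T D hT hD hTD => ?_⟩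
  set G : Vec n → ℝ≥0∞ := D.indicator fun x => w x ^ n * ENNReal.ofReal ((1 - ‖x‖) ^ b) with hG
  have hGm : Measurable G :=
    ((hw.pow_const n).mul ((measurable_const.sub measurable_norm).pow_const b).ennreal_ofReal).indicator
      hD
  have hcone : ∀ ω ∈ T ∩ unitSphere n,
      ∫⁻ r in Ioo (1 - h) 1, w (r • ω) ^ n * ENNReal.ofReal ((1 - r) ^ b) ≤
        ENNReal.ofReal (2 ^ (n - 1)) *
          ∫⁻ r in Ioi (0 : ℝ), ENNReal.ofReal (r ^ (n - 1)) * G (r • ω) := fun ω hω => by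
    rw [← lintegral_const_mul' _ _ ENNReal.ofReal_ne_top]
    refine le_trans ?_ (lintegral_mono_set (s := Ioo (1 - h) 1) fun r hr =>
      show (0 : ℝ) < r by linarith [hr.1])
    refine setLIntegral_mono' measurableSet_Ioo fun r hr => ?_
    have hr0 : 1 / 2 ≤ r := by linarith [hr.1]
    have hnorm : ‖r • ω‖ = r := by
      rw [norm_smul, mem_sphere_zero_iff_norm.1 hω.2, mul_one, Real.norm_of_nonneg (by linarith)]
    rw [hG, indicator_of_mem (hTD ω hω r hr), hnorm, ← mul_assoc,
      ← ENNReal.ofReal_mul (by positivity), ← mul_pow]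
    refine le_mul_of_one_le_left zero_le (ENNReal.one_le_ofReal.2 (one_le_pow₀ (by linarith)))
  have hae : ∀ᵐ ω ∂((polarSphere n).restrict T), ω ∈ T ∩ unitSphere n :=
    (ae_restrict_mem hT).and (ae_restrict_of_ae (ae_polarSphere_mem_unitSphere n))
  calc _ ≤ ∫⁻ ω in T, ENNReal.ofReal (C * h ^ ((n : ℝ) - 1 - b)) * (ENNReal.ofReal (2 ^ (n - 1)) *
          ∫⁻ r in Ioi (0 : ℝ), ENNReal.ofReal (r ^ (n - 1)) * G (r • ω)) ∂(polarSphere n) := by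
        refine lintegral_mono_ae (hae.mono fun ω hω => ?_)
        refine (hHolder (fun r => w (r • ω)) (hw.comp (measurable_id.smul_const ω)) h hh).trans ?_
        gcongr
        exact hcone ω hω
    _ ≤ ENNReal.ofReal (C * h ^ ((n : ℝ) - 1 - b)) * (ENNReal.ofReal (2 ^ (n - 1)) *
          ∫⁻ ω, (∫⁻ r in Ioi (0 : ℝ), ENNReal.ofReal (r ^ (n - 1)) * G (r • ω))
            ∂(polarSphere n)) := by
        rw [lintegral_const_mul' _ _ ENNReal.ofReal_ne_top,
          lintegral_const_mul' _ _ ENNReal.ofReal_ne_top]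
        gcongr
        exact Measure.restrict_le_self
    _ = _ := by
        rw [← lintegral_eq_polar (by omega) hGm, hG, lintegral_indicator hD, ← mul_assoc,
          ← ENNReal.ofReal_mul (by positivity)]
        congr 2
        ring

/-- The variation of `log ‖f‖` along the outer part of the radius through `ω`. -/
def radialVar (n : ℕ) (f : Vec n → Vec n) (h : ℝ) (ω : Vec n) : ℝ≥0∞ :=
  ∫⁻ r in Ioo (1 - h) 1, logGrad n f (r • ω)

theorem measurable_radialVar {n : ℕ} {f : Vec n → Vec n} (hf : ContinuousOn f (unitBall n))
    (h : ℝ) : Measurable (radialVar n f h) := by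
  refine Measurable.lintegral_prod_right' (f := fun q : Vec n × ℝ => logGrad n f (q.2 • q.1)) ?_
  exact (measurable_logGrad hf).comp (measurable_snd.smul measurable_fst)

theorem exists_radialVar_cap_const {n : ℕ} (hn : 2 ≤ n) {K C₀ α a C₁ : ℝ} (hK : 1 ≤ K)
    (hC₀ : 1 ≤ C₀) (hα : 0 < α) (ha0 : 0 ≤ a) (ha : a < (n : ℝ) - 1) (hC₁ : 0 < C₁) :
    ∃ C : ℝ, 0 ≤ C ∧ ∀ f, IsHardyMap n K C₀ α a C₁ f → ∀ ω ∈ unitSphere n, ∀ h : ℝ,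
      0 < h → h ≤ 1 / 2 →
      ∫⁻ ω' in closedBall ω h, radialVar n f h ω' ^ n ∂(polarSphere n) ≤
        ENNReal.ofReal (C * h ^ (n - 1)) := by
  obtain ⟨b, hab, hb⟩ := exists_between ha
  obtain ⟨C, hC, hrad⟩ := exists_lintegral_radial_pow_le hn hb
  obtain ⟨C', hC', hbox⟩ := exists_box_const (show 1 ≤ n by omega) hK hC₀ hα ha0 hC₁ hab
    (show (0 : ℝ) ≤ 2 by norm_num)
  refine ⟨C * C', by positivity, fun f hf ω hω h hh hh2 => ?_⟩
  have hω1 : ‖ω‖ = 1 := mem_sphere_zero_iff_norm.1 hω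
  have hnx : ‖(1 - h) • ω‖ = 1 - h := by
    rw [norm_smul, hω1, mul_one, Real.norm_of_nonneg (by linarith)]
  have hxB : (1 - h) • ω ∈ unitBall n := mem_ball_zero_iff.2 (by rw [hnx]; linarith)
  have h2 := hbox f hf _ hxB
  rw [hnx, sub_sub_cancel] at h2
  refine (hrad _ (measurable_logGrad hf.qr.1) h hh hh2 (closedBall ω h)
    (unitBall n ∩ closedBall ((1 - h) • ω) (2 * h)) measurableSet_closedBall
    ((isOpen_unitBall n).measurableSet.inter measurableSet_closedBall) ?_).trans ?_
  · intro ω' hω' r hr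
    have h1 : ‖ω'‖ = 1 := mem_sphere_zero_iff_norm.1 hω'.2
    have hr0 : 0 < r := by linarith [hr.1]
    refine ⟨mem_ball_zero_iff.2 ?_, ?_⟩
    · rw [norm_smul, h1, mul_one, Real.norm_of_nonneg hr0.le]; exact hr.2
    · have h3 := hω'.1
      rw [mem_closedBall, dist_eq_norm] at h3 ⊢
      rw [show r • ω' - (1 - h) • ω = (r - (1 - h)) • ω' + (1 - h) • (ω' - ω) by module]
      refine (norm_add_le _ _).trans ?_
      rw [norm_smul, norm_smul, h1, Real.norm_of_nonneg (by linarith [hr.1]),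
        Real.norm_of_nonneg (by linarith)]
      nlinarith [hr.2]
  · refine (mul_le_mul_right h2 _).trans ?_
    rw [← ENNReal.ofReal_mul (by positivity)]
    refine ENNReal.ofReal_le_ofReal (le_of_eq ?_)
    rw [mul_mul_mul_comm, ← Real.rpow_add hh, ← Real.rpow_natCast, Nat.cast_sub (by omega)]
    congr 2
    push_cast; ring

theorem ae_radialVar_lt_top {n : ℕ} (hn : 2 ≤ n) {K C₀ α a C₁ : ℝ} (hK : 1 ≤ K)
    (hC₀ : 1 ≤ C₀) (hα : 0 < α) (ha0 : 0 ≤ a) (ha : a < (n : ℝ) - 1) (hC₁ : 0 < C₁)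
    {f : Vec n → Vec n} (hf : IsHardyMap n K C₀ α a C₁ f) :
    ∀ᵐ ω ∂(polarSphere n), radialVar n f (1 / 2) ω < ⊤ := by
  obtain ⟨b, hab, hb⟩ := exists_between ha
  obtain ⟨C, hC, hrad⟩ := exists_lintegral_radial_pow_le hn hb
  obtain ⟨C', hC', hbox⟩ := exists_box_const (show 1 ≤ n by omega) hK hC₀ hα ha0 hC₁ hab
    (show (0 : ℝ) ≤ 1 by norm_num)
  have h0 := hbox f hf 0 (mem_ball_self one_pos)
  have h1 := hrad _ (measurable_logGrad hf.qr.1) (1 / 2) (by norm_num) le_rfl univ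
    (unitBall n ∩ closedBall 0 (1 * (1 - ‖(0 : Vec n)‖))) MeasurableSet.univ
    ((isOpen_unitBall n).measurableSet.inter measurableSet_closedBall) (by
      intro ω hω r hr
      have hr0 : 0 < r := by linarith [hr.1]
      have h2 : ‖r • ω‖ < 1 := by
        rw [norm_smul, mem_sphere_zero_iff_norm.1 hω.2, mul_one, Real.norm_of_nonneg hr0.le]
        exact hr.2
      exact ⟨mem_ball_zero_iff.2 h2, by simpa using h2.le⟩)
  rw [setLIntegral_univ] at h1
  have h2 := ae_lt_top ((measurable_radialVar hf.qr.1 (1 / 2)).pow_const n)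
    (ne_top_of_le_ne_top (ENNReal.mul_ne_top ENNReal.ofReal_ne_top ENNReal.ofReal_ne_top)
      (h1.trans (mul_le_mul_right h0 _)))
  exact h2.mono fun ω hω => (ENNReal.pow_lt_top_iff.1 hω).resolve_right (by omega)

theorem exists_good_cap_const {n : ℕ} (hn : 2 ≤ n) {K C₀ α a C₁ : ℝ} (hK : 1 ≤ K)
    (hC₀ : 1 ≤ C₀) (hα : 0 < α) (ha0 : 0 ≤ a) (ha : a < (n : ℝ) - 1) (hC₁ : 0 < C₁) :
    ∃ M c : ℝ, 0 < M ∧ 0 < c ∧ ∀ f, IsHardyMap n K C₀ α a C₁ f → ∀ ω ∈ unitSphere n, ∀ h : ℝ,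
      0 < h → h ≤ 1 / 2 → ENNReal.ofReal (c * h ^ (n - 1)) ≤
        polarSphere n (closedBall ω h ∩ {ω' | radialVar n f h ω' < ENNReal.ofReal M}) := by
  obtain ⟨C, hC, hcap⟩ := exists_radialVar_cap_const hn hK hC₀ hα ha0 ha hC₁
  obtain ⟨c, hc, hball⟩ := exists_le_polarSphere_closedBall (show 1 ≤ n by omega)
  refine ⟨max 1 (2 * C / c), c / 2, by positivity, by positivity, fun f hf ω hω h hh hh2 => ?_⟩
  set M := max 1 (2 * C / c) with hM
  have hM1 : 1 ≤ M := le_max_left _ _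
  have hMn : 2 * C / c ≤ M ^ n := (le_max_right _ _).trans (le_self_pow₀ hM1 (by omega))
  have hmeas := (measurable_radialVar hf.qr.1 h)
  have hset : MeasurableSet {ω' | radialVar n f h ω' < ENNReal.ofReal M} :=
    measurableSet_lt hmeas measurable_const
  have hbad : polarSphere n (closedBall ω h \ {ω' | radialVar n f h ω' < ENNReal.ofReal M}) ≤
      ENNReal.ofReal (c / 2 * h ^ (n - 1)) := by
    have h1 := meas_ge_le_lintegral_div (μ := (polarSphere n).restrict (closedBall ω h))
      (hmeas.pow_const n).aemeasurable (ε := ENNReal.ofReal (M ^ n)) (by simp; positivity)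
      ENNReal.ofReal_ne_top
    rw [Measure.restrict_apply (measurableSet_le measurable_const (hmeas.pow_const n))] at h1
    refine (measure_mono ?_).trans (h1.trans ((ENNReal.div_le_div_right (hcap f hf ω hω h hh hh2)
      _).trans ?_))
    · rintro ω' ⟨h2, h3⟩
      refine ⟨?_, h2⟩
      rw [mem_ofPred_eq, not_lt] at h3
      rw [mem_ofPred_eq, ENNReal.ofReal_pow (by positivity)]
      exact pow_le_pow_left' h3 n
    · rw [← ENNReal.ofReal_div_of_pos (by positivity)]
      refine ENNReal.ofReal_le_ofReal ?_
      rw [div_le_iff₀ (by positivity)]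
      rw [div_le_iff₀ hc] at hMn
      have : 0 ≤ h ^ (n - 1) := by positivity
      nlinarith
  have htot := hball ω hω h hh (by linarith)
  rw [← measure_inter_add_sdiff (closedBall ω h) hset] at htot
  have hsplit : ENNReal.ofReal (c * h ^ (n - 1)) = ENNReal.ofReal (c / 2 * h ^ (n - 1)) +
      ENNReal.ofReal (c / 2 * h ^ (n - 1)) := by
    rw [← ENNReal.ofReal_add (by positivity) (by positivity)]; congr 1; ring
  rw [hsplit] at htot
  exact ENNReal.le_of_add_le_add_right ENNReal.ofReal_ne_top
    (htot.trans (add_le_add_right hbad _))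

theorem norm_smul_unitSphere {n : ℕ} {ω : Vec n} (hω : ω ∈ unitSphere n) {r : ℝ} (hr : 0 ≤ r) :
    ‖r • ω‖ = r := by
  rw [norm_smul, mem_sphere_zero_iff_norm.1 hω, mul_one, Real.norm_of_nonneg hr]

theorem smul_mem_unitBall {n : ℕ} {ω : Vec n} (hω : ω ∈ unitSphere n) {r : ℝ} (hr : 0 ≤ r)
    (hr1 : r < 1) : r • ω ∈ unitBall n :=
  mem_ball_zero_iff.2 (by rwa [norm_smul_unitSphere hω hr])

theorem hasDerivAt_radial {n : ℕ} {f : Vec n → Vec n} {x ω : Vec n} {t : ℝ}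
    (hx : t • ω = x) (hf : DifferentiableAt ℝ f x) :
    HasDerivAt (fun s : ℝ => f (s • ω)) (fderiv ℝ f x ω) t := by
  subst hx
  have h1 : HasDerivAt (fun s : ℝ => s • ω) ω t := by
    simpa using (hasDerivAt_id t).smul_const ω
  exact hf.hasFDerivAt.comp_hasDerivAt t h1

theorem abs_log_norm_sub_le {n : ℕ} {K C₀ α a C₁ : ℝ} {f : Vec n → Vec n}
    (hf : IsHardyMap n K C₀ α a C₁ f) {ω : Vec n} (hω : ω ∈ unitSphere n) {h M : ℝ} (hh2 : h ≤ 1 / 2)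
    (hM : 0 ≤ M) (hV : radialVar n f h ω ≤ ENNReal.ofReal M) {s t : ℝ} (hs : 1 - h ≤ s)
    (hst : s ≤ t) (ht : t < 1) :
    |Real.log ‖f (t • ω)‖ - Real.log ‖f (s • ω)‖| ≤ M := by
  have hmem : ∀ r ∈ Icc s t, r • ω ∈ unitBall n := fun r hr =>
    smul_mem_unitBall hω (by linarith [hr.1]) (hr.2.trans_lt ht)
  have hder : ∀ r ∈ Icc s t, HasDerivAt (fun r : ℝ => Real.log ‖f (r • ω)‖)
      (inner ℝ (f (r • ω)) (fderiv ℝ f (r • ω) ω) / ‖f (r • ω)‖ ^ 2) r := fun r hr => by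
    have hne : ‖f (r • ω)‖ ≠ 0 := norm_ne_zero_iff.2 (hf.ne_zero _ (hmem r hr))
    have h1 := ((hasDerivAt_radial rfl (hf.qr.2.1 _ (hmem r hr))).norm_sq.log
      (pow_ne_zero 2 hne)).const_mul (1 / 2 : ℝ)
    refine (h1.congr_of_eventuallyEq (.of_forall fun y => ?_)).congr_deriv ?_
    · simp only [Real.log_pow]; push_cast; ring
    · ring
  have h2 := enorm_sub_le_lintegral_deriv hst hder
  have h3 : ∫⁻ r in Ioc s t, ‖inner ℝ (f (r • ω)) (fderiv ℝ f (r • ω) ω) / ‖f (r • ω)‖ ^ 2‖ₑ ≤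
      radialVar n f h ω := by
    refine le_trans (setLIntegral_mono' measurableSet_Ioc fun r hr => ?_)
      (lintegral_mono_set (s := Ioc s t) fun r hr => ⟨by linarith [hr.1], by linarith [hr.2]⟩)
    have hx := hmem r ⟨hr.1.le, hr.2⟩
    have hpos : 0 < ‖f (r • ω)‖ := norm_pos_iff.2 (hf.ne_zero _ hx)
    rw [logGrad, indicator_of_mem hx]
    rw [← ofReal_norm, ← ofReal_norm, ← ofReal_norm, ← ENNReal.ofReal_div_of_pos hpos]
    refine ENNReal.ofReal_le_ofReal ?_
    rw [norm_div, norm_pow, norm_norm, div_le_div_iff₀ (by positivity) hpos]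
    have h4 : ‖inner ℝ (f (r • ω)) (fderiv ℝ f (r • ω) ω)‖ ≤
        ‖f (r • ω)‖ * ‖fderiv ℝ f (r • ω)‖ := by
      refine (norm_inner_le_norm _ _).trans ?_
      gcongr
      simpa [mem_sphere_zero_iff_norm.1 hω] using (fderiv ℝ f (r • ω)).le_opNorm ω
    nlinarith
  have h5 := h2.trans (h3.trans hV)
  rw [← ofReal_norm, Real.norm_eq_abs] at h5
  exact (ENNReal.ofReal_le_ofReal_iff hM).1 h5

theorem norm_radial_le {n : ℕ} {K C₀ α a C₁ : ℝ} {f : Vec n → Vec n}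
    (hf : IsHardyMap n K C₀ α a C₁ f) {ω : Vec n} (hω : ω ∈ unitSphere n) {h M : ℝ} (hh2 : h ≤ 1 / 2)
    (hM : 0 ≤ M) (hV : radialVar n f h ω ≤ ENNReal.ofReal M) {s t : ℝ} (hs : 1 - h ≤ s)
    (hst : s ≤ t) (ht : t < 1) :
    ‖f (t • ω)‖ ≤ Real.exp M * ‖f (s • ω)‖ ∧ ‖f (s • ω)‖ ≤ Real.exp M * ‖f (t • ω)‖ := by
  have h1 := abs_le.1 (abs_log_norm_sub_le hf hω hh2 hM hV hs hst ht)
  have hp : ∀ r, s ≤ r → r ≤ t → 0 < ‖f (r • ω)‖ := fun r hr hr' =>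
    norm_pos_iff.2 (hf.ne_zero _ (smul_mem_unitBall hω (by linarith) (by linarith)))
  have hs0 := hp s le_rfl hst
  have ht0 := hp t hst le_rfl
  constructor
  · rw [← Real.log_le_log_iff ht0 (by positivity), Real.log_mul (Real.exp_ne_zero _) hs0.ne',
      Real.log_exp]
    linarith [h1.2]
  · rw [← Real.log_le_log_iff hs0 (by positivity), Real.log_mul (Real.exp_ne_zero _) ht0.ne',
      Real.log_exp]
    linarith [h1.1]

theorem edist_radial_le {n : ℕ} {K C₀ α a C₁ : ℝ} {f : Vec n → Vec n}
    (hf : IsHardyMap n K C₀ α a C₁ f) {ω : Vec n} (hω : ω ∈ unitSphere n) {s₀ s t R : ℝ}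
    (hs0 : 0 ≤ s₀) (hs : s₀ ≤ s) (hst : s ≤ t) (ht : t < 1)
    (hR : ∀ r, s ≤ r → r ≤ t → ‖f (r • ω)‖ ≤ R) :
    edist (f (t • ω)) (f (s • ω)) ≤
      ENNReal.ofReal R * ∫⁻ r in Ioo s₀ 1, logGrad n f (r • ω) := by
  have hmem : ∀ r ∈ Icc s t, r • ω ∈ unitBall n := fun r hr =>
    smul_mem_unitBall hω (by linarith [hr.1]) (hr.2.trans_lt ht)
  have h2 := enorm_sub_le_lintegral_deriv (φ := fun r : ℝ => f (r • ω)) hst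
    fun r hr => hasDerivAt_radial rfl (hf.qr.2.1 _ (hmem r hr))
  rw [edist_eq_enorm_sub]
  refine h2.trans ?_
  rw [← lintegral_const_mul' _ _ ENNReal.ofReal_ne_top]
  refine le_trans (setLIntegral_mono' measurableSet_Ioc fun r hr => ?_)
    (lintegral_mono_set (s := Ioc s t) fun r hr => ⟨by linarith [hr.1], by linarith [hr.2]⟩)
  have hx := hmem r ⟨hr.1.le, hr.2⟩
  have h3 : ‖fderiv ℝ f (r • ω) ω‖ₑ ≤ ‖fderiv ℝ f (r • ω)‖ₑ := by
    rw [← ofReal_norm, ← ofReal_norm]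
    refine ENNReal.ofReal_le_ofReal ?_
    simpa [mem_sphere_zero_iff_norm.1 hω] using (fderiv ℝ f (r • ω)).le_opNorm ω
  refine h3.trans ?_
  rw [enorm_fderiv_eq hf.ne_zero hx, mul_comm]
  gcongr
  rw [← ofReal_norm]
  exact ENNReal.ofReal_le_ofReal (hR r hr.1.le hr.2)

theorem exists_radial_limit {n : ℕ} {K C₀ α a C₁ : ℝ} {f : Vec n → Vec n}
    (hf : IsHardyMap n K C₀ α a C₁ f) {ω : Vec n} (hω : ω ∈ unitSphere n)
    (hV : radialVar n f (1 / 2) ω < ⊤) :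
    ∃ L, Tendsto (fun t : ℝ => f (t • ω)) (𝓝[<] 1) (𝓝 L) := by
  have hVM : radialVar n f (1 / 2) ω ≤ ENNReal.ofReal (radialVar n f (1 / 2) ω).toReal :=
    (ENNReal.ofReal_toReal hV.ne).ge
  obtain ⟨R, hR⟩ : ∃ R, ∀ t : ℝ, 1 / 2 ≤ t → t < 1 → ‖f (t • ω)‖ ≤ R :=
    ⟨_, fun t ht ht1 => (norm_radial_le hf hω le_rfl ENNReal.toReal_nonneg hVM
      (s := 1 / 2) (by norm_num) ht ht1).1⟩
  have hIoo : Tendsto (volume.restrict (Ioo (1 / 2 : ℝ) 1) ∘ fun s : ℝ => Ioo s 1) (𝓝[<] 1)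
      (𝓝 0) := by
    have h1 : Tendsto (fun s : ℝ => ENNReal.ofReal (1 - s)) (𝓝[<] 1) (𝓝 0) := by
      have : Continuous fun s : ℝ => ENNReal.ofReal (1 - s) :=
        ENNReal.continuous_ofReal.comp (continuous_const.sub continuous_id)
      simpa using (this.tendsto 1).mono_left nhdsWithin_le_nhds
    refine tendsto_of_tendsto_of_tendsto_of_le_of_le tendsto_const_nhds h1 (fun _ => zero_le)
      fun s => (Measure.restrict_apply_le _ _).trans_eq ?_
    rw [Real.volume_Ioo]
  have htail : Tendsto (fun s : ℝ => ENNReal.ofReal R *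
      ∫⁻ r in Ioo s 1, logGrad n f (r • ω) ∂(volume.restrict (Ioo (1 / 2 : ℝ) 1))) (𝓝[<] 1)
      (𝓝 0) := by
    have h1 : ∫⁻ r in Ioo (1 / 2 : ℝ) 1, logGrad n f (r • ω) ≠ ⊤ := by
      rw [radialVar, show (1 : ℝ) - 1 / 2 = 1 / 2 by norm_num] at hV
      exact hV.ne
    simpa using ENNReal.Tendsto.const_mul (tendsto_setLIntegral_zero h1 hIoo)
      (Or.inr ENNReal.ofReal_ne_top)
  refine cauchy_map_iff_exists_tendsto.1 (EMetric.cauchy_iff.2 ⟨NeBot.ne inferInstance,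
    fun ε hε => ?_⟩)
  obtain ⟨s, ⟨hsε, hs2⟩, hs1⟩ := (((htail.eventually (gt_mem_nhds hε)).and
    (eventually_nhdsWithin_of_eventually_nhds (lt_mem_nhds (by norm_num : (1 / 2 : ℝ) < 1)))).and
      self_mem_nhdsWithin).exists
  have hs : Ioo s 1 ∩ Ioo (1 / 2 : ℝ) 1 = Ioo s 1 :=
    inter_eq_left.2 (Ioo_subset_Ioo_left hs2.le)
  rw [Measure.restrict_restrict measurableSet_Ioo, hs] at hsε
  have hle : ∀ y z : ℝ, s < y → y ≤ z → z < 1 → edist (f (z • ω)) (f (y • ω)) < ε :=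
    fun y z hy hyz hz => (edist_radial_le hf hω (by linarith) hy.le hyz hz
      fun r hr hr' => hR r (by linarith) (by linarith)).trans_lt hsε
  refine ⟨_, image_mem_map (Ioo_mem_nhdsLT hs1), ?_⟩
  rintro _ ⟨y, hy, rfl⟩ _ ⟨z, hz, rfl⟩
  rcases le_total y z with h | h
  · rw [edist_comm]; exact hle y z hy.1 h hz.2
  · exact hle z y hz.1 h hy.2

theorem exists_le_norm_of_dist_le {n : ℕ} {K C₀ α a C₁ : ℝ} (hC₀ : 1 ≤ C₀) (hα : 0 < α)
    {A τ : ℝ} (hA : 0 ≤ A) (hτ : 0 < τ) :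
    ∃ c : ℝ, 0 < c ∧ ∀ f, IsHardyMap n K C₀ α a C₁ f → ∀ x ∈ unitBall n, ∀ z ∈ unitBall n,
      dist z x ≤ A * (1 - ‖x‖) → τ * (1 - ‖x‖) ≤ 1 - ‖z‖ →
        c * ‖f x‖ ≤ ‖f z‖ ∧ c * ‖f z‖ ≤ ‖f x‖ := by
  set δ := τ / (A + 2) ^ 2 with hδ
  have hδ0 : 0 < δ := by positivity
  refine ⟨C₀⁻¹ * (4 / δ) ^ (-α), by positivity, fun f hf x hx z hz hzx hzτ => ?_⟩
  have hx1 : 0 < 1 - ‖x‖ := sub_pos.2 (mem_ball_zero_iff.1 hx)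
  have hgap : δ ≤ mobiusGap x z := by
    refine le_trans ?_ (le_mobiusGap_of_dist_le hx hz hA hzx)
    rw [hδ, div_le_div_iff₀ (by positivity) (by positivity)]
    have : 0 ≤ (A + 2) ^ 2 := by positivity
    nlinarith
  obtain ⟨h1, h2⟩ := harnack_of_le_mobiusGap hC₀ hα hf.ne_zero hf.miniowitz hx hz hδ0 hgap
  refine ⟨h2, ?_⟩
  have h3 : 0 < C₀ * (4 / δ) ^ α := by positivity
  rw [Real.rpow_neg (by positivity), ← mul_inv, inv_mul_le_iff₀ h3]
  exact h1

theorem exists_lt_norm_cap {n : ℕ} {K C₀ α a C₁ κ : ℝ} (hC₀ : 1 ≤ C₀) (hα : 0 < α)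
    (hκ : 0 < κ) :
    ∃ c : ℝ, 0 < c ∧ ∀ f, IsHardyMap n K C₀ α a C₁ f → ∀ ω ∈ unitSphere n, ∀ x ∈ ntRegion n κ ω,
      ∃ ω₀ ∈ unitSphere n, ∃ h : ℝ, 0 < h ∧ h ≤ 1 / 2 ∧
        closedBall ω₀ h ⊆ closedBall ω ((3 + κ) * h) ∧ c * ‖f x‖ ≤ ‖f ((1 - h) • ω₀)‖ := by
  obtain ⟨c, hc, hharnack⟩ := exists_le_norm_of_dist_le (n := n) (K := K) (a := a) (C₁ := C₁) hC₀ hα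
    (show (0 : ℝ) ≤ 2 by norm_num) (show (0 : ℝ) < 1 / 2 by norm_num)
  refine ⟨min c 1, by positivity, fun f hf ω hω x hx => ?_⟩
  have hω1 : ‖ω‖ = 1 := mem_sphere_zero_iff_norm.1 hω
  have hx1 : ‖x‖ < 1 := mem_ball_zero_iff.1 hx.1
  rcases le_or_gt (1 / 2) ‖x‖ with h2 | h2
  · have hx0 : ‖x‖ ≠ 0 := by linarith
    have hn0 : ‖‖x‖⁻¹ • x‖ = 1 := by
      rw [norm_smul, norm_inv, norm_norm, inv_mul_cancel₀ hx0]
    refine ⟨‖x‖⁻¹ • x, mem_sphere_zero_iff_norm.2 hn0, 1 - ‖x‖, by linarith, by linarith, ?_, ?_⟩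
    · refine closedBall_subset_closedBall' ?_
      have h3 : dist (‖x‖⁻¹ • x) x ≤ 1 - ‖x‖ := by
        rw [dist_eq_norm, show ‖x‖⁻¹ • x - x = (1 - ‖x‖) • (‖x‖⁻¹ • x) by
          rw [sub_smul, one_smul, smul_inv_smul₀ hx0], norm_smul, hn0, mul_one,
          Real.norm_of_nonneg (by linarith)]
      have h4 : dist x ω ≤ (1 + κ) * (1 - ‖x‖) := by rw [dist_eq_norm]; exact hx.2.le
      linarith [dist_triangle (‖x‖⁻¹ • x) x ω]
    · rw [sub_sub_cancel, smul_inv_smul₀ hx0]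
      exact mul_le_of_le_one_left (norm_nonneg _) (min_le_right _ _)
  · refine ⟨ω, hω, 1 / 2, by norm_num, le_rfl, closedBall_subset_closedBall (by linarith), ?_⟩
    have hz := norm_smul_unitSphere hω (show (0 : ℝ) ≤ 1 - 1 / 2 by norm_num)
    have h3 := (hharnack f hf x hx.1 ((1 - 1 / 2 : ℝ) • ω)
      (smul_mem_unitBall hω (by norm_num) (by norm_num)) (by
        rw [dist_eq_norm]
        refine (norm_sub_le _ _).trans ?_
        rw [hz]; linarith) (by rw [hz]; linarith [norm_nonneg x])).1
    refine le_trans ?_ h3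
    gcongr
    exact min_le_left _ _

theorem exists_cap_limit_const {n : ℕ} (hn : 2 ≤ n) {K C₀ α a C₁ κ : ℝ} (hK : 1 ≤ K)
    (hC₀ : 1 ≤ C₀) (hα : 0 < α) (ha0 : 0 ≤ a) (ha : a < (n : ℝ) - 1) (hC₁ : 0 < C₁)
    (hκ : 0 < κ) :
    ∃ c d : ℝ, 0 < c ∧ 0 < d ∧ ∀ f, IsHardyMap n K C₀ α a C₁ f → ∀ g : Vec n → Vec n,
      (∀ᵐ ω ∂(polarSphere n), Tendsto (fun t : ℝ => f (t • ω)) (𝓝[<] 1) (𝓝 (g ω))) →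
      ∀ ω ∈ unitSphere n, ∀ x ∈ ntRegion n κ ω, ∃ r : ℝ, 0 < r ∧ r ≤ 3 + κ ∧
        ENNReal.ofReal (d * r ^ (n - 1)) ≤
          polarSphere n (closedBall ω r ∩ {ω' | c * ‖f x‖ ≤ ‖g ω'‖}) := by
  obtain ⟨c₁, hc₁, hcap⟩ := exists_lt_norm_cap (n := n) (K := K) (a := a) (C₁ := C₁) hC₀ hα hκ
  obtain ⟨c₂, hc₂, hharnack⟩ := exists_le_norm_of_dist_le (n := n) (K := K) (a := a) (C₁ := C₁)
    hC₀ hα zero_le_one one_pos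
  obtain ⟨M, d, hM, hd, hgood⟩ := exists_good_cap_const hn hK hC₀ hα ha0 ha hC₁
  refine ⟨(Real.exp M)⁻¹ * (c₂ * c₁), d / (3 + κ) ^ (n - 1), by positivity, by positivity,
    fun f hf g hg ω hω x hx => ?_⟩
  obtain ⟨ω₀, hω₀, h, hh, hh2, hsub, hfx⟩ := hcap f hf ω hω x hx
  refine ⟨(3 + κ) * h, by positivity, by nlinarith, ?_⟩
  have h1 := hgood f hf ω₀ hω₀ h hh hh2
  rw [mul_pow, ← mul_assoc, div_mul_cancel₀ _ (by positivity)]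
  refine h1.trans (measure_mono_ae ?_)
  filter_upwards [hg, ae_polarSphere_mem_unitSphere n] with ω' hlim hω' hmem
  obtain ⟨hm1, hm2⟩ := hmem
  refine ⟨hsub hm1, ?_⟩
  have hn0 := norm_smul_unitSphere hω₀ (show 0 ≤ 1 - h by linarith)
  have hn' := norm_smul_unitSphere hω' (show 0 ≤ 1 - h by linarith)
  have h2 : c₂ * ‖f ((1 - h) • ω₀)‖ ≤ ‖f ((1 - h) • ω')‖ := by
    refine (hharnack f hf _ (smul_mem_unitBall hω₀ (by linarith) (by linarith)) _
      (smul_mem_unitBall hω' (by linarith) (by linarith)) ?_ (by rw [hn0, hn', one_mul])).1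
    rw [dist_smul₀, hn0, Real.norm_of_nonneg (by linarith)]
    rw [mem_closedBall] at hm1
    nlinarith [dist_nonneg (x := ω') (y := ω₀)]
  have h3 : (Real.exp M)⁻¹ * ‖f ((1 - h) • ω')‖ ≤ ‖g ω'‖ := by
    refine ge_of_tendsto hlim.norm ?_
    filter_upwards [Ioo_mem_nhdsLT (show 1 - h < 1 by linarith)] with t ht
    rw [inv_mul_le_iff₀ (Real.exp_pos _)]
    exact (norm_radial_le hf hω' hh2 hM.le (le_of_lt hm2) le_rfl ht.1.le ht.2).2
  rw [mem_ofPred_eq]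
  refine le_trans ?_ h3
  rw [mul_assoc, mul_assoc]
  gcongr
  exact (mul_le_mul_of_nonneg_left hfx hc₂.le).trans h2

theorem exists_distribution_const {n : ℕ} (hn : 2 ≤ n) {K C₀ α a C₁ κ : ℝ} (hK : 1 ≤ K)
    (hC₀ : 1 ≤ C₀) (hα : 0 < α) (ha0 : 0 ≤ a) (ha : a < (n : ℝ) - 1) (hC₁ : 0 < C₁)
    (hκ : 0 < κ) :
    ∃ (c : ℝ) (C : ℝ≥0∞), 0 < c ∧ C ≠ ⊤ ∧ ∀ f, IsHardyMap n K C₀ α a C₁ f → ∀ g : Vec n → Vec n,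
      (∀ᵐ ω ∂(polarSphere n), Tendsto (fun t : ℝ => f (t • ω)) (𝓝[<] 1) (𝓝 (g ω))) →
      ∀ t : ℝ, 0 < t → polarSphere n {ω | ENNReal.ofReal t < ntMax n κ f ω} ≤
        C * polarSphere n {ω | c * t ≤ ‖g ω‖} := by
  obtain ⟨c, d, hc, hd, hcap⟩ := exists_cap_limit_const hn hK hC₀ hα ha0 ha hC₁ hκ
  obtain ⟨C, hC, hball⟩ := exists_polarSphere_closedBall_le (show 1 ≤ n by omega)
  have hd0 : ENNReal.ofReal d ≠ 0 := by simpa using hd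
  refine ⟨c, ENNReal.ofReal (C * 5 ^ (n - 1)) * (ENNReal.ofReal d)⁻¹, hc,
    ENNReal.mul_ne_top ENNReal.ofReal_ne_top (ENNReal.inv_ne_top.2 hd0),
    fun f hf g hg t ht => ?_⟩
  set F := {ω | c * t ≤ ‖g ω‖} with hF
  set E := {ω | ENNReal.ofReal t < ntMax n κ f ω} ∩ unitSphere n with hE
  have hEν : polarSphere n {ω | ENNReal.ofReal t < ntMax n κ f ω} ≤ polarSphere n E := by
    refine measure_mono_ae ?_
    filter_upwards [ae_polarSphere_mem_unitSphere n] with ω hω h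
    exact ⟨h, hω⟩
  obtain ⟨u, r, huE, huc, hr, hcov, hsum⟩ := exists_vitali_cover (n := n) (m := n - 1)
    (μ := (ENNReal.ofReal d)⁻¹ • (polarSphere n).restrict F) (E := E) (δ := 3 + κ) fun ω hω => by
      obtain ⟨hω1, hω⟩ := hω
      rw [mem_ofPred_eq, ntMax] at hω1
      obtain ⟨x, hx⟩ := lt_iSup_iff.1 hω1
      obtain ⟨hxΓ, hx⟩ := lt_iSup_iff.1 hx
      have hxt : t ≤ ‖f x‖ := (ENNReal.ofReal_lt_ofReal_iff_of_nonneg ht.le).1 hx |>.le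
      obtain ⟨r, hr0, hr, hrν⟩ := hcap f hf g hg ω hω x hxΓ
      refine ⟨r, hr0, hr, ?_⟩
      rw [Measure.smul_apply, smul_eq_mul, Measure.restrict_apply measurableSet_closedBall,
        mul_comm, ← div_eq_mul_inv, ENNReal.le_div_iff_mul_le (Or.inl hd0)
        (Or.inl ENNReal.ofReal_ne_top), mul_comm, ← ENNReal.ofReal_mul hd.le]
      refine hrν.trans (measure_mono (inter_subset_inter_right _ fun ω' hω' => ?_))
      exact (mul_le_mul_of_nonneg_left hxt hc.le).trans hω'
  have : Countable u := huc.to_subtype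
  calc _ ≤ ∑' b : u, polarSphere n (closedBall (b : Vec n) (5 * r b)) :=
        hEν.trans ((measure_mono hcov).trans (measure_iUnion_le _))
    _ ≤ ∑' b : u, ENNReal.ofReal (C * 5 ^ (n - 1)) * ENNReal.ofReal (r b ^ (n - 1)) := by
        refine ENNReal.tsum_le_tsum fun b => ?_
        have h1 := (hr b b.2).1
        refine (hball b (huE b.2).2 _ (by positivity)).trans (le_of_eq ?_)
        rw [← ENNReal.ofReal_mul (by positivity), mul_pow, mul_assoc]
    _ ≤ _ := by
        rw [ENNReal.tsum_mul_left, mul_assoc]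
        gcongr
        refine hsum.trans (le_of_eq ?_)
        rw [Measure.smul_apply, Measure.restrict_apply_univ, smul_eq_mul]

theorem lintegral_rpow_le_of_distribution {X : Type*} [MeasurableSpace X] {μ : Measure X}
    [IsFiniteMeasure μ] {F : X → ℝ≥0∞} {G : X → ℝ} (hF : AEMeasurable F μ) (hG : AEMeasurable G μ)
    (hG0 : ∀ x, 0 ≤ G x) {c p : ℝ} (hc : 0 < c) (hp : 0 < p) {C : ℝ≥0∞} (hC : C ≠ ⊤)
    (h : ∀ t : ℝ, 0 < t → μ {x | ENNReal.ofReal t < F x} ≤ C * μ {x | c * t ≤ G x}) :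
    ∫⁻ x, F x ^ p ∂μ ≤ C * ENNReal.ofReal (c⁻¹ ^ p) * ∫⁻ x, ENNReal.ofReal (G x ^ p) ∂μ := by
  have hFtop : ∀ᵐ x ∂μ, F x < ⊤ := by
    have hlim : Tendsto (fun k : ℕ => C * μ {x | c * (k + 1 : ℝ) ≤ G x}) atTop (𝓝 (C * 0)) := by
      refine ENNReal.Tendsto.const_mul ?_ (Or.inr hC)
      have h1 := tendsto_measure_iInter_atTop (μ := μ) (s := fun k : ℕ => {x | c * (k + 1 : ℝ) ≤ G x})
        (fun k => nullMeasurableSet_le aemeasurable_const hG)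
        (fun i j hij x hx => le_trans (by gcongr) (show c * (j + 1 : ℝ) ≤ G x from hx))
        ⟨0, measure_ne_top _ _⟩
      have h2 : (⋂ k : ℕ, {x | c * (k + 1 : ℝ) ≤ G x}) = ∅ := by
        refine eq_empty_of_forall_notMem fun x hx => ?_
        obtain ⟨k, hk⟩ := exists_nat_gt (G x / c)
        have h3 : c * (k + 1 : ℝ) ≤ G x := mem_iInter.1 hx k
        rw [div_lt_iff₀ hc] at hk
        nlinarith
      rw [h2, measure_empty] at h1
      exact h1
    rw [mul_zero] at hlim
    rw [ae_iff]
    refine le_antisymm (ge_of_tendsto hlim (.of_forall fun k => ?_)) zero_le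
    refine le_trans (measure_mono fun x hx => ?_) (h (k + 1) (by positivity))
    rw [mem_ofPred_eq, not_lt, top_le_iff] at hx
    rw [mem_ofPred_eq, hx]
    exact ENNReal.ofReal_lt_top
  have hFr : ∫⁻ x, F x ^ p ∂μ = ∫⁻ x, ENNReal.ofReal ((F x).toReal ^ p) ∂μ := by
    refine lintegral_congr_ae (hFtop.mono fun x hx => ?_)
    simp only
    rw [← ENNReal.ofReal_rpow_of_nonneg ENNReal.toReal_nonneg hp.le, ENNReal.ofReal_toReal hx.ne]
  have hGr : ENNReal.ofReal (c⁻¹ ^ p) * ∫⁻ x, ENNReal.ofReal (G x ^ p) ∂μ =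
      ∫⁻ x, ENNReal.ofReal ((c⁻¹ * G x) ^ p) ∂μ := by
    rw [← lintegral_const_mul' _ _ ENNReal.ofReal_ne_top]
    refine lintegral_congr fun x => ?_
    rw [← ENNReal.ofReal_mul (by positivity), Real.mul_rpow (by positivity) (hG0 x)]
  rw [mul_assoc, hGr, hFr, lintegral_rpow_eq_lintegral_meas_lt_mul μ
    (.of_forall fun _ => ENNReal.toReal_nonneg) hF.ennreal_toReal hp,
    lintegral_rpow_eq_lintegral_meas_le_mul μ
    (.of_forall fun x => mul_nonneg (inv_nonneg.2 hc.le) (hG0 x)) (hG.const_mul _) hp, mul_left_comm]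
  gcongr
  rw [← lintegral_const_mul' _ _ hC]
  refine setLIntegral_mono' measurableSet_Ioi fun t ht => ?_
  rw [← mul_assoc]
  gcongr
  refine le_trans (measure_mono fun x hx => ?_) ((h t ht).trans (le_of_eq ?_))
  · rcases eq_or_ne (F x) ⊤ with hT | hT
    · rw [mem_ofPred_eq, hT]; exact ENNReal.ofReal_lt_top
    · exact (ENNReal.ofReal_lt_iff_lt_toReal (le_of_lt ht) hT).2 hx
  · congr 3
    ext x
    rw [← div_eq_inv_mul, le_div_iff₀ hc, mul_comm]

theorem measurable_ntMax {n : ℕ} (κ : ℝ) (f : Vec n → Vec n) : Measurable (ntMax n κ f) := by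
  refine measurable_of_Ioi fun t => IsOpen.measurableSet ?_
  have : ntMax n κ f ⁻¹' Ioi t = ⋃ x ∈ {x ∈ unitBall n | t < ENNReal.ofReal ‖f x‖},
      {ω | ‖x - ω‖ < (1 + κ) * (1 - ‖x‖)} := by
    ext ω
    simp only [mem_preimage, mem_Ioi, ntMax, lt_iSup_iff, mem_iUnion, exists_prop, mem_ofPred_eq,
      ntRegion]
    exact ⟨fun ⟨x, ⟨h1, h2⟩, h3⟩ => ⟨x, ⟨h1, h3⟩, h2⟩, fun ⟨x, ⟨h1, h3⟩, h2⟩ => ⟨x, ⟨h1, h2⟩, h3⟩⟩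
  rw [this]
  exact isOpen_biUnion fun x _ => isOpen_lt (by fun_prop) continuous_const

theorem aemeasurable_of_radial_limit {n : ℕ} {f g : Vec n → Vec n}
    (hf : ContinuousOn f (unitBall n))
    (hg : ∀ᵐ ω ∂(polarSphere n), Tendsto (fun t : ℝ => f (t • ω)) (𝓝[<] 1) (𝓝 (g ω))) :
    AEMeasurable g (polarSphere n) := by
  have h1 : Measurable ((unitBall n).indicator f) :=
    hf.measurable_piecewise (g := fun _ => (0 : Vec n)) continuousOn_const
      (isOpen_unitBall n).measurableSet
  refine aemeasurable_of_tendsto_metrizable_ae (𝓝[<] (1 : ℝ))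
    (f := fun t ω => (unitBall n).indicator f (t • ω))
    (fun t => (h1.comp (measurable_id.const_smul t)).aemeasurable) ?_
  filter_upwards [hg, ae_polarSphere_mem_unitSphere n] with ω hω hS
  refine hω.congr' ?_
  filter_upwards [Ioo_mem_nhdsLT (zero_lt_one' ℝ)] with t ht
  rw [indicator_of_mem (smul_mem_unitBall hS ht.1.le ht.2)]

theorem exists_ntMax_const {n : ℕ} (hn : 2 ≤ n) {K C₀ α a C₁ κ p : ℝ} (hK : 1 ≤ K)
    (hC₀ : 1 ≤ C₀) (hα : 0 < α) (ha0 : 0 ≤ a) (ha : a < (n : ℝ) - 1) (hC₁ : 0 < C₁)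
    (hκ : 0 < κ) (hp : 0 < p) :
    ∃ C : ℝ≥0∞, C ≠ ⊤ ∧ ∀ f, IsHardyMap n K C₀ α a C₁ f → ∀ g : Vec n → Vec n,
      (∀ᵐ ω ∂(polarSphere n), Tendsto (fun t : ℝ => f (t • ω)) (𝓝[<] 1) (𝓝 (g ω))) →
      ∫⁻ ω, ntMax n κ f ω ^ p ∂(polarSphere n) ≤
        C * ∫⁻ ω, ENNReal.ofReal (‖g ω‖ ^ p) ∂(polarSphere n) := by
  obtain ⟨c, C, hc, hC, hdist⟩ := exists_distribution_const hn hK hC₀ hα ha0 ha hC₁ hκ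
  exact ⟨C * ENNReal.ofReal (c⁻¹ ^ p), ENNReal.mul_ne_top hC ENNReal.ofReal_ne_top,
    fun f hf g hg => lintegral_rpow_le_of_distribution (measurable_ntMax κ f).aemeasurable
      (aemeasurable_of_radial_limit hf.qr.1 hg).norm (fun _ => norm_nonneg _) hc hp hC
      (hdist f hf g hg)⟩

theorem IsHardyMap.integrableOn_norm_fderiv_pow {n : ℕ} (hn : 1 ≤ n) {K C₀ α a C₁ : ℝ} (hK : 1 ≤ K)
    (hC₀ : 1 ≤ C₀) (hα : 0 < α) (hC₁ : 0 < C₁) {f : Vec n → Vec n}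
    (hf : IsHardyMap n K C₀ α a C₁ f) {S : Set (Vec n)} (hS : S ⊆ unitBall n) (hSc : IsCompact S) :
    IntegrableOn (fun x => ‖fderiv ℝ f x‖ ^ n) S := by
  rcases S.eq_empty_or_nonempty with rfl | hne
  · exact integrableOn_empty
  obtain ⟨C, hC, henergy⟩ := exists_energy_const hn hK hC₀ hα hC₁ (lt_add_one a)
  obtain ⟨z₀, hz₀, hmax⟩ := hSc.exists_isMaxOn hne continuous_norm.continuousOn
  have hz₀1 : 0 < 1 - ‖z₀‖ ^ 2 := one_sub_sq_norm_pos (hS hz₀)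
  have h0 := henergy f hf 0 (mem_ball_self one_pos) (1 - ‖z₀‖ ^ 2) hz₀1
    (by linarith [sq_nonneg ‖z₀‖]) S hS hSc.measurableSet fun z hz => by
      have h1 : ‖z‖ ≤ ‖z₀‖ := hmax hz
      have h2 := one_sub_sq_norm_pos (hS hz)
      have h3 : mobiusGap 0 z = 1 - ‖z‖ ^ 2 := by simp [mobiusGap]
      rw [h3]
      have := norm_nonneg z
      nlinarith
  obtain ⟨M, hM⟩ := hSc.exists_bound_of_continuousOn (hf.qr.1.mono hS)
  refine ⟨((measurable_fderiv ℝ f).norm.pow_const n).aestronglyMeasurable, ?_⟩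
  calc ∫⁻ x in S, ‖‖fderiv ℝ f x‖ ^ n‖ₑ ≤ ∫⁻ x in S, ENNReal.ofReal M ^ n * logGrad n f x ^ n := by
        refine setLIntegral_mono' hSc.measurableSet fun x hx => ?_
        rw [enorm_pow, enorm_norm, enorm_fderiv_eq hf.ne_zero (hS hx), mul_pow, mul_comm]
        gcongr
        rw [← ofReal_norm]
        exact ENNReal.ofReal_le_ofReal (hM x hx)
    _ = ENNReal.ofReal M ^ n * ∫⁻ x in S, logGrad n f x ^ n :=
        lintegral_const_mul' _ _ (by simp)
    _ < ⊤ := ENNReal.mul_lt_top (by simp) (h0.trans_lt ENNReal.ofReal_lt_top)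

theorem exists_whitney_osc_const {n : ℕ} (hn : 2 ≤ n) {K C₀ α a C₁ : ℝ} (hK : 1 ≤ K)
    (hC₀ : 1 ≤ C₀) (hα : 0 < α) (hC₁ : 0 < C₁) :
    ∃ C : ℝ≥0∞, C ≠ ⊤ ∧ ∀ f, IsHardyMap n K C₀ α a C₁ f → ∀ y ∈ unitBall n, ∀ z,
      dist z y ≤ (1 - ‖y‖) / (4 * n) → ‖f z - f y‖ₑ ≤ C * ‖f y‖ₑ *
        (∫⁻ x in closedBall y ((1 - ‖y‖) / 2), logGrad n f x ^ n) ^ (1 / (n : ℝ)) := by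
  obtain ⟨C, hC, hosc⟩ := exists_osc_const hn
  obtain ⟨c, hc, hharnack⟩ := exists_le_norm_of_dist_le (n := n) (K := K) (a := a) (C₁ := C₁)
    hC₀ hα zero_le_one (show (0 : ℝ) < 1 / 2 by norm_num)
  refine ⟨C * ENNReal.ofReal c⁻¹, ENNReal.mul_ne_top hC ENNReal.ofReal_ne_top,
    fun f hf y hy z hz => ?_⟩
  have hn0 : (0 : ℝ) < n := by exact_mod_cast (show 0 < n by omega)
  have hy1 : 0 < 1 - ‖y‖ := sub_pos.2 (mem_ball_zero_iff.1 hy)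
  have hr : 2 * n * ((1 - ‖y‖) / (4 * n)) = (1 - ‖y‖) / 2 := by field_simp; norm_num
  have hball : ∀ x ∈ closedBall y ((1 - ‖y‖) / 2), 1 / 2 * (1 - ‖y‖) ≤ 1 - ‖x‖ := fun x hx => by
    rw [mem_closedBall, dist_eq_norm] at hx
    have := norm_le_norm_add_norm_sub' x y
    linarith
  have hsub : closedBall y ((1 - ‖y‖) / 2) ⊆ unitBall n := fun x hx =>
    mem_ball_zero_iff.2 (by linarith [hball x hx])
  have h1 := hosc (unitBall n) f K (isOpen_unitBall n) hf.qr.2.1 hf.qr.2.2 (by linarith)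
    (fun S hS hSc => hf.integrableOn_norm_fderiv_pow (by omega) hK hC₀ hα hC₁ hS hSc) y
    ((1 - ‖y‖) / (4 * n)) (by positivity) (by rw [hr]; exact hsub) z hz
  rw [hr] at h1
  refine h1.trans ?_
  rw [mul_assoc, mul_assoc]
  gcongr
  have h2 : ∫⁻ x in closedBall y ((1 - ‖y‖) / 2), ‖fderiv ℝ f x‖ₑ ^ n ≤
      (ENNReal.ofReal c⁻¹ * ‖f y‖ₑ) ^ n *
        ∫⁻ x in closedBall y ((1 - ‖y‖) / 2), logGrad n f x ^ n := by
    rw [← lintegral_const_mul' _ _ (ENNReal.pow_ne_top (ENNReal.mul_ne_top ENNReal.ofReal_ne_top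
      enorm_ne_top))]
    refine setLIntegral_mono' measurableSet_closedBall fun x hx => ?_
    rw [enorm_fderiv_eq hf.ne_zero (hsub hx), mul_pow, mul_comm]
    gcongr
    have h3 := (hharnack f hf y hy x (hsub hx) (by
      rw [mem_closedBall] at hx; linarith) (hball x hx)).2
    rw [← ofReal_norm, ← ofReal_norm, ← ENNReal.ofReal_mul (by positivity)]
    exact ENNReal.ofReal_le_ofReal ((le_inv_mul_iff₀ hc).2 h3)
  calc _ ≤ _ := ENNReal.rpow_le_rpow h2 (by positivity)
    _ = _ := by
        rw [ENNReal.mul_rpow_of_nonneg _ _ (by positivity), ← ENNReal.rpow_natCast,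
          ← ENNReal.rpow_mul, mul_one_div_cancel hn0.ne', ENNReal.rpow_one, mul_assoc]

theorem polarSphere_shadow_le {n : ℕ} {C κ : ℝ} (hκ : 0 < κ)
    (hball : ∀ ω ∈ unitSphere n, ∀ r > 0, polarSphere n (closedBall ω r) ≤
      ENNReal.ofReal (C * r ^ (n - 1))) {x : Vec n} (hx : x ∈ unitBall n) :
    polarSphere n {ω | x ∈ ntRegion n κ ω} ≤
      ENNReal.ofReal (C * (2 * (1 + κ) * (1 - ‖x‖)) ^ (n - 1)) := by
  have hx1 : 0 < 1 - ‖x‖ := sub_pos.2 (mem_ball_zero_iff.1 hx)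
  have hle : polarSphere n {ω | x ∈ ntRegion n κ ω} ≤
      polarSphere n ({ω | x ∈ ntRegion n κ ω} ∩ unitSphere n) := by
    refine measure_mono_ae ?_
    filter_upwards [ae_polarSphere_mem_unitSphere n] with ω hω h
    exact ⟨h, hω⟩
  refine hle.trans ?_
  rcases ({ω | x ∈ ntRegion n κ ω} ∩ unitSphere n).eq_empty_or_nonempty with h0 | ⟨ω₀, h1, h2⟩
  · rw [h0, measure_empty]; exact zero_le
  · refine le_trans (measure_mono fun ω hω => ?_) (hball ω₀ h2 _ (by positivity))
    have h3 : ‖x - ω₀‖ < (1 + κ) * (1 - ‖x‖) := h1.2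
    have h4 : ‖x - ω‖ < (1 + κ) * (1 - ‖x‖) := hω.1.2
    rw [mem_closedBall, dist_eq_norm, show ω - ω₀ = (x - ω₀) - (x - ω) by abel]
    linarith [norm_sub_le (x - ω₀) (x - ω)]

theorem isOpen_ntRegion_prod (n : ℕ) (κ : ℝ) :
    IsOpen {q : Vec n × Vec n | q.2 ∈ ntRegion n κ q.1} := by
  have h1 : Continuous fun q : Vec n × Vec n => ‖q.2 - q.1‖ := by fun_prop
  have h2 : Continuous fun q : Vec n × Vec n => (1 + κ) * (1 - ‖q.2‖) := by fun_prop
  exact ((isOpen_unitBall n).preimage continuous_snd).inter (isOpen_lt h1 h2)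

theorem isOpen_ntRegion (n : ℕ) (κ : ℝ) (ω : Vec n) : IsOpen (ntRegion n κ ω) :=
  (isOpen_ntRegion_prod n κ).preimage (Continuous.prodMk_right ω)

theorem ae_lintegral_ntRegion_lt_top {n : ℕ} (hn : 2 ≤ n) {K C₀ α a C₁ κ : ℝ} (hK : 1 ≤ K)
    (hC₀ : 1 ≤ C₀) (hα : 0 < α) (ha0 : 0 ≤ a) (ha : a < (n : ℝ) - 1) (hC₁ : 0 < C₁) (hκ : 0 < κ)
    {f : Vec n → Vec n} (hf : IsHardyMap n K C₀ α a C₁ f) :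
    ∀ᵐ ω ∂(polarSphere n), ∫⁻ x in ntRegion n κ ω, logGrad n f x ^ n < ⊤ := by
  obtain ⟨b, hab, hb⟩ := exists_between ha
  obtain ⟨C, hC, hball⟩ := exists_polarSphere_closedBall_le (show 1 ≤ n by omega)
  obtain ⟨C', hC', hbox⟩ := exists_box_const (show 1 ≤ n by omega) hK hC₀ hα ha0 hC₁ hab
    (show (0 : ℝ) ≤ 1 by norm_num)
  have h0 := hbox f hf 0 (mem_ball_self one_pos)
  have hset : unitBall n ∩ closedBall 0 (1 * (1 - ‖(0 : Vec n)‖)) = unitBall n := by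
    rw [norm_zero, sub_zero, mul_one]
    exact inter_eq_left.2 ball_subset_closedBall
  rw [hset] at h0
  have hw := (measurable_logGrad hf.qr.1).pow_const n
  set P := {q : Vec n × Vec n | q.2 ∈ ntRegion n κ q.1} with hP
  have hPm : MeasurableSet P := (isOpen_ntRegion_prod n κ).measurableSet
  have hPint : Measurable (P.indicator fun q : Vec n × Vec n => logGrad n f q.2 ^ n) :=
    (hw.comp measurable_snd).indicator hPm
  have hin : ∀ ω, ∫⁻ x in ntRegion n κ ω, logGrad n f x ^ n =
      ∫⁻ x, P.indicator (fun q : Vec n × Vec n => logGrad n f q.2 ^ n) (ω, x) := fun ω => by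
    rw [← lintegral_indicator (isOpen_ntRegion n κ ω).measurableSet]
    rfl
  simp only [hin]
  refine ae_lt_top hPint.lintegral_prod_right' (ne_of_lt ?_)
  rw [lintegral_lintegral_swap (μ := polarSphere n) (ν := volume)
    (f := fun ω x => P.indicator (fun q : Vec n × Vec n => logGrad n f q.2 ^ n) (ω, x))
    hPint.aemeasurable]
  set D := C * (2 * (1 + κ)) ^ (n - 1) with hD
  refine lt_of_le_of_lt (b := ENNReal.ofReal D *
    ∫⁻ x in unitBall n, logGrad n f x ^ n * ENNReal.ofReal ((1 - ‖x‖) ^ b)) ?_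
    (ENNReal.mul_lt_top ENNReal.ofReal_lt_top (h0.trans_lt ENNReal.ofReal_lt_top))
  rw [← lintegral_const_mul' _ _ ENNReal.ofReal_ne_top,
    ← lintegral_indicator (isOpen_unitBall n).measurableSet]
  refine lintegral_mono fun x => ?_
  by_cases hx : x ∈ unitBall n
  · have hx1 : 0 < 1 - ‖x‖ := sub_pos.2 (mem_ball_zero_iff.1 hx)
    rw [indicator_of_mem hx]
    have hmeas : MeasurableSet {ω | x ∈ ntRegion n κ ω} :=
      ((isOpen_ntRegion_prod n κ).preimage (Continuous.prodMk_left x)).measurableSet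
    calc _ = ∫⁻ ω, {ω | x ∈ ntRegion n κ ω}.indicator (fun _ => logGrad n f x ^ n) ω
            ∂(polarSphere n) := rfl
      _ = logGrad n f x ^ n * polarSphere n {ω | x ∈ ntRegion n κ ω} := by
          rw [lintegral_indicator hmeas, setLIntegral_const]
      _ ≤ logGrad n f x ^ n * ENNReal.ofReal (D * (1 - ‖x‖) ^ b) := by
          gcongr
          refine (polarSphere_shadow_le hκ hball hx).trans (ENNReal.ofReal_le_ofReal ?_)
          rw [mul_pow, ← mul_assoc]
          gcongr
          rw [← Real.rpow_natCast, Nat.cast_sub (by omega), Nat.cast_one]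
          exact Real.rpow_le_rpow_of_exponent_ge hx1 (by linarith [norm_nonneg x]) hb.le
      _ = _ := by
          rw [ENNReal.ofReal_mul (by positivity), mul_left_comm]
  · rw [indicator_of_notMem hx]
    refine (lintegral_congr fun ω => ?_).trans_le (lintegral_zero).le
    exact indicator_of_notMem (fun h => hx h.1) _

theorem smul_mem_ntRegion {n : ℕ} {κ : ℝ} (hκ : 0 < κ) {ω : Vec n} (hω : ω ∈ unitSphere n)
    {t : ℝ} (ht : 0 ≤ t) (ht1 : t < 1) : t • ω ∈ ntRegion n κ ω := by
  refine ⟨smul_mem_unitBall hω ht ht1, ?_⟩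
  rw [norm_smul_unitSphere hω ht, show t • ω - ω = -((1 - t) • ω) by module, norm_neg, norm_smul,
    mem_sphere_zero_iff_norm.1 hω, mul_one, Real.norm_of_nonneg (by linarith)]
  nlinarith

theorem exists_ntRegion_osc_const {n : ℕ} (hn : 2 ≤ n) {K C₀ α a C₁ κ : ℝ} (hK : 1 ≤ K)
    (hC₀ : 1 ≤ C₀) (hα : 0 < α) (hC₁ : 0 < C₁) (hκ : 0 < κ) :
    ∃ C : ℝ≥0∞, C ≠ ⊤ ∧ ∀ f : Vec n → Vec n, IsHardyMap n K C₀ α a C₁ f →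
      ∀ ω ∈ unitSphere n, ∀ x ∈ ntRegion n κ ω,
        ‖f x - f (‖x‖ • ω)‖ₑ ≤ C * ‖f (‖x‖ • ω)‖ₑ *
          (∫⁻ z in ntRegion n (9 + 3 * κ) ω ∩ closedBall ω (2 * (3 + κ) * (1 - ‖x‖)),
            logGrad n f z ^ n) ^ (1 / (n : ℝ)) := by
  obtain ⟨C, hC, hosc⟩ := exists_whitney_osc_const (a := a) hn hK hC₀ hα hC₁
  obtain ⟨c, hc, hnorm⟩ := exists_le_norm_of_dist_le (n := n) (K := K) (a := a) (C₁ := C₁) hC₀ hα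
    (show 0 ≤ 2 + κ by positivity) one_pos
  obtain ⟨N, hN⟩ := exists_nat_ge (4 * n * (2 + κ))
  have hn0 : (0 : ℝ) < n := by exact_mod_cast (show 0 < n by omega)
  have hN0 : (0 : ℝ) < N := lt_of_lt_of_le (by positivity) hN
  refine ⟨N * (C * ENNReal.ofReal c⁻¹), ENNReal.mul_ne_top (ENNReal.natCast_ne_top N)
    (ENNReal.mul_ne_top hC ENNReal.ofReal_ne_top), fun f hf ω hω x hx => ?_⟩
  set r := ‖x‖ with hr
  have hr0 : 0 ≤ r := norm_nonneg x
  have hr1 : 0 < 1 - r := sub_pos.2 (mem_ball_zero_iff.1 hx.1)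
  have hω1 : ‖ω‖ = 1 := mem_sphere_zero_iff_norm.1 hω
  have hrω : ‖r • ω‖ = r := norm_smul_unitSphere hω hr0
  have hrωω : ‖r • ω - ω‖ = 1 - r := by
    rw [show r • ω - ω = -((1 - r) • ω) by module, norm_neg, norm_smul, hω1, mul_one,
      Real.norm_of_nonneg hr1.le]
  have hxr : ‖x - r • ω‖ ≤ (2 + κ) * (1 - r) := by
    have h1 : ‖x - ω‖ < (1 + κ) * (1 - r) := hx.2
    rw [show x - r • ω = (x - ω) - (r • ω - ω) by abel]
    linarith [norm_sub_le (x - ω) (r • ω - ω)]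
  set y : ℕ → Vec n := fun j => r • ω + ((j : ℝ) / N) • (x - r • ω) with hy
  have hy0 : y 0 = r • ω := by simp [hy]
  have hyN : y N = x := by simp [hy, div_self hN0.ne']
  have hfrac : ∀ j ≤ N, 0 ≤ (j : ℝ) / N ∧ (j : ℝ) / N ≤ 1 := fun j hj =>
    ⟨by positivity, (div_le_one hN0).2 (by exact_mod_cast hj)⟩
  have hyr : ∀ j ≤ N, ‖y j‖ ≤ r := fun j hj => by
    obtain ⟨h1, h2⟩ := hfrac j hj
    have h3 : y j = (1 - (j : ℝ) / N) • (r • ω) + ((j : ℝ) / N) • x := by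
      simp only [hy]; module
    rw [h3]
    refine (norm_add_le _ _).trans ?_
    rw [norm_smul _ (r • ω), norm_smul _ x, hrω, ← hr, Real.norm_of_nonneg h1,
      Real.norm_of_nonneg (sub_nonneg.2 h2)]
    exact le_of_eq (by ring)
  have hyd : ∀ j ≤ N, dist (y j) (r • ω) ≤ (2 + κ) * (1 - r) := fun j hj => by
    obtain ⟨h1, h2⟩ := hfrac j hj
    rw [dist_eq_norm, show y j - r • ω = ((j : ℝ) / N) • (x - r • ω) by simp [hy], norm_smul,
      Real.norm_of_nonneg h1]
    exact (mul_le_of_le_one_left (norm_nonneg _) h2).trans hxr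
  have hyball : ∀ j ≤ N, y j ∈ unitBall n := fun j hj =>
    mem_ball_zero_iff.2 (by linarith [hyr j hj])
  set I := ∫⁻ z in ntRegion n (9 + 3 * κ) ω ∩ closedBall ω (2 * (3 + κ) * (1 - r)),
    logGrad n f z ^ n with hI
  have hstep : ∀ j < N, ‖f (y (j + 1)) - f (y j)‖ₑ ≤
      C * ENNReal.ofReal c⁻¹ * ‖f (r • ω)‖ₑ * I ^ (1 / (n : ℝ)) := fun j hj => by
    have hyj := hyr j hj.le
    have hdist : dist (y (j + 1)) (y j) ≤ (1 - ‖y j‖) / (4 * n) := by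
      rw [dist_eq_norm, show y (j + 1) - y j = (1 / (N : ℝ)) • (x - r • ω) by
        simp only [hy, Nat.cast_add, Nat.cast_one]; module, norm_smul,
        Real.norm_of_nonneg (by positivity), le_div_iff₀ (by positivity)]
      calc 1 / (N : ℝ) * ‖x - r • ω‖ * (4 * n) ≤ 1 / (N : ℝ) * ((2 + κ) * (1 - r)) * (4 * n) := by
            gcongr
        _ = (4 * n * (2 + κ)) / N * (1 - r) := by ring
        _ ≤ 1 * (1 - r) := by
            gcongr
            exact (div_le_one hN0).2 hN
        _ ≤ 1 - ‖y j‖ := by linarith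
    refine (hosc f hf (y j) (hyball j hj.le) _ hdist).trans ?_
    have hharn : ‖f (y j)‖ₑ ≤ ENNReal.ofReal c⁻¹ * ‖f (r • ω)‖ₑ := by
      have h1 := (hnorm f hf (r • ω) (smul_mem_unitBall hω hr0 (by linarith)) (y j)
        (hyball j hj.le) (by rw [hrω]; exact hyd j hj.le) (by rw [hrω]; linarith)).2
      rw [← ofReal_norm, ← ofReal_norm, ← ENNReal.ofReal_mul (by positivity)]
      refine ENNReal.ofReal_le_ofReal ?_
      rwa [inv_mul_eq_div, le_div_iff₀' hc]
    have hsub : closedBall (y j) ((1 - ‖y j‖) / 2) ⊆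
        ntRegion n (9 + 3 * κ) ω ∩ closedBall ω (2 * (3 + κ) * (1 - r)) := fun z hz => by
      have h1 : ‖z - y j‖ ≤ (1 - ‖y j‖) / 2 := by rwa [← dist_eq_norm]
      have h2 : ‖y j - ω‖ ≤ (3 + κ) * (1 - r) := by
        have := hyd j hj.le
        rw [dist_eq_norm] at this
        rw [show y j - ω = (y j - r • ω) + (r • ω - ω) by abel]
        linarith [norm_add_le (y j - r • ω) (r • ω - ω)]
      have h3 : 1 - ‖y j‖ ≤ ‖y j - ω‖ := by
        have := norm_sub_norm_le ω (y j)
        rwa [hω1, norm_sub_rev] at this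
      have h4 : ‖z - ω‖ ≤ ‖z - y j‖ + ‖y j - ω‖ := norm_sub_le_norm_sub_add_norm_sub _ _ _
      have h5 : ‖z‖ - ‖y j‖ ≤ ‖z - y j‖ := norm_sub_norm_le _ _
      have h6 : 0 < (3 + κ) * (1 - r) := by positivity
      have h7 : (1 - r) / 2 ≤ 1 - ‖z‖ := by linarith
      refine ⟨⟨mem_ball_zero_iff.2 (by linarith), ?_⟩, ?_⟩
      · nlinarith
      · rw [mem_closedBall, dist_eq_norm]; linarith
    calc C * ‖f (y j)‖ₑ * (∫⁻ x in closedBall (y j) ((1 - ‖y j‖) / 2),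
            logGrad n f x ^ n) ^ (1 / (n : ℝ))
        ≤ C * (ENNReal.ofReal c⁻¹ * ‖f (r • ω)‖ₑ) * I ^ (1 / (n : ℝ)) := by
          gcongr
          exact lintegral_mono_set hsub
      _ = _ := by ring
  calc ‖f x - f (r • ω)‖ₑ = ‖∑ j ∈ Finset.range N, (f (y (j + 1)) - f (y j))‖ₑ := by
        rw [Finset.sum_range_sub (fun j => f (y j)), hyN, hy0]
    _ ≤ ∑ j ∈ Finset.range N, ‖f (y (j + 1)) - f (y j)‖ₑ := enorm_sum_le _ _
    _ ≤ ∑ _j ∈ Finset.range N, C * ENNReal.ofReal c⁻¹ * ‖f (r • ω)‖ₑ * I ^ (1 / (n : ℝ)) :=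
        Finset.sum_le_sum fun j hj => hstep j (Finset.mem_range.1 hj)
    _ = _ := by rw [Finset.sum_const, Finset.card_range, nsmul_eq_mul]; ring

theorem tendsto_norm_ntRegion {n : ℕ} (κ : ℝ) {ω : Vec n} (hω : ω ∈ unitSphere n) :
    Tendsto (fun x : Vec n => ‖x‖) (𝓝[ntRegion n κ ω] ω) (𝓝[<] 1) := by
  refine tendsto_nhdsWithin_iff.2 ⟨?_, ?_⟩
  · have h := (continuous_norm (E := Vec n)).tendsto ω
    rw [mem_sphere_zero_iff_norm.1 hω] at h
    exact h.mono_left nhdsWithin_le_nhds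
  · filter_upwards [self_mem_nhdsWithin] with x hx
    exact mem_ball_zero_iff.1 hx.1

theorem hasNTLimit_of_radial {n : ℕ} (hn : 2 ≤ n) {K C₀ α a C₁ κ : ℝ} (hK : 1 ≤ K)
    (hC₀ : 1 ≤ C₀) (hα : 0 < α) (hC₁ : 0 < C₁) (hκ : 0 < κ) {f : Vec n → Vec n}
    (hf : IsHardyMap n K C₀ α a C₁ f) {ω L : Vec n} (hω : ω ∈ unitSphere n)
    (hint : ∫⁻ x in ntRegion n (9 + 3 * κ) ω, logGrad n f x ^ n < ⊤)
    (hL : Tendsto (fun t : ℝ => f (t • ω)) (𝓝[<] 1) (𝓝 L)) : HasNTLimit n κ f ω L := by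
  obtain ⟨C, hC, hosc⟩ := exists_ntRegion_osc_const (a := a) hn hK hC₀ hα hC₁ hκ
  have hlim := tendsto_norm_ntRegion κ hω
  have hfω := hL.comp hlim
  have hn0 : (0 : ℝ) < n := by exact_mod_cast (show 0 < n by omega)
  have hvol : Tendsto (fun s : ℝ => volume (closedBall ω s)) (𝓝[>] 0) (𝓝 0) := by
    have h : Tendsto (fun s : ℝ => ENNReal.ofReal (s ^ n) * volume (ball (0 : Vec n) 1)) (𝓝 0)
        (𝓝 (ENNReal.ofReal (0 ^ n) * volume (ball (0 : Vec n) 1))) :=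
      ENNReal.Tendsto.mul_const
        ((ENNReal.continuous_ofReal.comp (continuous_pow n)).tendsto 0)
        (Or.inr measure_ball_lt_top.ne)
    rw [zero_pow (show n ≠ 0 by omega), ENNReal.ofReal_zero, zero_mul] at h
    refine (h.mono_left nhdsWithin_le_nhds).congr' ?_
    filter_upwards [self_mem_nhdsWithin] with s hs
    rw [Measure.addHaar_closedBall _ _ (le_of_lt hs), finrank_euclideanSpace_fin]
  have hrad : Tendsto (fun x : Vec n => 2 * (3 + κ) * (1 - ‖x‖)) (𝓝[ntRegion n κ ω] ω)
      (𝓝[>] 0) := by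
    refine tendsto_nhdsWithin_iff.2 ⟨?_, ?_⟩
    · have h := (tendsto_nhdsWithin_iff.1 hlim).1
      have h2 := (h.const_sub 1).const_mul (2 * (3 + κ))
      rwa [sub_self, mul_zero] at h2
    · filter_upwards [self_mem_nhdsWithin] with x hx
      have : 0 < 1 - ‖x‖ := sub_pos.2 (mem_ball_zero_iff.1 hx.1)
      exact mem_Ioi.2 (by positivity)
  have hI : Tendsto (fun x : Vec n =>
      ∫⁻ z in ntRegion n (9 + 3 * κ) ω ∩ closedBall ω (2 * (3 + κ) * (1 - ‖x‖)),
        logGrad n f z ^ n) (𝓝[ntRegion n κ ω] ω) (𝓝 0) := by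
    have h := tendsto_setLIntegral_zero (μ := volume.restrict (ntRegion n (9 + 3 * κ) ω))
      (f := fun z => logGrad n f z ^ n) hint.ne
      (s := fun x : Vec n => closedBall ω (2 * (3 + κ) * (1 - ‖x‖)))
      (l := 𝓝[ntRegion n κ ω] ω)
      (tendsto_of_tendsto_of_tendsto_of_le_of_le tendsto_const_nhds (hvol.comp hrad)
        (fun _ => zero_le) (fun x => Measure.restrict_le_self _))
    refine h.congr fun x => ?_
    rw [Measure.restrict_restrict measurableSet_closedBall, inter_comm]
  have hzero : Tendsto (fun x => C * ‖f (‖x‖ • ω)‖ₑ *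
      (∫⁻ z in ntRegion n (9 + 3 * κ) ω ∩ closedBall ω (2 * (3 + κ) * (1 - ‖x‖)),
        logGrad n f z ^ n) ^ (1 / (n : ℝ))) (𝓝[ntRegion n κ ω] ω) (𝓝 0) := by
    have h1 : Tendsto (fun x : Vec n => C * ‖f (‖x‖ • ω)‖ₑ) (𝓝[ntRegion n κ ω] ω)
        (𝓝 (C * ‖L‖ₑ)) := ENNReal.Tendsto.const_mul hfω.enorm (Or.inr hC)
    have h2 := hI.ennrpow_const (1 / (n : ℝ))
    rw [ENNReal.zero_rpow_of_pos (by positivity)] at h2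
    have h3 := ENNReal.Tendsto.mul h1 (Or.inr ENNReal.zero_ne_top) h2
      (Or.inr (ENNReal.mul_ne_top hC enorm_ne_top))
    rwa [mul_zero] at h3
  have hdiff : Tendsto (fun x => f x - f (‖x‖ • ω)) (𝓝[ntRegion n κ ω] ω) (𝓝 0) := by
    rw [tendsto_zero_iff_enorm_tendsto_zero]
    refine tendsto_of_tendsto_of_tendsto_of_le_of_le' tendsto_const_nhds hzero
      (Eventually.of_forall fun _ => zero_le) ?_
    filter_upwards [self_mem_nhdsWithin] with x hx
    exact hosc f hf ω hω x hx
  have h := hdiff.add hfω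
  rw [zero_add] at h
  exact h.congr fun x => sub_add_cancel _ _

theorem HasNTLimit.tendsto_radial {n : ℕ} {κ : ℝ} (hκ : 0 < κ) {f : Vec n → Vec n} {ω L : Vec n}
    (hω : ω ∈ unitSphere n) (h : HasNTLimit n κ f ω L) :
    Tendsto (fun t : ℝ => f (t • ω)) (𝓝[<] 1) (𝓝 L) := by
  have h1 : Tendsto (fun t : ℝ => t • ω) (𝓝[<] 1) (𝓝[ntRegion n κ ω] ω) := by
    refine tendsto_nhdsWithin_iff.2 ⟨?_, ?_⟩
    · have h2 : Continuous fun t : ℝ => t • ω := by fun_prop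
      have h3 := h2.tendsto 1
      simp only [one_smul] at h3
      exact h3.mono_left nhdsWithin_le_nhds
    · filter_upwards [Ioo_mem_nhdsLT (zero_lt_one' ℝ)] with t ht
      exact smul_mem_ntRegion hκ hω ht.1.le ht.2
  exact Tendsto.comp h h1

theorem ae_exists_hasNTLimit {n : ℕ} (hn : 2 ≤ n) {K C₀ α a C₁ κ : ℝ} (hK : 1 ≤ K)
    (hC₀ : 1 ≤ C₀) (hα : 0 < α) (ha0 : 0 ≤ a) (ha : a < (n : ℝ) - 1) (hC₁ : 0 < C₁) (hκ : 0 < κ)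
    {f : Vec n → Vec n} (hf : IsHardyMap n K C₀ α a C₁ f) :
    ∀ᵐ ω ∂(polarSphere n), ∃ L, HasNTLimit n κ f ω L := by
  filter_upwards [ae_polarSphere_mem_unitSphere n,
    ae_radialVar_lt_top hn hK hC₀ hα ha0 ha hC₁ hf,
    ae_lintegral_ntRegion_lt_top hn hK hC₀ hα ha0 ha hC₁
      (show 0 < 9 + 3 * κ by positivity) hf] with ω hω hV hint
  obtain ⟨L, hL⟩ := exists_radial_limit hf hω hV
  exact ⟨L, hasNTLimit_of_radial hn hK hC₀ hα hC₁ hκ hf hω hint hL⟩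

theorem sphMeasure_unitSphere_ne_top {n : ℕ} (hn : 2 ≤ n) : sphMeasure n (unitSphere n) ≠ ⊤ := by
  obtain ⟨C, hC, hle⟩ := exists_sphMeasure_le_smul hn
  refine ne_top_of_le_ne_top ?_ (hle (unitSphere n))
  rw [Measure.smul_apply, smul_eq_mul]
  exact ENNReal.mul_ne_top hC (measure_ne_top _ _)

theorem sphMeasure_unitSphere_ne_zero {n : ℕ} (hn : 2 ≤ n) : sphMeasure n (unitSphere n) ≠ 0 := by
  intro h0
  obtain ⟨C, -, hle⟩ := exists_polarSphere_le_smul hn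
  obtain ⟨c, hc, hball⟩ := exists_le_polarSphere_closedBall (show 1 ≤ n by omega)
  have hσ : sphMeasure n = 0 := by
    rwa [sphMeasure, Measure.restrict_apply_self, ← Measure.restrict_eq_zero] at h0
  have hν : polarSphere n = 0 := by
    rw [hσ, smul_zero] at hle
    exact le_antisymm hle (Measure.zero_le _)
  have hω : EuclideanSpace.single (⟨0, by omega⟩ : Fin n) (1 : ℝ) ∈ unitSphere n := by
    simp [unitSphere]
  have h1 := hball _ hω 1 one_pos one_le_two
  rw [hν, one_pow, mul_one, Measure.coe_zero, Pi.zero_apply] at h1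
  exact (ENNReal.ofReal_pos.2 hc).not_ge h1

theorem ae_sphMeasure_mem_unitSphere (n : ℕ) : ∀ᵐ ω ∂(sphMeasure n), ω ∈ unitSphere n :=
  ae_restrict_mem isClosed_sphere.measurableSet

theorem hardyNorm_le_ntMaxLp {n : ℕ} {κ p : ℝ} (hκ : 0 < κ) (hp : 0 < p) (f : Vec n → Vec n) :
    hardyNorm n p f ≤ (sphMeasure n (unitSphere n))⁻¹ ^ (1 / p) * ntMaxLp n κ p f := by
  have hp' : 0 ≤ 1 / p := by positivity
  rw [hardyNorm, ntMaxLp, ← ENNReal.mul_rpow_of_nonneg _ _ hp']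
  refine ENNReal.rpow_le_rpow (iSup₂_le fun r hr => ?_) hp'
  rw [hardyMean]
  refine mul_le_mul_right (lintegral_mono_ae ?_) _
  filter_upwards [ae_sphMeasure_mem_unitSphere n] with ω hω
  rw [← ENNReal.ofReal_rpow_of_nonneg (norm_nonneg _) hp.le]
  exact ENNReal.rpow_le_rpow (le_iSup₂_of_le (r • ω) (smul_mem_ntRegion hκ hω hr.1.le hr.2) le_rfl)
    hp.le

theorem lpSphere_le_hardyNorm {n : ℕ} (hn : 2 ≤ n) {κ p : ℝ} (hκ : 0 < κ) (hp : 0 < p)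
    {f g : Vec n → Vec n} (hf : ContinuousOn f (unitBall n))
    (hg : ∀ᵐ ω ∂(sphMeasure n), HasNTLimit n κ f ω (g ω)) :
    lpSphere n p g ≤ sphMeasure n (unitSphere n) ^ (1 / p) * hardyNorm n p f := by
  have hp' : 0 ≤ 1 / p := by positivity
  rw [lpSphere, hardyNorm, ← ENNReal.mul_rpow_of_nonneg _ _ hp']
  refine ENNReal.rpow_le_rpow ?_ hp'
  obtain ⟨u, -, hu, hu1⟩ := exists_seq_strictMono_tendsto' (zero_lt_one' ℝ)
  have hu2 : Tendsto u atTop (𝓝[<] 1) :=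
    tendsto_nhdsWithin_iff.2 ⟨hu1, Eventually.of_forall fun k => (hu k).2⟩
  have hmeas : ∀ k, AEMeasurable (fun ω => ENNReal.ofReal (‖f (u k • ω)‖ ^ p)) (sphMeasure n) :=
    fun k => by
      have hc : ContinuousOn (fun ω => f (u k • ω)) (unitSphere n) :=
        hf.comp (by fun_prop) fun ω hω => smul_mem_unitBall hω (hu k).1.le (hu k).2
      have h := hc.aemeasurable (μ := μH[(n : ℝ) - 1]) isClosed_sphere.measurableSet
      exact (h.norm.pow_const p).ennreal_ofReal
  calc ∫⁻ ω, ENNReal.ofReal (‖g ω‖ ^ p) ∂(sphMeasure n)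
      = ∫⁻ ω, liminf (fun k => ENNReal.ofReal (‖f (u k • ω)‖ ^ p)) atTop ∂(sphMeasure n) := by
        refine lintegral_congr_ae ?_
        filter_upwards [ae_sphMeasure_mem_unitSphere n, hg] with ω hω hL
        have h1 := ((hL.tendsto_radial hκ hω).comp hu2).norm.rpow_const (Or.inr hp.le)
        exact ((ENNReal.continuous_ofReal.tendsto _).comp h1).liminf_eq.symm
    _ ≤ liminf (fun k => ∫⁻ ω, ENNReal.ofReal (‖f (u k • ω)‖ ^ p) ∂(sphMeasure n)) atTop :=
        lintegral_liminf_le' hmeas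
    _ ≤ sphMeasure n (unitSphere n) * ⨆ r ∈ Ioo (0 : ℝ) 1, hardyMean n p f r := by
        refine liminf_le_of_le (h := fun b hb => ?_)
        obtain ⟨k, hk⟩ := hb.exists
        refine hk.trans ?_
        have h1 : hardyMean n p f (u k) ≤ ⨆ r ∈ Ioo (0 : ℝ) 1, hardyMean n p f r :=
          le_iSup₂_of_le (u k) (hu k) le_rfl
        refine le_trans (le_of_eq ?_) (mul_le_mul_right h1 _)
        rw [hardyMean, ← mul_assoc, ENNReal.mul_inv_cancel (sphMeasure_unitSphere_ne_zero hn)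
          (sphMeasure_unitSphere_ne_top hn), one_mul]

theorem exists_ntMaxLp_le_lpSphere {n : ℕ} (hn : 2 ≤ n) {K C₀ α a C₁ κ p : ℝ} (hK : 1 ≤ K)
    (hC₀ : 1 ≤ C₀) (hα : 0 < α) (ha0 : 0 ≤ a) (ha : a < (n : ℝ) - 1) (hC₁ : 0 < C₁) (hκ : 0 < κ)
    (hp : 0 < p) :
    ∃ C : ℝ≥0∞, C ≠ ⊤ ∧ ∀ f : Vec n → Vec n, IsHardyMap n K C₀ α a C₁ f → ∀ g : Vec n → Vec n,
      (∀ᵐ ω ∂(sphMeasure n), HasNTLimit n κ f ω (g ω)) →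
        ntMaxLp n κ p f ≤ C * lpSphere n p g := by
  obtain ⟨C, hC, hmax⟩ := exists_ntMax_const hn hK hC₀ hα ha0 ha hC₁ hκ hp
  obtain ⟨D, hD, hνσ⟩ := exists_polarSphere_le_smul hn
  obtain ⟨E, hE, hσν⟩ := exists_sphMeasure_le_smul hn
  have hp' : 0 ≤ 1 / p := by positivity
  refine ⟨(E * (C * D)) ^ (1 / p), ENNReal.rpow_ne_top_of_nonneg hp'
    (ENNReal.mul_ne_top hE (ENNReal.mul_ne_top hC hD)), fun f hf g hg => ?_⟩
  rw [ntMaxLp, lpSphere, ← ENNReal.mul_rpow_of_nonneg _ _ hp']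
  refine ENNReal.rpow_le_rpow ?_ hp'
  have hac : polarSphere n ≪ sphMeasure n := Measure.absolutelyContinuous_of_le_smul hνσ
  have hrad : ∀ᵐ ω ∂(polarSphere n), Tendsto (fun t : ℝ => f (t • ω)) (𝓝[<] 1) (𝓝 (g ω)) := by
    filter_upwards [ae_polarSphere_mem_unitSphere n, hac.ae_le hg] with ω hω h
    exact h.tendsto_radial hκ hω
  calc ∫⁻ ω, ntMax n κ f ω ^ p ∂(sphMeasure n)
      ≤ ∫⁻ ω, ntMax n κ f ω ^ p ∂(E • polarSphere n) := lintegral_mono' hσν le_rfl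
    _ = E * ∫⁻ ω, ntMax n κ f ω ^ p ∂(polarSphere n) := by rw [lintegral_smul_measure, smul_eq_mul]
    _ ≤ E * (C * ∫⁻ ω, ENNReal.ofReal (‖g ω‖ ^ p) ∂(polarSphere n)) := by
        gcongr
        exact hmax f hf g hrad
    _ ≤ E * (C * ∫⁻ ω, ENNReal.ofReal (‖g ω‖ ^ p) ∂(D • sphMeasure n)) := by
        gcongr
    _ = _ := by rw [lintegral_smul_measure, smul_eq_mul]; ring

theorem exists_ae_hasNTLimit {n : ℕ} (hn : 2 ≤ n) {K C₀ α a C₁ κ : ℝ} (hK : 1 ≤ K)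
    (hC₀ : 1 ≤ C₀) (hα : 0 < α) (ha0 : 0 ≤ a) (ha : a < (n : ℝ) - 1) (hC₁ : 0 < C₁) (hκ : 0 < κ)
    {f : Vec n → Vec n} (hf : IsHardyMap n K C₀ α a C₁ f) :
    ∃ g : Vec n → Vec n, ∀ᵐ ω ∂(sphMeasure n), HasNTLimit n κ f ω (g ω) := by
  obtain ⟨E, -, hσν⟩ := exists_sphMeasure_le_smul hn
  have hac : sphMeasure n ≪ polarSphere n := Measure.absolutelyContinuous_of_le_smul hσν
  have h := hac.ae_le (ae_exists_hasNTLimit hn hK hC₀ hα ha0 ha hC₁ hκ hf)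
  refine ⟨fun ω => if h : ∃ L, HasNTLimit n κ f ω L then h.choose else 0, ?_⟩
  filter_upwards [h] with ω hω
  rw [dif_pos hω]
  exact hω.choose_spec

theorem hardy_space_characterization (n : ℕ) (hn : 2 ≤ n)
    (K C₀ α a C₁ κ p : ℝ) (hK : 1 ≤ K) (hC₀ : 1 ≤ C₀) (hα : 0 < α)
    (ha0 : 0 ≤ a) (ha : a < (n : ℝ) - 1) (hC₁ : 0 < C₁) (hκ : 0 < κ) (hp : 0 < p) :
    (∀ f : Vec n → Vec n,
      IsQR n K f → (∀ x ∈ unitBall n, f x ≠ 0) →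
      InMiniowitz n C₀ α f → MultCond n a C₁ f →
      ((MemHp n p f ↔
          ∃ g : Vec n → Vec n,
            (∀ᵐ ω ∂(sphMeasure n), HasNTLimit n κ f ω (g ω)) ∧ lpSphere n p g < ⊤) ∧
        (MemHp n p f ↔ ntMaxLp n κ p f < ⊤))) ∧
    (∃ c : ℝ, 1 ≤ c ∧ ∀ f : Vec n → Vec n,
      IsQR n K f → (∀ x ∈ unitBall n, f x ≠ 0) →
      InMiniowitz n C₀ α f → MultCond n a C₁ f →
      ((hardyNorm n p f ≤ ENNReal.ofReal c * ntMaxLp n κ p f ∧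
        ntMaxLp n κ p f ≤ ENNReal.ofReal c * hardyNorm n p f) ∧
       ∀ g : Vec n → Vec n, (∀ᵐ ω ∂(sphMeasure n), HasNTLimit n κ f ω (g ω)) →
         (hardyNorm n p f ≤ ENNReal.ofReal c * lpSphere n p g ∧
          lpSphere n p g ≤ ENNReal.ofReal c * hardyNorm n p f))) := by
  obtain ⟨D, hD, hmax⟩ := exists_ntMaxLp_le_lpSphere hn hK hC₀ hα ha0 ha hC₁ hκ hp
  have hp' : 0 ≤ 1 / p := by positivity
  set A := (sphMeasure n (unitSphere n))⁻¹ ^ (1 / p) with hA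
  set B := sphMeasure n (unitSphere n) ^ (1 / p) with hB
  have hAt : A ≠ ⊤ := ENNReal.rpow_ne_top_of_nonneg hp'
    (ENNReal.inv_ne_top.2 (sphMeasure_unitSphere_ne_zero hn))
  have hBt : B ≠ ⊤ := ENNReal.rpow_ne_top_of_nonneg hp' (sphMeasure_unitSphere_ne_top hn)
  set M := 1 + A + B + D * B + A * D with hM
  have hMt : M ≠ ⊤ := by finiteness
  have hofM : ENNReal.ofReal M.toReal = M := ENNReal.ofReal_toReal hMt
  have h1M : 1 ≤ M := by
    simp only [hM, add_assoc]; exact le_self_add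
  have hAM : A ≤ M := by
    rw [show M = A + (1 + B + D * B + A * D) by rw [hM]; ring]; exact le_self_add
  have hBM : B ≤ M := by
    rw [show M = B + (1 + A + D * B + A * D) by rw [hM]; ring]; exact le_self_add
  have hDBM : D * B ≤ M := by
    rw [show M = D * B + (1 + A + B + A * D) by rw [hM]; ring]; exact le_self_add
  have hADM : A * D ≤ M := by
    rw [show M = A * D + (1 + A + B + D * B) by rw [hM]; ring]; exact le_self_add
  have main : ∀ f : Vec n → Vec n, IsHardyMap n K C₀ α a C₁ f →
      (hardyNorm n p f ≤ M * ntMaxLp n κ p f ∧ ntMaxLp n κ p f ≤ M * hardyNorm n p f) ∧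
      ∀ g : Vec n → Vec n, (∀ᵐ ω ∂(sphMeasure n), HasNTLimit n κ f ω (g ω)) →
        (hardyNorm n p f ≤ M * lpSphere n p g ∧ lpSphere n p g ≤ M * hardyNorm n p f) := by
    intro f hf
    have h1 : hardyNorm n p f ≤ A * ntMaxLp n κ p f := hardyNorm_le_ntMaxLp hκ hp f
    have h2 : ∀ g : Vec n → Vec n, (∀ᵐ ω ∂(sphMeasure n), HasNTLimit n κ f ω (g ω)) →
        lpSphere n p g ≤ B * hardyNorm n p f := fun g hg =>
      lpSphere_le_hardyNorm hn hκ hp hf.qr.1 hg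
    obtain ⟨g₀, hg₀⟩ := exists_ae_hasNTLimit hn hK hC₀ hα ha0 ha hC₁ hκ hf
    refine ⟨⟨h1.trans (by gcongr), ?_⟩, fun g hg => ⟨?_, (h2 g hg).trans (by gcongr)⟩⟩
    · calc ntMaxLp n κ p f ≤ D * lpSphere n p g₀ := hmax f hf g₀ hg₀
        _ ≤ D * (B * hardyNorm n p f) := by gcongr; exact h2 g₀ hg₀
        _ = D * B * hardyNorm n p f := by ring
        _ ≤ M * hardyNorm n p f := by gcongr
    · calc hardyNorm n p f ≤ A * ntMaxLp n κ p f := h1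
        _ ≤ A * (D * lpSphere n p g) := by gcongr; exact hmax f hf g hg
        _ = A * D * lpSphere n p g := by ring
        _ ≤ M * lpSphere n p g := by gcongr
  have hlt : ∀ {s t : ℝ≥0∞}, s ≤ M * t → t < ⊤ → s < ⊤ := fun h ht =>
    h.trans_lt (ENNReal.mul_lt_top hMt.lt_top ht)
  refine ⟨fun f hqr hne hmin hmul => ?_, M.toReal, ?_, fun f hqr hne hmin hmul => ?_⟩
  · have hf : IsHardyMap n K C₀ α a C₁ f := ⟨hqr, hne, hmin, hmul⟩
    obtain ⟨⟨h1, h2⟩, h3⟩ := main f hf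
    obtain ⟨g₀, hg₀⟩ := exists_ae_hasNTLimit hn hK hC₀ hα ha0 ha hC₁ hκ hf
    exact ⟨⟨fun h => ⟨g₀, hg₀, hlt (h3 g₀ hg₀).2 h⟩, fun ⟨g, hg, h⟩ => hlt (h3 g hg).1 h⟩,
      fun h => hlt h2 h, fun h => hlt h1 h⟩
  · rw [← ENNReal.toReal_one]
    exact ENNReal.toReal_mono hMt h1M
  · rw [hofM]
    exact main f ⟨hqr, hne, hmin, hmul⟩

end
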